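/- Suppose f is of Allee type (f_A), δ ∈ (θ*_f, 1), and (c*, q*) is a semi-wave pair for (f, δ, d). Let (u,g,h) be a classical solution of the free boundary problem (a) with initial datum u₀ ∈ X(h₀) on [0,∞). Then there exist constants ĥ, ĝ ∈ ℝ such that, as t → ∞: h(t) − c*·t → ĥ, h'(t) → c*, g(t) + c*·t → ĝ, and g'(t) → −c*. -/

import Mathlib

open Set Filter

/-- A function `f` is of Allee type `(f_A)` with distinguished zero `θ ∈ [0,1)`. -/
def AlleeType (f : ℝ → ℝ) (θ : ℝ) : Prop :=
  ContDiffOn ℝ 1 f (Ici (0:ℝ)) ∧ θ ∈ Ico (0:ℝ) 1 ∧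
    f 0 = 0 ∧ f θ = 0 ∧ f 1 = 0 ∧
    derivWithin f (Ici (0:ℝ)) 0 ≤ 0 ∧ derivWithin f (Ici (0:ℝ)) 1 < 0 ∧
    (∀ u ∈ Icc (0:ℝ) θ, f u ≤ 0) ∧ (∀ u ∈ Ioo θ (1:ℝ), 0 < f u) ∧
    (∀ u ∈ Ioi (1:ℝ), f u < 0) ∧ 0 < ∫ s in (0:ℝ)..1, f s

/-- `θs` is the number `θ*_f ∈ [θ,1)` attached to an Allee type `f`. -/
def IsThetaStar (f : ℝ → ℝ) (θ θs : ℝ) : Prop :=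
  θs ∈ Ico θ (1:ℝ) ∧ (∫ s in (0:ℝ)..θs, f s) = 0 ∧
    ∀ u ∈ Ioc θs (1:ℝ), 0 < ∫ s in (0:ℝ)..u, f s

/-- Membership in the initial class `X(h₀)`. -/
def InX (δ h₀ : ℝ) (φ : ℝ → ℝ) : Prop :=
  ContDiffOn ℝ 2 φ (Icc (-h₀) h₀) ∧ φ (-h₀) = δ ∧ φ h₀ = δ ∧
    ∀ x ∈ Icc (-h₀) h₀, 0 < φ x

/-- A classical solution `(u,g,h)` of the free boundary problem (with reaction
term `f = f(t,x,u)`) with initial datum `u₀ ∈ X(h₀)` on the time interval `I`. -/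
structure ClassicalSolution (d δ h₀ : ℝ) (f : ℝ → ℝ → ℝ → ℝ) (u₀ : ℝ → ℝ)
    (I : Set ℝ) (u : ℝ → ℝ → ℝ) (g h : ℝ → ℝ) : Prop where
  g_reg : ContDiffOn ℝ 1 g I
  h_reg : ContDiffOn ℝ 1 h I
  g_lt_h : ∀ t ∈ I, g t < h t
  u_cont : ContinuousOn (fun p : ℝ × ℝ => u p.1 p.2)
      {p : ℝ × ℝ | p.1 ∈ I ∧ p.2 ∈ Icc (g p.1) (h p.1)}
  ux_cont : ContinuousOn (fun p : ℝ × ℝ => deriv (u p.1) p.2)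
      {p : ℝ × ℝ | p.1 ∈ I ∧ 0 < p.1 ∧ p.2 ∈ Icc (g p.1) (h p.1)}
  ut_diff : ∀ t ∈ I, 0 < t → ∀ x ∈ Ioo (g t) (h t),
      DifferentiableAt ℝ (fun s => u s x) t
  ux_diff : ∀ t ∈ I, 0 < t → ∀ x ∈ Icc (g t) (h t), DifferentiableAt ℝ (u t) x
  uxx_diff : ∀ t ∈ I, 0 < t → ∀ x ∈ Ioo (g t) (h t),
      DifferentiableAt ℝ (deriv (u t)) x
  ut_cont : ContinuousOn (fun p : ℝ × ℝ => deriv (fun s => u s p.2) p.1)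
      {p : ℝ × ℝ | p.1 ∈ I ∧ 0 < p.1 ∧ p.2 ∈ Ioo (g p.1) (h p.1)}
  uxx_cont : ContinuousOn (fun p : ℝ × ℝ => deriv (deriv (u p.1)) p.2)
      {p : ℝ × ℝ | p.1 ∈ I ∧ 0 < p.1 ∧ p.2 ∈ Ioo (g p.1) (h p.1)}
  pde : ∀ t ∈ I, 0 < t → ∀ x ∈ Ioo (g t) (h t),
      deriv (fun s => u s x) t = d * deriv (deriv (u t)) x + f t x (u t x)
  bc_g : ∀ t ∈ I, 0 < t → u t (g t) = δ
  bc_h : ∀ t ∈ I, 0 < t → u t (h t) = δ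
  stefan_g : ∀ t ∈ I, 0 < t → deriv g t = -(d / δ) * deriv (u t) (g t)
  stefan_h : ∀ t ∈ I, 0 < t → deriv h t = -(d / δ) * deriv (u t) (h t)
  g_init : g 0 = -h₀
  h_init : h 0 = h₀
  u_init : ∀ x ∈ Icc (-h₀) h₀, u 0 x = u₀ x

/-- A semi-wave pair `(c,q)` for `(f, δ, d)`. -/
def SemiWavePair (d δ : ℝ) (f : ℝ → ℝ) (c : ℝ) (q : ℝ → ℝ) : Prop :=
  0 < c ∧ ContDiffOn ℝ 2 q (Ici (0:ℝ)) ∧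
    (∀ z ∈ Ici (0:ℝ),
      d * derivWithin (derivWithin q (Ici (0:ℝ))) (Ici (0:ℝ)) z
        - c * derivWithin q (Ici (0:ℝ)) z + f (q z) = 0) ∧
    (∀ z ∈ Ioi (0:ℝ), 0 < q z) ∧ q 0 = δ ∧
    Tendsto q atTop (nhds 1) ∧
    derivWithin q (Ici (0:ℝ)) 0 = c * δ / d ∧
    ∀ z ∈ Ici (0:ℝ), 0 < derivWithin q (Ici (0:ℝ)) z

/-- Condition `(f2)` with Hölder exponent `β`. -/
def CondF2 (f : ℝ → ℝ → ℝ → ℝ) (β : ℝ) : Prop :=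
  β ∈ Ioo (0:ℝ) 1 ∧
    (∀ M > 0, ∃ C > 0, ∀ t₁ ∈ Ici (0:ℝ), ∀ t₂ ∈ Ici (0:ℝ), ∀ x₁ x₂ : ℝ,
        ∀ v ∈ Icc (0:ℝ) M,
        |f t₁ x₁ v - f t₂ x₂ v| ≤ C * (|t₁ - t₂| ^ (β / 2) + |x₁ - x₂| ^ β)) ∧
    (∀ t ∈ Ici (0:ℝ), ∀ x : ℝ, ContDiffOn ℝ 1 (f t x) (Ici (0:ℝ))) ∧
    (∀ t ∈ Ici (0:ℝ), ∀ x : ℝ, f t x 0 = 0) ∧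
    (∀ M > 0, ∃ L > 0, ∀ t ∈ Ici (0:ℝ), ∀ x : ℝ,
        ∀ v₁ ∈ Icc (0:ℝ) M, ∀ v₂ ∈ Icc (0:ℝ) M,
        |f t x v₁ - f t x v₂| ≤ L * |v₁ - v₂|)

/-- Condition `(f3)` with constant `M₀`. -/
def CondF3 (f : ℝ → ℝ → ℝ → ℝ) (M₀ : ℝ) : Prop :=
  0 < M₀ ∧ ∀ t ∈ Ici (0:ℝ), ∀ x : ℝ, ∀ v, M₀ ≤ v → f t x v < 0

/-- Part (i) of condition `(f4)`, with upper bound function `fbar`. -/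
def CondF4i (f : ℝ → ℝ → ℝ → ℝ) (fbar : ℝ → ℝ) (β : ℝ) : Prop :=
  CondF2 f β ∧ (∀ t ∈ Ici (0:ℝ), ∀ x : ℝ, f t x 1 = 0) ∧
    ContinuousOn fbar (Ici (1:ℝ)) ∧
    ∀ t ∈ Ici (0:ℝ), ∀ x : ℝ, ∀ v, 1 < v → f t x v ≤ fbar v ∧ fbar v < 0

/-- Condition `(f4)`, with bounds `fbar` (above, for `u > 1`) and
`funder` (below, of Allee type). -/
def CondF4 (f : ℝ → ℝ → ℝ → ℝ) (fbar funder : ℝ → ℝ) (θ β : ℝ) : Prop :=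
  CondF4i f fbar β ∧ AlleeType funder θ ∧
    ∀ t ∈ Ici (0:ℝ), ∀ x : ℝ, ∀ v, 0 ≤ v → funder v ≤ f t x v

/-- Combustion-type nonlinearity `(f_c)` with ignition value `θ`. -/
def CombustionType (f : ℝ → ℝ) (θ : ℝ) : Prop :=
  ContDiffOn ℝ 1 f (Ici (0:ℝ)) ∧ θ ∈ Ioo (0:ℝ) 1 ∧
    (∀ u ∈ Icc (0:ℝ) θ, f u = 0) ∧ f 1 = 0 ∧ derivWithin f (Ici (0:ℝ)) 1 < 0 ∧
    (∀ u ∈ Ioo θ (1:ℝ), 0 < f u) ∧ (∀ u ∈ Ioi (1:ℝ), f u < 0)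

/-- The (unnormalised) bistable condition `(F_b)` with constants `0 < P < Q`. -/
def CondFb (F : ℝ → ℝ) (P Q : ℝ) : Prop :=
  0 < P ∧ P < Q ∧ ContDiffOn ℝ 1 F (Ici (0:ℝ)) ∧
    F 0 = 0 ∧ F P = 0 ∧ F Q = 0 ∧
    derivWithin F (Ici (0:ℝ)) 0 < 0 ∧ derivWithin F (Ici (0:ℝ)) Q < 0 ∧
    (∀ u ∈ Ioo (0:ℝ) P, F u < 0) ∧ (∀ u ∈ Ioi Q, F u < 0) ∧
    (∀ u ∈ Ioo P Q, 0 < F u) ∧ 0 < ∫ s in (0:ℝ)..Q, F s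


open Set Filter Topology

namespace FA

/-! ### Calculus helpers -/

lemma deriv_nonpos_of_left {φ : ℝ → ℝ} {t a : ℝ} (hφ : HasDerivAt φ a t)
    (h : ∀ᶠ s in 𝓝[<] t, φ t ≤ φ s) : a ≤ 0 := by
  have h1 : Tendsto (slope φ t) (𝓝[<] t) (𝓝 a) :=
    (hasDerivAt_iff_tendsto_slope.mp hφ).mono_left
      (nhdsWithin_mono _ (fun x hx => ne_of_lt hx))
  refine le_of_tendsto h1 ?_
  filter_upwards [h, self_mem_nhdsWithin] with s hs hst
  have hst' : s < t := hst
  rw [slope_def_field]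
  exact div_nonpos_of_nonneg_of_nonpos (by linarith) (by linarith)

lemma second_deriv_nonneg {φ φ1 : ℝ → ℝ} {x a : ℝ}
    (h1 : ∀ᶠ y in 𝓝 x, HasDerivAt φ (φ1 y) y) (h2 : HasDerivAt φ1 a x)
    (hmin : ∀ᶠ y in 𝓝 x, φ x ≤ φ y) : 0 ≤ a := by
  by_contra hneg
  push Not at hneg
  have hloc : IsLocalMin φ x := hmin
  have hz : φ1 x = 0 := hloc.hasDerivAt_eq_zero h1.self_of_nhds
  -- φ1 < 0 on the right
  have hs : Tendsto (slope φ1 x) (𝓝[>] x) (𝓝 a) :=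
    (hasDerivAt_iff_tendsto_slope.mp h2).mono_left
      (nhdsWithin_mono _ (fun y hy => ne_of_gt hy))
  have hev : ∀ᶠ y in 𝓝[>] x, φ1 y < 0 := by
    filter_upwards [hs.eventually (gt_mem_nhds hneg), self_mem_nhdsWithin] with y hy hxy
    have hxy' : x < y := hxy
    rw [slope_def_field, hz, sub_zero] at hy
    by_contra hc
    push Not at hc
    have : 0 ≤ φ1 y / (y - x) := div_nonneg hc (by linarith)
    linarith
  have hall := (hev.and (nhdsWithin_le_nhds (h1.and hmin)))
  obtain ⟨y, hy, hyI⟩ := (mem_nhdsGT_iff_exists_Ioc_subset).mp hall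
  have hxy : x < y := hy
  have hcont : ContinuousOn φ (Icc x y) := by
    intro z hz'
    rcases eq_or_lt_of_le hz'.1 with h | h
    · rw [← h]; exact h1.self_of_nhds.continuousAt.continuousWithinAt
    · exact (hyI ⟨h, hz'.2⟩).2.1.continuousAt.continuousWithinAt
  obtain ⟨z, hz1, hz2⟩ := exists_hasDerivAt_eq_slope φ φ1 hxy hcont
    (fun z hz => (hyI ⟨hz.1, hz.2.le⟩).2.1)
  have hlt := (hyI ⟨hz1.1, hz1.2.le⟩).1
  have hge := (hyI ⟨hxy, le_refl y⟩).2.2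
  rw [hz2] at hlt
  have : 0 ≤ (φ y - φ x) / (y - x) := div_nonneg (by linarith) (by linarith)
  linarith

/-- First touch lemma. -/
lemma first_touch {X : Type*} [TopologicalSpace X] {Ω : Set (ℝ × X)} (hΩ : IsCompact Ω)
    {Z : ℝ × X → ℝ} (hZ : ContinuousOn Z Ω) [T2Space X]
    (hno : ∀ t x, (t, x) ∈ Ω → Z (t, x) ≤ 0 →
      (∀ s y, (s, y) ∈ Ω → s < t → 0 < Z (s, y)) →
      (∀ y, (t, y) ∈ Ω → Z (t, x) ≤ Z (t, y)) → False) :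
    ∀ p ∈ Ω, 0 < Z p := by
  by_contra hcon
  push Not at hcon
  obtain ⟨p0, hp0, hp0'⟩ := hcon
  have hK : IsCompact (Ω ∩ Z ⁻¹' Iic 0) := by
    obtain ⟨C, hC, hCe⟩ := (continuousOn_iff_isClosed.mp hZ) (Iic 0) isClosed_Iic
    have : Ω ∩ Z ⁻¹' Iic 0 = Ω ∩ C := by
      rw [inter_comm, hCe, inter_comm]
    rw [this]; exact hΩ.inter_right hC
  obtain ⟨⟨t, x1⟩, hp1, hmin1⟩ := hK.exists_isMinOn ⟨p0, hp0, hp0'⟩ continuous_fst.continuousOn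
  have hSl : IsCompact (Ω ∩ {p | p.1 = t}) :=
    hΩ.inter_right (isClosed_eq continuous_fst continuous_const)
  obtain ⟨⟨t2, x2⟩, hp2, hmin2⟩ := hSl.exists_isMinOn ⟨(t, x1), hp1.1, rfl⟩
    (hZ.mono inter_subset_left)
  obtain ⟨hp2a, hp2b⟩ := hp2
  have ht2 : t2 = t := hp2b
  subst ht2
  refine hno t2 x2 hp2a ?_ ?_ ?_
  · exact (isMinOn_iff.mp hmin2 _ ⟨hp1.1, rfl⟩).trans hp1.2
  · intro s y hs hst
    by_contra hc
    push Not at hc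
    have := isMinOn_iff.mp hmin1 _ ⟨hs, hc⟩
    simp at this
    linarith
  · intro y hy
    exact isMinOn_iff.mp hmin2 _ ⟨hy, rfl⟩

/-- scalar first touch -/
lemma first_zero {m : ℝ → ℝ} {T T' : ℝ} (hm : ContinuousOn m (Icc T T')) (h0 : 0 < m T)
    (hno : ∀ t ∈ Ioc T T', (∀ s ∈ Ico T t, 0 < m s) → m t = 0 → False) :
    ∀ t ∈ Icc T T', 0 < m t := by
  have hc : IsCompact ((Icc T T') ×ˢ (univ : Set Unit)) := isCompact_Icc.prod isCompact_univ
  have := first_touch (Z := fun p : ℝ × Unit => m p.1) hc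
    (hm.comp continuousOn_fst (fun p hp => hp.1)) (by
      intro t x hx hle hpos _
      have htT : T < t := by
        rcases eq_or_lt_of_le hx.1.1 with h | h
        · simp only at h hle; rw [← h] at hle; linarith
        · exact h
      have hpos' : ∀ s ∈ Ico T t, 0 < m s := fun s hs =>
        hpos s () ⟨⟨hs.1, hs.2.le.trans hx.1.2⟩, mem_univ _⟩ hs.2
      refine hno t ⟨htT, hx.1.2⟩ hpos' (le_antisymm hle ?_)
      have hct : Tendsto m (𝓝[Ico T t] t) (𝓝 (m t)) :=
        (hm t hx.1).mono_left (nhdsWithin_mono _ (fun s hs => ⟨hs.1, hs.2.le.trans hx.1.2⟩))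
      haveI : (𝓝[Ico T t] t).NeBot := by
        rw [nhdsWithin_Ico_eq_nhdsLT htT]; infer_instance
      refine ge_of_tendsto hct ?_
      filter_upwards [self_mem_nhdsWithin] with s hs
      exact (hpos' s hs).le)
  intro t ht
  exact this (t, ()) ⟨ht, mem_univ _⟩

/-! ### Cleaned solution structure -/

structure FB (d δ : ℝ) (f : ℝ → ℝ) (u : ℝ → ℝ → ℝ) (g h : ℝ → ℝ) : Prop where
  gc : ContinuousOn g (Ici 0)
  hc : ContinuousOn h (Ici 0)
  gh : ∀ t, 0 ≤ t → g t < h t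
  uc : ContinuousOn (fun p : ℝ × ℝ => u p.1 p.2) {p | 0 ≤ p.1 ∧ g p.1 ≤ p.2 ∧ p.2 ≤ h p.1}
  ut : ∀ t, 0 < t → ∀ x, g t < x → x < h t →
    HasDerivAt (fun s => u s x) (d * deriv (deriv (u t)) x + f (u t x)) t
  ux : ∀ t, 0 < t → ∀ x, g t ≤ x → x ≤ h t → HasDerivAt (u t) (deriv (u t) x) x
  uxx : ∀ t, 0 < t → ∀ x, g t < x → x < h t →
    HasDerivAt (deriv (u t)) (deriv (deriv (u t)) x) x
  bg : ∀ t, 0 ≤ t → u t (g t) = δ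
  bh : ∀ t, 0 ≤ t → u t (h t) = δ
  sg : ∀ t, 0 < t → HasDerivAt g (-(d / δ) * deriv (u t) (g t)) t
  sh : ∀ t, 0 < t → HasDerivAt h (-(d / δ) * deriv (u t) (h t)) t
  pos0 : ∀ x, g 0 ≤ x → x ≤ h 0 → 0 < u 0 x

lemma FB.reflect {d δ : ℝ} {f : ℝ → ℝ} {u : ℝ → ℝ → ℝ} {g h : ℝ → ℝ} (S : FB d δ f u g h) :
    FB d δ f (fun t x => u t (-x)) (fun t => -h t) (fun t => -g t) := by
  have e1 : ∀ t, deriv (fun x => u t (-x)) = fun x => -deriv (u t) (-x) := by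
    intro t; funext x; exact deriv_comp_neg (u t) x
  have e2 : ∀ t x, deriv (deriv (fun x => u t (-x))) x = deriv (deriv (u t)) (-x) := by
    intro t x
    rw [e1]
    have := deriv_comp_neg (deriv (u t)) x
    rw [deriv.fun_neg, this, neg_neg]
  refine ⟨S.hc.neg, S.gc.neg, fun t ht => neg_lt_neg (S.gh t ht), ?_, ?_, ?_, ?_, ?_, ?_, ?_, ?_, ?_⟩
  · refine S.uc.comp (f := fun p : ℝ × ℝ => (p.1, -p.2)) (by fun_prop) ?_
    rintro ⟨t, x⟩ ⟨h1, h2, h3⟩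
    exact ⟨h1, by simp only at *; linarith, by simp only at *; linarith⟩
  · intro t ht x h1 h2
    rw [e2]
    exact S.ut t ht (-x) (by linarith) (by linarith)
  · intro t ht x h1 h2
    rw [e1]
    have := (S.ux t ht (-x) (by linarith) (by linarith)).scomp x (hasDerivAt_neg x)
    simpa [Function.comp_def] using this
  · intro t ht x h1 h2
    rw [e2, e1]
    have := ((S.uxx t ht (-x) (by linarith) (by linarith)).scomp x (hasDerivAt_neg x)).fun_neg
    simpa [Function.comp_def] using this
  · intro t ht; simpa using S.bh t ht
  · intro t ht; simpa using S.bg t ht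
  · intro t ht
    have := (S.sh t ht).fun_neg
    rw [e1]; simpa using this
  · intro t ht
    have := (S.sg t ht).fun_neg
    rw [e1]; simpa using this
  · intro x h1 h2; exact S.pos0 (-x) (by linarith) (by linarith)

end FA

open Set Filter Topology

namespace FA

/-! ### Comparison principles -/

def SubAt (d : ℝ) (w : ℝ → ℝ → ℝ) (t x r : ℝ) : Prop :=
  ∃ (ψ : ℝ → ℝ → ℝ) (ψt : ℝ) (ψ1 : ℝ → ℝ) (ψxx : ℝ), ψ t x = w t x ∧
    (∀ᶠ s in 𝓝[<] t, ψ s x ≤ w s x) ∧ (∀ᶠ y in 𝓝 x, ψ t y ≤ w t y) ∧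
    HasDerivAt (fun s => ψ s x) ψt t ∧ (∀ᶠ y in 𝓝 x, HasDerivAt (ψ t) (ψ1 y) y) ∧
    HasDerivAt ψ1 ψxx x ∧ ψt < d * ψxx + r

lemma SubAt.smooth {d : ℝ} {w : ℝ → ℝ → ℝ} {t x r : ℝ} (wt : ℝ) (w1 : ℝ → ℝ) (wxx : ℝ)
    (h1 : HasDerivAt (fun s => w s x) wt t) (h2 : ∀ᶠ y in 𝓝 x, HasDerivAt (w t) (w1 y) y)
    (h3 : HasDerivAt w1 wxx x) (h4 : wt < d * wxx + r) : SubAt d w t x r :=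
  ⟨w, wt, w1, wxx, rfl, Eventually.of_forall fun _ => le_rfl,
    Eventually.of_forall fun _ => le_rfl, h1, h2, h3, h4⟩

def SupAt (d : ℝ) (w : ℝ → ℝ → ℝ) (t x r : ℝ) : Prop :=
  SubAt d (fun s y => - w s y) t x (-r)

lemma SupAt.smooth {d : ℝ} {w : ℝ → ℝ → ℝ} {t x r : ℝ} (wt : ℝ) (w1 : ℝ → ℝ) (wxx : ℝ)
    (h1 : HasDerivAt (fun s => w s x) wt t) (h2 : ∀ᶠ y in 𝓝 x, HasDerivAt (w t) (w1 y) y)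
    (h3 : HasDerivAt w1 wxx x) (h4 : d * wxx + r < wt) : SupAt d w t x r :=
  SubAt.smooth (-wt) (fun y => - w1 y) (-wxx) h1.fun_neg
    (h2.mono fun _ h => h.fun_neg) h3.fun_neg (by linarith)

def band (T T' : ℝ) (A B : ℝ → ℝ) : Set (ℝ × ℝ) :=
  {p | (T ≤ p.1 ∧ p.1 ≤ T') ∧ A p.1 ≤ p.2 ∧ p.2 ≤ B p.1}

lemma band_compact {T T' : ℝ} {A B : ℝ → ℝ} (hA : ContinuousOn A (Icc T T'))
    (hB : ContinuousOn B (Icc T T')) : IsCompact (band T T' A B) := by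
  obtain ⟨a, ha⟩ := (isCompact_Icc.image_of_continuousOn hA).bddBelow
  obtain ⟨b, hb⟩ := (isCompact_Icc.image_of_continuousOn hB).bddAbove
  have hcA : ContinuousOn (fun p : ℝ × ℝ => p.2 - A p.1) (Icc T T' ×ˢ Icc a b) :=
    continuousOn_snd.sub (hA.comp continuousOn_fst (fun p hp => hp.1))
  have hcB : ContinuousOn (fun p : ℝ × ℝ => B p.1 - p.2) (Icc T T' ×ˢ Icc a b) :=
    (hB.comp continuousOn_fst (fun p hp => hp.1)).sub continuousOn_snd
  have hcl : IsClosed (Icc T T' ×ˢ Icc a b) := isClosed_Icc.prod isClosed_Icc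
  have h1 := hcA.preimage_isClosed_of_isClosed hcl (isClosed_Ici (a := 0))
  have h2 := hcB.preimage_isClosed_of_isClosed hcl (isClosed_Ici (a := 0))
  refine (isCompact_Icc.prod isCompact_Icc).of_isClosed_subset
    (s := (Icc T T' ×ˢ Icc a b)) (t := band T T' A B) ?_ ?_
  · have : band T T' A B = ((Icc T T' ×ˢ Icc a b) ∩ (fun p : ℝ × ℝ => p.2 - A p.1) ⁻¹' Ici 0) ∩
        ((Icc T T' ×ˢ Icc a b) ∩ (fun p : ℝ × ℝ => B p.1 - p.2) ⁻¹' Ici 0) := by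
      ext ⟨t, x⟩
      simp only [band, mem_ofPred_eq, mem_inter_iff, mem_prod, mem_Icc, mem_preimage, mem_Ici,
        sub_nonneg]
      constructor
      · rintro ⟨ht, h3, h4⟩
        have ha' := ha ⟨t, ht, rfl⟩
        have hb' := hb ⟨t, ht, rfl⟩
        exact ⟨⟨⟨ht, ha'.trans h3, h4.trans hb'⟩, h3⟩, ⟨ht, ha'.trans h3, h4.trans hb'⟩, h4⟩
      · rintro ⟨⟨⟨ht, _⟩, h3⟩, _, h4⟩
        exact ⟨ht, h3, h4⟩
    rw [this]; exact h1.inter h2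
  · rintro ⟨t, x⟩ ⟨ht, h3, h4⟩
    exact ⟨ht, (ha ⟨t, ht, rfl⟩).trans h3, h4.trans (hb ⟨t, ht, rfl⟩)⟩

lemma dcl {d T T' : ℝ} (hd : 0 < d) {A B : ℝ → ℝ} {u w : ℝ → ℝ → ℝ}
    (hA : ContinuousOn A (Icc T T')) (hB : ContinuousOn B (Icc T T'))
    (uc : ContinuousOn (fun p : ℝ × ℝ => u p.1 p.2) (band T T' A B))
    (wc : ContinuousOn (fun p : ℝ × ℝ => w p.1 p.2) (band T T' A B))
    (h0 : ∀ x, A T ≤ x → x ≤ B T → w T x < u T x)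
    (hlA : ∀ t, T < t → t ≤ T' → w t (A t) < u t (A t))
    (hlB : ∀ t, T < t → t ≤ T' → w t (B t) < u t (B t))
    (hint : ∀ t, T < t → t ≤ T' → ∀ x, A t < x → x < B t → w t x = u t x →
      ∃ (ut : ℝ) (u1 : ℝ → ℝ) (uxx : ℝ), HasDerivAt (fun s => u s x) ut t ∧
        (∀ᶠ y in 𝓝 x, HasDerivAt (u t) (u1 y) y) ∧ HasDerivAt u1 uxx x ∧
        SubAt d w t x (ut - d * uxx)) :
    ∀ t, T ≤ t → t ≤ T' → ∀ x, A t ≤ x → x ≤ B t → w t x < u t x := by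
  have key := first_touch (band_compact hA hB) (Z := fun p => u p.1 p.2 - w p.1 p.2)
    (uc.sub wc) (by
      intro t x hx hle hearly hmin
      obtain ⟨⟨ht1, ht2⟩, hx1, hx2⟩ := hx
      simp only at ht1 ht2 hx1 hx2 hle hearly hmin
      rcases eq_or_lt_of_le ht1 with e | htT
      · subst e; linarith [h0 x hx1 hx2]
      rcases eq_or_lt_of_le hx1 with e | hxA
      · rw [← e] at hle; linarith [hlA t htT ht2]
      rcases eq_or_lt_of_le hx2 with e | hxB
      · rw [e] at hle; linarith [hlB t htT ht2]
      -- interior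
      have hev : ∀ᶠ s in 𝓝[<] t, A s < x ∧ x < B s ∧ T < s ∧ s < t := by
        have hle : 𝓝[Ioo T t] t ≤ 𝓝[Icc T T'] t :=
          nhdsWithin_mono _ (fun s hs => ⟨hs.1.le, hs.2.le.trans ht2⟩)
        have a1 := (hA t ⟨ht1, ht2⟩).mono_left hle |>.eventually (gt_mem_nhds hxA)
        have a2 := (hB t ⟨ht1, ht2⟩).mono_left hle |>.eventually (lt_mem_nhds hxB)
        have a3 : ∀ᶠ s in 𝓝[Ioo T t] t, s ∈ Ioo T t := self_mem_nhdsWithin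
        rw [nhdsWithin_Ioo_eq_nhdsLT htT] at a1 a2 a3
        filter_upwards [a1, a2, a3] with s b1 b2 b3
        exact ⟨b1, b2, b3.1, b3.2⟩
      have hpos : ∀ᶠ s in 𝓝[<] t, w s x < u s x := by
        filter_upwards [hev] with s hs
        have := hearly s x ⟨⟨hs.2.2.1.le, hs.2.2.2.le.trans ht2⟩, hs.1.le, hs.2.1.le⟩ hs.2.2.2
        linarith
      have hge : 0 ≤ u t x - w t x := by
        have hbt : (t, x) ∈ band T T' A B := ⟨⟨ht1, ht2⟩, hx1, hx2⟩
        have hcz := (uc.sub wc) (t, x) hbt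
        have hmap : Tendsto (fun s => (s, x)) (𝓝[<] t) (𝓝[band T T' A B] (t, x)) := by
          refine tendsto_nhdsWithin_iff.mpr ⟨?_, ?_⟩
          · exact ((continuous_id.prodMk continuous_const).tendsto t).mono_left
              nhdsWithin_le_nhds
          · filter_upwards [hev] with s hs
            exact ⟨⟨hs.2.2.1.le, hs.2.2.2.le.trans ht2⟩, hs.1.le, hs.2.1.le⟩
        have := Tendsto.comp hcz hmap
        refine ge_of_tendsto this ?_
        filter_upwards [hpos] with s hs
        exact sub_nonneg.mpr hs.le
      have heq : w t x = u t x := by linarith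
      obtain ⟨ut, u1, uxx, hut, hu1, huxx, ψ, ψt, ψ1, ψxx, e0, e1, e2, e3, e4, e5, e6⟩ :=
        hint t htT ht2 x hxA hxB heq
      have r1 : ut - ψt ≤ 0 := by
        refine deriv_nonpos_of_left (hut.fun_sub e3) ?_
        filter_upwards [e1, hpos] with s a b
        linarith
      have r2 : 0 ≤ uxx - ψxx := by
        refine second_deriv_nonneg (φ := fun y => u t y - ψ t y) (x := x)
          (φ1 := fun y => u1 y - ψ1 y) ?_ (huxx.fun_sub e5) ?_
        · filter_upwards [hu1, e4] with y a b
          exact a.fun_sub b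
        · filter_upwards [e2, Ioo_mem_nhds hxA hxB] with y a b
          have := hmin y ⟨⟨ht1, ht2⟩, b.1.le, b.2.le⟩
          linarith
      nlinarith)
  intro t h1 h2 x h3 h4
  have := key (t, x) ⟨⟨h1, h2⟩, h3, h4⟩
  simp only at this
  linarith

section
variable {d δ : ℝ} {f : ℝ → ℝ} {u : ℝ → ℝ → ℝ} {g h : ℝ → ℝ}

lemma FB.band_cont (S : FB d δ f u g h) {T T' : ℝ} {A B : ℝ → ℝ} (hT : 0 ≤ T)
    (hgA : ∀ t, T ≤ t → t ≤ T' → g t ≤ A t) (hBh : ∀ t, T ≤ t → t ≤ T' → B t ≤ h t) :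
    ContinuousOn (fun p : ℝ × ℝ => u p.1 p.2) (band T T' A B) := by
  refine S.uc.mono ?_
  rintro ⟨t, x⟩ ⟨⟨h1, h2⟩, h3, h4⟩
  exact ⟨hT.trans h1, (hgA t h1 h2).trans h3, h4.trans (hBh t h1 h2)⟩

lemma FB.ux_ev (S : FB d δ f u g h) {t x : ℝ} (ht : 0 < t) (h1 : g t < x) (h2 : x < h t) :
    ∀ᶠ y in 𝓝 x, HasDerivAt (u t) (deriv (u t) y) y := by
  filter_upwards [Ioo_mem_nhds h1 h2] with y hy
  exact S.ux t ht y hy.1.le hy.2.le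

lemma FB.dcl_low (S : FB d δ f u g h) (hd : 0 < d) {T T' : ℝ} (hT : 0 ≤ T) {A B : ℝ → ℝ}
    {w : ℝ → ℝ → ℝ}
    (hA : ContinuousOn A (Icc T T')) (hB : ContinuousOn B (Icc T T'))
    (hgA : ∀ t, T ≤ t → t ≤ T' → g t ≤ A t) (hBh : ∀ t, T ≤ t → t ≤ T' → B t ≤ h t)
    (wc : ContinuousOn (fun p : ℝ × ℝ => w p.1 p.2) (band T T' A B))
    (h0 : ∀ x, A T ≤ x → x ≤ B T → w T x < u T x)
    (hlA : ∀ t, T < t → t ≤ T' → w t (A t) < u t (A t))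
    (hlB : ∀ t, T < t → t ≤ T' → w t (B t) < u t (B t))
    (hint : ∀ t, T < t → t ≤ T' → ∀ x, A t < x → x < B t → w t x = u t x →
      SubAt d w t x (f (w t x))) :
    ∀ t, T ≤ t → t ≤ T' → ∀ x, A t ≤ x → x ≤ B t → w t x < u t x := by
  refine dcl hd hA hB (S.band_cont hT hgA hBh) wc h0 hlA hlB ?_
  intro t h1 h2 x h3 h4 h5
  have ht : 0 < t := hT.trans_lt h1
  have hg' := (hgA t h1.le h2).trans_lt h3
  have hh' := h4.trans_le (hBh t h1.le h2)
  refine ⟨_, _, _, S.ut t ht x hg' hh', S.ux_ev ht hg' hh', S.uxx t ht x hg' hh', ?_⟩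
  rw [add_sub_cancel_left, ← h5]
  exact hint t h1 h2 x h3 h4 h5

lemma FB.dcl_up (S : FB d δ f u g h) (hd : 0 < d) {T T' : ℝ} (hT : 0 ≤ T) {A B : ℝ → ℝ}
    {w : ℝ → ℝ → ℝ}
    (hA : ContinuousOn A (Icc T T')) (hB : ContinuousOn B (Icc T T'))
    (hgA : ∀ t, T ≤ t → t ≤ T' → g t ≤ A t) (hBh : ∀ t, T ≤ t → t ≤ T' → B t ≤ h t)
    (wc : ContinuousOn (fun p : ℝ × ℝ => w p.1 p.2) (band T T' A B))
    (h0 : ∀ x, A T ≤ x → x ≤ B T → u T x < w T x)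
    (hlA : ∀ t, T < t → t ≤ T' → u t (A t) < w t (A t))
    (hlB : ∀ t, T < t → t ≤ T' → u t (B t) < w t (B t))
    (hint : ∀ t, T < t → t ≤ T' → ∀ x, A t < x → x < B t → w t x = u t x →
      SupAt d w t x (f (w t x))) :
    ∀ t, T ≤ t → t ≤ T' → ∀ x, A t ≤ x → x ≤ B t → u t x < w t x := by
  have := dcl (u := fun t x => - u t x) (w := fun t x => - w t x) hd hA hB
    (S.band_cont hT hgA hBh).neg wc.neg
    (fun x a b => neg_lt_neg (h0 x a b)) (fun t a b => neg_lt_neg (hlA t a b))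
    (fun t a b => neg_lt_neg (hlB t a b)) ?_
  · intro t a b x e1 e2
    exact neg_lt_neg_iff.mp (this t a b x e1 e2)
  intro t h1 h2 x h3 h4 h5
  have h5 : w t x = u t x := neg_injective h5
  have ht : 0 < t := hT.trans_lt h1
  have hg' := (hgA t h1.le h2).trans_lt h3
  have hh' := h4.trans_le (hBh t h1.le h2)
  refine ⟨_, _, _, (S.ut t ht x hg' hh').fun_neg,
    (S.ux_ev ht hg' hh').mono (fun y hy => hy.fun_neg), (S.uxx t ht x hg' hh').fun_neg, ?_⟩
  have e : -(d * deriv (deriv (u t)) x + f (u t x)) - d * -deriv (deriv (u t)) x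
    = - f (w t x) := by rw [h5]; ring
  rw [e]
  exact hint t h1 h2 x h3 h4 h5

/-- limits of slices -/
lemma slice_le {T t : ℝ} {A B : ℝ → ℝ} {w : ℝ → ℝ → ℝ} (hTt : T < t)
    (hA : ContinuousOn A (Icc T t)) (hB : ContinuousOn B (Icc T t)) (hAB : A t < B t)
    (uc : ContinuousOn (fun p : ℝ × ℝ => u p.1 p.2) (band T t A B))
    (wc : ContinuousOn (fun p : ℝ × ℝ => w p.1 p.2) (band T t A B))
    (hlt : ∀ s, T ≤ s → s < t → ∀ x, A s ≤ x → x ≤ B s → w s x ≤ u s x) :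
    ∀ x, A t ≤ x → x ≤ B t → w t x ≤ u t x := by
  intro x hx1 hx2
  -- path through relative position
  set lam := (x - A t) / (B t - A t) with hlam
  have hl0 : 0 ≤ lam := div_nonneg (by linarith) (by linarith)
  have hl1 : lam ≤ 1 := (div_le_one (by linarith)).mpr (by linarith)
  set X : ℝ → ℝ := fun s => A s + lam * (B s - A s) with hX
  have hXt : X t = x := by
    have : B t - A t ≠ 0 := by linarith
    simp only [hX, hlam]; field_simp; ring
  have hXc : ContinuousOn X (Icc T t) := hA.add (continuousOn_const.mul (hB.sub hA))
  have hle : 𝓝[Ioo T t] t ≤ 𝓝[Icc T t] t :=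
    nhdsWithin_mono _ (fun s hs => ⟨hs.1.le, hs.2.le⟩)
  have a3 : ∀ᶠ s in 𝓝[Ioo T t] t, s ∈ Ioo T t := self_mem_nhdsWithin
  have a4 : ∀ᶠ s in 𝓝[Ioo T t] t, A s < B s := by
    have := ((hB.sub hA) t ⟨hTt.le, le_rfl⟩).mono_left hle |>.eventually
      (lt_mem_nhds (sub_pos.mpr hAB))
    filter_upwards [this] with s hs
    have : 0 < B s - A s := hs
    linarith
  have hin : ∀ᶠ s in 𝓝[Ioo T t] t, (s < t ∧ T ≤ s) ∧ A s ≤ X s ∧ X s ≤ B s := by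
    filter_upwards [a3, a4] with s b3 b4
    refine ⟨⟨b3.2, b3.1.le⟩, ?_, ?_⟩
    · simp only [hX]; nlinarith
    · simp only [hX]; nlinarith
  have hmap : Tendsto (fun s => (s, X s)) (𝓝[Ioo T t] t) (𝓝[band T t A B] (t, x)) := by
    refine tendsto_nhdsWithin_iff.mpr ⟨?_, ?_⟩
    · rw [← hXt]
      refine Tendsto.prodMk_nhds (tendsto_id.mono_left nhdsWithin_le_nhds) ?_
      exact (hXc t ⟨hTt.le, le_rfl⟩).mono_left hle
    · filter_upwards [hin] with s hs
      exact ⟨⟨hs.1.2, hs.1.1.le⟩, hs.2.1, hs.2.2⟩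
  have hbt : (t, x) ∈ band T t A B := ⟨⟨hTt.le, le_rfl⟩, hx1, hx2⟩
  have l1 := Tendsto.comp (uc (t, x) hbt) hmap
  have l2 := Tendsto.comp (wc (t, x) hbt) hmap
  have : (𝓝[Ioo T t] t).NeBot := by
    rw [nhdsWithin_Ioo_eq_nhdsLT hTt]; infer_instance
  refine le_of_tendsto_of_tendsto l2 l1 ?_
  filter_upwards [hin] with s hs
  exact hlt s hs.1.2 hs.1.1 _ hs.2.1 hs.2.2

lemma band_mono {T t T' : ℝ} {A B : ℝ → ℝ} (ht : t ≤ T') : band T t A B ⊆ band T T' A B := by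
  rintro ⟨s, x⟩ ⟨⟨h1, h2⟩, h3⟩
  exact ⟨⟨h1, h2.trans ht⟩, h3⟩

lemma FB.freeComp (S : FB d δ f u g h) (hd : 0 < d) {T T' : ℝ} (hT : 0 ≤ T)
    {A B : ℝ → ℝ} {w : ℝ → ℝ → ℝ}
    (hA : ContinuousOn A (Icc T T')) (hB : ContinuousOn B (Icc T T'))
    (hAB : ∀ t, T ≤ t → t ≤ T' → A t < B t)
    (hgA0 : g T < A T) (hBh0 : B T < h T)
    (wc : ContinuousOn (fun p : ℝ × ℝ => w p.1 p.2) (band T T' A B))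
    (h0 : ∀ x, A T ≤ x → x ≤ B T → w T x < u T x)
    (hlA : ∀ t, T < t → t ≤ T' → g t < A t → A t < h t → w t (A t) < u t (A t))
    (hlB : ∀ t, T < t → t ≤ T' → g t < B t → B t < h t → w t (B t) < u t (B t))
    (hint : ∀ t, T < t → t ≤ T' → ∀ x, A t < x → x < B t → g t < x → x < h t → w t x = u t x →
      SubAt d w t x (f (w t x)))
    (hL : ∀ t, T < t → t ≤ T' → (∀ s, T ≤ s → s < t → g s < A s) → A t = g t →
      (∀ x, A t ≤ x → x ≤ B t → w t x ≤ u t x) → False)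
    (hR : ∀ t, T < t → t ≤ T' → (∀ s, T ≤ s → s < t → B s < h s) → B t = h t →
      (∀ x, A t ≤ x → x ≤ B t → w t x ≤ u t x) → False) :
    ∀ t, T ≤ t → t ≤ T' → g t < A t ∧ B t < h t ∧
      ∀ x, A t ≤ x → x ≤ B t → w t x < u t x := by
  have hgc : ContinuousOn g (Icc T T') := S.gc.mono (fun s hs => hT.trans hs.1)
  have hhc : ContinuousOn h (Icc T T') := S.hc.mono (fun s hs => hT.trans hs.1)
  have hcmp : ∀ s, T ≤ s → s ≤ T' → (∀ r, T ≤ r → r ≤ s → g r < A r ∧ B r < h r) →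
      ∀ x, A s ≤ x → x ≤ B s → w s x < u s x := by
    intro s h1 h2 hh
    refine S.dcl_low hd hT (T' := s) (hA.mono (Icc_subset_Icc_right h2))
      (hB.mono (Icc_subset_Icc_right h2)) (fun r a b => (hh r a b).1.le)
      (fun r a b => (hh r a b).2.le) (wc.mono (band_mono h2)) h0 ?_ ?_ ?_ s h1 le_rfl
    · intro t a b
      exact hlA t a (b.trans h2) (hh t a.le b).1
        ((hAB t a.le (b.trans h2)).trans (hh t a.le b).2)
    · intro t a b
      exact hlB t a (b.trans h2) ((hh t a.le b).1.trans (hAB t a.le (b.trans h2)))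
        (hh t a.le b).2
    · intro t a b x e1 e2 e3
      exact hint t a (b.trans h2) x e1 e2 ((hh t a.le b).1.trans e1) (e2.trans (hh t a.le b).2) e3
  have hm := first_zero (m := fun t => min (A t - g t) (h t - B t)) (T := T) (T' := T')
    ((hA.sub hgc).inf (hhc.sub hB)) (lt_min (by linarith) (by linarith)) (by
      intro t ht hpos hz
      have hs : ∀ s, T ≤ s → s < t → g s < A s ∧ B s < h s := by
        intro s a b
        have := lt_min_iff.mp (hpos s ⟨a, b⟩)
        exact ⟨by linarith [this.1], by linarith [this.2]⟩
      have hge : g t ≤ A t ∧ B t ≤ h t := by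
        have := le_min_iff.mp hz.ge
        exact ⟨by linarith [this.1], by linarith [this.2]⟩
      have hh : ∀ r, T ≤ r → r ≤ t → g r ≤ A r ∧ B r ≤ h r := by
        intro r a b
        rcases eq_or_lt_of_le b with e | e
        · rw [e]; exact hge
        · exact ⟨(hs r a e).1.le, (hs r a e).2.le⟩
      have hsl := slice_le (u := u) (w := w) ht.1 (hA.mono (Icc_subset_Icc_right ht.2))
        (hB.mono (Icc_subset_Icc_right ht.2)) (hAB t ht.1.le ht.2)
        (S.band_cont hT (fun r a b => (hh r a b).1) (fun r a b => (hh r a b).2))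
        (wc.mono (band_mono ht.2)) (fun s a b x e1 e2 =>
          (hcmp s a (b.le.trans ht.2) (fun r a' b' => hs r a' (b'.trans_lt b)) x e1 e2).le)
      rcases min_choice (A t - g t) (h t - B t) with e | e
      · exact hL t ht.1 ht.2 (fun s a b => (hs s a b).1) (by rw [e] at hz; linarith) hsl
      · exact hR t ht.1 ht.2 (fun s a b => (hs s a b).2) (by rw [e] at hz; linarith) hsl)
  have hm' : ∀ r, T ≤ r → r ≤ T' → g r < A r ∧ B r < h r := by
    intro r a b
    have := lt_min_iff.mp (hm r ⟨a, b⟩)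
    exact ⟨by linarith [this.1], by linarith [this.2]⟩
  intro t a b
  exact ⟨(hm' t a b).1, (hm' t a b).2, hcmp t a b (fun r a' b' => hm' r a' (b'.trans b))⟩

lemma FB.slopeR (S : FB d δ f u g h) (hd : 0 < d) (hδ : 0 < δ) {T t : ℝ} (hT : 0 ≤ T)
    (hTt : T < t) {B : ℝ → ℝ} {B' s a : ℝ} {v : ℝ → ℝ} (hB' : HasDerivAt B B' t)
    (hearly : ∀ s, T ≤ s → s < t → B s < h s) (hBt : B t = h t)
    (ha : a < B t) (hv : ∀ x, a < x → x < B t → v x ≤ u t x) (hvδ : v (B t) = δ)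
    (hv' : HasDerivAt v (-s) (B t)) (hlt : B' < d / δ * s) : False := by
  have ht : 0 < t := hT.trans_lt hTt
  have h1 : -(d / δ) * deriv (u t) (h t) - B' ≤ 0 := by
    refine deriv_nonpos_of_left ((S.sh t ht).fun_sub hB') ?_
    filter_upwards [Ioo_mem_nhdsLT hTt] with r hr
    have := hearly r hr.1.le hr.2
    linarith
  have h2 : deriv (u t) (h t) - (-s) ≤ 0 := by
    rw [hBt] at hv' hvδ ha hv
    refine deriv_nonpos_of_left ((S.ux t ht (h t) (S.gh t ht.le).le le_rfl).fun_sub hv') ?_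
    filter_upwards [Ioo_mem_nhdsLT ha] with r hr
    have := hv r hr.1 hr.2
    rw [S.bh t ht.le, hvδ]
    linarith
  have h3 : 0 < d / δ := by positivity
  nlinarith

lemma FB.slopeL (S : FB d δ f u g h) (hd : 0 < d) (hδ : 0 < δ) {T t : ℝ} (hT : 0 ≤ T)
    (hTt : T < t) {A : ℝ → ℝ} {A' s b : ℝ} {v : ℝ → ℝ} (hA' : HasDerivAt A A' t)
    (hearly : ∀ s, T ≤ s → s < t → g s < A s) (hAt : A t = g t)
    (hb : A t < b) (hv : ∀ x, A t < x → x < b → v x ≤ u t x) (hvδ : v (A t) = δ)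
    (hv' : HasDerivAt v s (A t)) (hlt : -A' < d / δ * s) : False := by
  refine S.reflect.slopeR hd hδ hT hTt (B := fun t => - A t) (v := fun x => v (-x)) (a := -b) (s := s)
    hA'.fun_neg (fun s a b => neg_lt_neg (hearly s a b)) (by simp [hAt]) (by simpa using hb)
    (fun x a b => hv (-x) (by linarith) (by linarith)) (by simpa using hvδ) ?_ hlt
  have : HasDerivAt v s (- -A t) := by simpa using hv'
  simpa [Function.comp_def] using this.scomp (-A t) (hasDerivAt_neg (-A t))

end

end FA

open Set Filter Topology

namespace FA

/-! ### Facts about the nonlinearity -/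

structure NL (δ : ℝ) (f : ℝ → ℝ) : Prop where
  δ0 : 0 < δ
  δ1 : δ < 1
  fc : ContinuousOn f (Ici 0)
  lip : ∀ M : ℝ, ∃ K > 0, ∀ a b, 0 ≤ a → a ≤ M → 0 ≤ b → b ≤ M → |f a - f b| ≤ K * |a - b|
  f0 : f 0 = 0
  f1 : f 1 = 0
  fpos : ∀ v, δ ≤ v → v < 1 → 0 < f v
  fneg : ∀ v, 1 < v → f v < 0
  dec : ∃ ω > 0, ∃ m > 0, ω < 1 ∧ ∀ a b, 1 - ω ≤ a → a ≤ b → b ≤ 1 + ω → f b - f a ≤ - m * (b - a)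
  front : ∃ ε > 0, ∀ v, 0 ≤ v → v ≤ δ → ε * (δ - v) ≤ ∫ s in v..δ, f s

lemma intInt {f : ℝ → ℝ} (fc : ContinuousOn f (Ici 0)) {a b : ℝ} (ha : 0 ≤ a) (hb : 0 ≤ b) :
    IntervalIntegrable f MeasureTheory.volume a b := by
  refine (fc.mono ?_).intervalIntegrable
  intro x hx
  rcases mem_uIcc.mp hx with h | h
  · exact ha.trans h.1
  · exact hb.trans h.1

lemma NL.of {f : ℝ → ℝ} {θ θs δ : ℝ} (hf : AlleeType f θ) (hθs : IsThetaStar f θ θs)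
    (hδ : δ ∈ Ioo θs 1) : NL δ f := by
  obtain ⟨hC, hθ, f0, fθ, f1, -, hd1, hle, hpos, hneg, -⟩ := hf
  obtain ⟨hs1, hs2, hs3⟩ := hθs
  have hθδ : θ < δ := hs1.1.trans_lt hδ.1
  have hδ0 : 0 < δ := hθ.1.trans_lt hθδ
  have fc : ContinuousOn f (Ici 0) := hC.continuousOn
  have hposδ : ∀ v, δ ≤ v → v < 1 → 0 < f v := fun v a b => hpos v ⟨hθδ.trans_le a, b⟩
  refine ⟨hδ0, hδ.2, fc, ?_, f0, f1, hposδ, fun v hv => hneg v hv, ?_, ?_⟩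
  · intro M
    obtain ⟨K, hK⟩ := (hC.mono (s := Ici 0) (t := Icc 0 M) (fun x hx => hx.1)).exists_lipschitzOnWith
      (by norm_num) (convex_Icc 0 M) isCompact_Icc
    refine ⟨K + 1, by positivity, fun a b h1 h2 h3 h4 => ?_⟩
    have := hK.dist_le_mul a ⟨h1, h2⟩ b ⟨h3, h4⟩
    rw [Real.dist_eq, Real.dist_eq] at this
    nlinarith [abs_nonneg (a - b)]
  · have hdc : ContinuousOn (derivWithin f (Ici 0)) (Ici 0) :=
      hC.continuousOn_derivWithin (uniqueDiffOn_Ici 0) (by norm_num)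
    set m := - derivWithin f (Ici 0) 1 / 2 with hm
    have hm0 : 0 < m := by rw [hm]; linarith
    have hca : ContinuousAt (derivWithin f (Ici 0)) 1 :=
      hdc.continuousAt (Ici_mem_nhds (by norm_num))
    have hev := hca.eventually (gt_mem_nhds (show derivWithin f (Ici 0) 1 < -m by rw [hm]; linarith))
    obtain ⟨ω, hω, hball⟩ := Metric.eventually_nhds_iff.mp hev
    refine ⟨min (ω / 2) (1 / 2), by positivity, m, hm0, ?_, ?_⟩
    · exact lt_of_le_of_lt (min_le_right _ _) (by norm_num)
    intro a b ha hab hb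
    have k1 := min_le_left (ω / 2) (1 / 2 : ℝ)
    have k2 := min_le_right (ω / 2) (1 / 2 : ℝ)
    have hsub : Icc a b ⊆ Ioi (0:ℝ) := fun x hx => by
      have := hx.1
      show 0 < x
      linarith
    have hdiff : ∀ x ∈ Ioi (0:ℝ), HasDerivAt f (derivWithin f (Ici 0) x) x := by
      intro x hx
      exact ((hC.differentiableOn (by norm_num)) x (mem_Ici.mpr (le_of_lt (mem_Ioi.mp hx)))).hasDerivWithinAt.hasDerivAt
        (Ici_mem_nhds hx)
    refine (convex_Icc a b).image_sub_le_mul_sub_of_deriv_le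
      (fun x hx => (hdiff x (hsub hx)).continuousAt.continuousWithinAt)
      (fun x hx => (hdiff x (hsub (interior_subset hx))).differentiableAt.differentiableWithinAt)
      ?_ a ⟨le_rfl, hab⟩ b ⟨hab, le_rfl⟩ hab
    intro x hx
    have hx' := interior_subset hx
    rw [(hdiff x (hsub hx')).deriv]
    refine (hball ?_).le
    rw [Real.dist_eq, abs_lt]
    constructor <;> linarith [hx'.1, hx'.2]
  · have hfδ : 0 < f δ := hposδ δ le_rfl hδ.2
    have hca : ContinuousAt f δ := fc.continuousAt (Ici_mem_nhds hδ0)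
    have hev := hca.eventually (lt_mem_nhds (show f δ / 2 < f δ by linarith))
    obtain ⟨ρ, hρ, hball⟩ := Metric.eventually_nhds_iff.mp hev
    set r := min (ρ / 2) (δ - θ) with hr
    have hr0 : 0 < r := lt_min (by linarith) (by linarith)
    have k1 := min_le_left (ρ / 2) (δ - θ)
    have k2 := min_le_right (ρ / 2) (δ - θ)
    have hFδ : 0 < ∫ s in (0:ℝ)..δ, f s := hs3 δ ⟨hδ.1, hδ.2.le⟩
    set F := ∫ s in (0:ℝ)..δ, f s with hF
    have near : ∀ v, 0 ≤ v → δ - r ≤ v → v ≤ δ → f δ / 2 * (δ - v) ≤ ∫ s in v..δ, f s := by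
      intro v h0 h1 h2
      have : ∫ s in v..δ, (f δ / 2 : ℝ) ≤ ∫ s in v..δ, f s := by
        refine intervalIntegral.integral_mono_on h2 (by simp) (intInt fc h0 hδ0.le) ?_
        intro x hx
        refine (hball ?_).le
        rw [Real.dist_eq, abs_lt]
        constructor <;> linarith [hx.1, hx.2]
      simp only [intervalIntegral.integral_const, smul_eq_mul] at this
      linarith
    have hrδ : 0 ≤ δ - r := by linarith [hθ.1]
    set ε := min (f δ / 2) (min (f δ / 2 * r / δ) (F / δ)) with hε
    have e1 : ε ≤ f δ / 2 := min_le_left _ _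
    have e2 : ε ≤ f δ / 2 * r / δ := (min_le_right _ _).trans (min_le_left _ _)
    have e3 : ε ≤ F / δ := (min_le_right _ _).trans (min_le_right _ _)
    have hε0 : 0 < ε := by
      refine lt_min (by positivity) (lt_min (by positivity) (by positivity))
    rw [le_div_iff₀ hδ0] at e2 e3
    refine ⟨ε, hε0, fun v h0 h1 => ?_⟩
    rcases le_total (δ - r) v with h2 | h2
    · have := near v h0 h2 h1
      nlinarith
    · rcases le_total θ v with h3 | h3
      · have h4 := near (δ - r) hrδ le_rfl (by linarith)
        have h5 : 0 ≤ ∫ s in v..(δ - r), f s := by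
          refine intervalIntegral.integral_nonneg h2 ?_
          intro x hx
          rcases eq_or_lt_of_le (h3.trans hx.1) with e | e
          · rw [← e, fθ]
          · exact (hpos x ⟨e, by linarith [hx.2, hδ.2]⟩).le
        have h6 := intervalIntegral.integral_add_adjacent_intervals (intInt fc h0 hrδ)
          (intInt fc hrδ hδ0.le)
        nlinarith
      · have h5 : ∫ s in (0:ℝ)..v, f s ≤ 0 := by
          have : ∫ s in (0:ℝ)..v, f s ≤ ∫ s in (0:ℝ)..v, (0:ℝ) := by
            refine intervalIntegral.integral_mono_on h0 (intInt fc le_rfl h0) (by simp) ?_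
            intro x hx
            exact hle x ⟨hx.1, hx.2.trans h3⟩
          simpa using this
        have h6 := intervalIntegral.integral_add_adjacent_intervals (intInt fc le_rfl h0)
          (intInt fc h0 hδ0.le)
        nlinarith

lemma NL.lin {δ : ℝ} {f : ℝ → ℝ} (N : NL δ f) :
    ∃ m > 0, ∀ v, δ ≤ v → v ≤ 1 → m * (1 - v) ≤ f v := by
  obtain ⟨ω, hω, m, hm, hω1, hdec⟩ := N.dec
  by_cases hc : 1 - ω ≤ δ
  · refine ⟨m, hm, fun v h1 h2 => ?_⟩
    have := hdec v 1 (by linarith) h2 (by linarith)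
    rw [N.f1] at this; linarith
  push Not at hc
  obtain ⟨x, hx, hmin⟩ := (isCompact_Icc (a := δ) (b := 1 - ω)).exists_isMinOn
    (nonempty_Icc.mpr hc.le) (N.fc.mono (fun x hx => N.δ0.le.trans hx.1))
  have hfx : 0 < f x := N.fpos x hx.1 (by linarith [hx.2])
  refine ⟨min m (f x), lt_min hm hfx, fun v h1 h2 => ?_⟩
  have k1 := min_le_left m (f x)
  have k2 := min_le_right m (f x)
  have k3 : 0 < min m (f x) := lt_min hm hfx
  rcases le_total (1 - ω) v with h | h
  · have := hdec v 1 (by linarith) h2 (by linarith)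
    rw [N.f1] at this; nlinarith
  · have := isMinOn_iff.mp hmin v ⟨h1, h⟩
    have : 1 - v ≤ 1 := by linarith [N.δ0]
    nlinarith

/-! ### Basic bounds -/

section
variable {d δ : ℝ} {f : ℝ → ℝ} {u : ℝ → ℝ → ℝ} {g h : ℝ → ℝ}

lemma FB.slice_compact (S : FB d δ f u g h) {t a b : ℝ} (ht : 0 ≤ t) (ha : g t ≤ a) (hb : b ≤ h t) :
    ContinuousOn (u t) (Icc a b) := by
  have : ContinuousOn (fun x : ℝ => ((t, x) : ℝ × ℝ)) (Icc a b) := by fun_prop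
  exact S.uc.comp this (fun x hx => ⟨ht, ha.trans hx.1, hx.2.trans hb⟩)

lemma FB.pos (S : FB d δ f u g h) (hd : 0 < d) (N : NL δ f) :
    ∀ t, 0 ≤ t → ∀ x, g t ≤ x → x ≤ h t → 0 < u t x := by
  intro T' hT'
  obtain ⟨K, hK, hlip⟩ := N.lip δ
  obtain ⟨x, hx, hmin⟩ := (isCompact_Icc (a := g 0) (b := h 0)).exists_isMinOn
    (nonempty_Icc.mpr (S.gh 0 le_rfl).le) (S.slice_compact le_rfl le_rfl le_rfl)
  have hu0 := S.pos0 x hx.1 hx.2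
  set m := min (u 0 x) δ / 2 with hm
  have hm0 : 0 < m := by have := lt_min hu0 N.δ0; rw [hm]; linarith
  have k1 := min_le_left (u 0 x) δ
  have k2 := min_le_right (u 0 x) δ
  have hm1 : m < u 0 x := by linarith
  have hm2 : m < δ := by linarith
  have hexp : ∀ t, 0 ≤ t → Real.exp (-(K + 1) * t) ≤ 1 := by
    intro t ht; rw [Real.exp_le_one_iff]; nlinarith
  have hc : ∀ t, 0 ≤ t → m * Real.exp (-(K + 1) * t) ≤ m := fun t ht => by
    nlinarith [hexp t ht]
  have key := S.dcl_low hd le_rfl (T' := T') (A := g) (B := h)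
    (w := fun t _ => m * Real.exp (-(K + 1) * t))
    (S.gc.mono fun s hs => hs.1) (S.hc.mono fun s hs => hs.1)
    (fun _ _ _ => le_rfl) (fun _ _ _ => le_rfl) (by fun_prop)
    (by
      intro y h1 h2
      have := isMinOn_iff.mp hmin y ⟨h1, h2⟩
      have := hc 0 le_rfl
      linarith)
    (by
      intro t h1 h2
      rw [S.bg t h1.le]
      exact (hc t h1.le).trans_lt hm2)
    (by
      intro t h1 h2
      rw [S.bh t h1.le]
      exact (hc t h1.le).trans_lt hm2)
    (by
      intro t h1 h2 y h3 h4 h5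
      refine SubAt.smooth (m * (Real.exp (-(K + 1) * t) * (-(K + 1)))) (fun _ => 0) 0 ?_ ?_ ?_ ?_
      · have := ((hasDerivAt_id t).const_mul (-(K + 1))).exp.const_mul m
        simpa using this
      · exact Eventually.of_forall fun y => hasDerivAt_const _ _
      · exact hasDerivAt_const _ _
      · set e := m * Real.exp (-(K + 1) * t) with he
        have he0 : 0 < e := by positivity
        have := hlip e 0 he0.le ((hc t h1.le).trans hm2.le) le_rfl N.δ0.le
        rw [N.f0, sub_zero, sub_zero, abs_of_pos he0] at this
        have := (abs_le.mp this).1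
        have e2 : m * (Real.exp (-(K + 1) * t) * (-(K + 1))) = -(K + 1) * e := by rw [he]; ring
        rw [e2]; nlinarith) T' hT' le_rfl
  intro y h1 h2
  have := key y h1 h2
  have : 0 < m * Real.exp (-(K + 1) * T') := by positivity
  linarith

lemma FB.bdd (S : FB d δ f u g h) (hd : 0 < d) (N : NL δ f) :
    ∃ M, 1 < M ∧ ∀ t, 0 ≤ t → ∀ x, g t ≤ x → x ≤ h t → u t x < M := by
  obtain ⟨x, hx, hmax⟩ := (isCompact_Icc (a := g 0) (b := h 0)).exists_isMaxOn
    (nonempty_Icc.mpr (S.gh 0 le_rfl).le) (S.slice_compact le_rfl le_rfl le_rfl)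
  set M := max (u 0 x) 1 + 1 with hM
  have k1 := le_max_left (u 0 x) 1
  have k2 := le_max_right (u 0 x) 1
  refine ⟨M, by linarith, fun T' hT' => ?_⟩
  refine S.dcl_up hd le_rfl (T' := T') (A := g) (B := h)
    (w := fun t _ => M)
    (S.gc.mono fun s hs => hs.1) (S.hc.mono fun s hs => hs.1)
    (fun _ _ _ => le_rfl) (fun _ _ _ => le_rfl) (by fun_prop) ?_ ?_ ?_ ?_ T' hT' le_rfl
  · intro y h1 h2
    have := isMaxOn_iff.mp hmax y ⟨h1, h2⟩
    linarith
  · intro t h1 h2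
    rw [S.bg t h1.le]; linarith [N.δ1]
  · intro t h1 h2
    rw [S.bh t h1.le]; linarith [N.δ1]
  · intro t h1 h2 y h3 h4 h5
    refine SupAt.smooth 0 (fun _ => 0) 0 (hasDerivAt_const _ _)
      (Eventually.of_forall fun y => hasDerivAt_const _ _) (hasDerivAt_const _ _) ?_
    have := N.fneg M (by linarith)
    linarith

lemma FB.limsup_one (S : FB d δ f u g h) (hd : 0 < d) (N : NL δ f) {ω : ℝ} (hω : 0 < ω) :
    ∃ T, 0 ≤ T ∧ ∀ t, T ≤ t → ∀ x, g t ≤ x → x ≤ h t → u t x < 1 + ω := by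
  obtain ⟨M, hM, hb⟩ := S.bdd hd N
  -- f ≤ -k on [1+ω/2, 1+ω+M]
  obtain ⟨y, hy, hmax⟩ := (isCompact_Icc (a := 1 + ω / 2) (b := 1 + ω + M)).exists_isMaxOn
    (nonempty_Icc.mpr (by linarith)) (N.fc.mono (fun x hx => by
      have := hx.1
      show 0 ≤ x
      linarith))
  have hk : f y < 0 := N.fneg y (by linarith [hy.1])
  set k := - f y / (2 * M) with hkd
  have hk0 : 0 < k := by apply div_pos <;> linarith
  have hkM : k * M = - f y / 2 := by rw [hkd]; field_simp
  have key : ∀ T', 0 ≤ T' → ∀ x, g T' ≤ x → x ≤ h T' →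
      u T' x < 1 + ω / 2 + M * Real.exp (- k * T') := by
    intro T' hT'
    have hexp : ∀ t, 0 ≤ t → Real.exp (- k * t) ≤ 1 := by
      intro t ht; rw [Real.exp_le_one_iff]; nlinarith
    have hexp0 : ∀ t, 0 < Real.exp (- k * t) := fun t => Real.exp_pos _
    refine S.dcl_up hd le_rfl (T' := T') (A := g) (B := h)
      (w := fun t _ => 1 + ω / 2 + M * Real.exp (- k * t))
      (S.gc.mono fun s hs => hs.1) (S.hc.mono fun s hs => hs.1)
      (fun _ _ _ => le_rfl) (fun _ _ _ => le_rfl) (by fun_prop) ?_ ?_ ?_ ?_ T' hT' le_rfl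
    · intro y h1 h2
      have := hb 0 le_rfl y h1 h2
      simp
      linarith
    · intro t h1 h2
      rw [S.bg t h1.le]; nlinarith [N.δ1, hexp0 t]
    · intro t h1 h2
      rw [S.bh t h1.le]; nlinarith [N.δ1, hexp0 t]
    · intro t h1 h2 x h3 h4 h5
      refine SupAt.smooth (M * (Real.exp (-k * t) * (-k))) (fun _ => 0) 0 ?_
        (Eventually.of_forall fun y => hasDerivAt_const _ _) (hasDerivAt_const _ _) ?_
      · have := (((hasDerivAt_id t).const_mul (-k)).exp.const_mul M).const_add (1 + ω / 2)
        simpa using this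
      · have e1 := hexp t h1.le
        have e0 := hexp0 t
        have := isMaxOn_iff.mp hmax (1 + ω / 2 + M * Real.exp (- k * t))
          ⟨by nlinarith, by nlinarith⟩
        nlinarith
  have hlim : Tendsto (fun t : ℝ => 1 + ω / 2 + M * Real.exp (- k * t)) atTop (𝓝 (1 + ω / 2 + M * 0)) := by
    refine tendsto_const_nhds.add (tendsto_const_nhds.mul ?_)
    refine Real.tendsto_exp_atBot.comp ?_
    exact tendsto_id.const_mul_atTop_of_neg (by linarith)
  have hev := hlim.eventually (gt_mem_nhds (show 1 + ω / 2 + M * 0 < 1 + ω by linarith))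
  obtain ⟨T, hT⟩ := eventually_atTop.mp (hev.and (eventually_ge_atTop 0))
  refine ⟨T, (hT T le_rfl).2, fun t ht x h1 h2 => ?_⟩
  exact (key t (hT t ht).2 x h1 h2).trans (hT t ht).1

end

end FA

open Set Filter Topology

namespace FA

lemma ode2 {G : ℝ → ℝ} {K Γ ℓ y0 : ℝ} (hK : 0 ≤ K) (hΓ : 0 ≤ Γ) (hℓ : 0 < ℓ)
    (hlip : ∀ a b, |G a - G b| ≤ K * |a - b|) (hbd : ∀ a, |G a| ≤ Γ) :
    ∃ y y1 : ℝ → ℝ, y 0 = y0 ∧ y1 0 = 0 ∧ ∀ z, -ℓ < z → z < ℓ →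
      HasDerivAt y (y1 z) z ∧ HasDerivAt y1 (G (y z)) z := by
  set a : ℝ := Γ * ℓ ^ 2 + 1 with ha
  have ha0 : 0 < a := by positivity
  have hPL : IsPicardLindelof (fun (_ : ℝ) (p : ℝ × ℝ) => (p.2 / ℓ, ℓ * G p.1))
      (tmin := -ℓ) (tmax := ℓ) ⟨0, by constructor <;> linarith⟩ (y0, 0)
      (Real.toNNReal a) 0 (Real.toNNReal (a / ℓ)) (Real.toNNReal (1 / ℓ + ℓ * K)) := by
    refine ⟨?_, ?_, ?_, ?_⟩
    · intro t _
      refine LipschitzWith.lipschitzOnWith (LipschitzWith.of_dist_le_mul ?_)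
      intro p q
      rw [Real.coe_toNNReal _ (by positivity), Prod.dist_eq]
      simp only [Real.dist_eq]
      refine max_le ?_ ?_
      · have h1 : |p.2 - q.2| ≤ dist p q := le_max_right _ _
        rw [← sub_div, abs_div, abs_of_pos hℓ, div_eq_inv_mul, ← one_div]
        have h2 : 0 ≤ ℓ * K := by positivity
        have h3 : 0 < 1 / ℓ := by positivity
        nlinarith [dist_nonneg (x := p) (y := q)]
      · have h1 : |p.1 - q.1| ≤ dist p q := le_max_left _ _
        rw [← mul_sub, abs_mul, abs_of_pos hℓ]
        have h2 := hlip p.1 q.1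
        have h3 : 0 < 1 / ℓ := by positivity
        have h4 : ℓ * |G p.1 - G q.1| ≤ ℓ * (K * dist p q) := by gcongr; nlinarith
        nlinarith [dist_nonneg (x := p) (y := q)]
    · intro x _; exact continuousOn_const
    · intro t _ p hp
      rw [Real.coe_toNNReal _ (by positivity)]
      rw [Metric.mem_closedBall, Real.coe_toNNReal _ ha0.le, Prod.dist_eq] at hp
      have hp2 : |p.2| ≤ a := by
        have := (le_max_right _ _).trans hp
        simpa [Real.dist_eq] using this
      rw [Prod.norm_def]
      refine max_le ?_ ?_
      · simp only [Real.norm_eq_abs, abs_div, abs_of_pos hℓ]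
        gcongr
      · simp only [Real.norm_eq_abs, abs_mul, abs_of_pos hℓ]
        rw [le_div_iff₀ hℓ]
        have := hbd p.1
        have h2 : ℓ * |G p.1| * ℓ ≤ ℓ * Γ * ℓ := by gcongr
        nlinarith
    · rw [Real.coe_toNNReal _ (by positivity), Real.coe_toNNReal _ ha0.le]
      simp
      field_simp
      exact le_rfl
  obtain ⟨α, h0, hα⟩ := hPL.exists_eq_forall_mem_Icc_hasDerivWithinAt₀
  refine ⟨fun z => (α z).1, fun z => (α z).2 / ℓ, ?_, ?_, ?_⟩
  · simp only at h0 ⊢; rw [h0]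
  · simp only at h0 ⊢; rw [h0]; simp
  · intro z h1 h2
    have hz := (hα z ⟨h1.le, h2.le⟩).hasDerivAt (Icc_mem_nhds h1 h2)
    have hz1 : HasDerivAt (fun z => (α z).1) ((α z).2 / ℓ) z := by
      exact hasFDerivAt_fst.comp_hasDerivAt z hz
    have hz2 : HasDerivAt (fun z => (α z).2) (ℓ * G (α z).1) z := by
      exact hasFDerivAt_snd.comp_hasDerivAt z hz
    refine ⟨hz1, ?_⟩
    have := hz2.div_const ℓ
    simpa [hℓ.ne'] using this

/-- backward front ODE -/
lemma NL.front_ode {δ d : ℝ} {f : ℝ → ℝ} (N : NL δ f) (hd : 0 < d) :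
    ∃ (ε z₀ : ℝ) (y y1 : ℝ → ℝ), 0 < ε ∧ z₀ < 0 ∧ y 0 = δ ∧ y z₀ = 0 ∧
      (∀ z, z₀ ≤ z → z ≤ 0 → 0 ≤ y z ∧ y z ≤ δ) ∧
      (∀ z, z₀ ≤ z → z ≤ 0 → (∀ᶠ s in 𝓝 z, HasDerivAt y (y1 s) s) ∧
        HasDerivAt y1 ((ε - f (y z)) / d) z) ∧
      (∀ᶠ z in 𝓝[>] 0, y z ≤ δ) := by
  obtain ⟨ε', hε', hfr⟩ := N.front
  have hfδ : 0 < f δ := N.fpos δ le_rfl N.δ1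
  set ε := min (ε' / 2) (f δ / 2) with hε
  have hε0 : 0 < ε := by positivity
  have k1 : ε ≤ ε' / 2 := min_le_left _ _
  have k2 : ε ≤ f δ / 2 := min_le_right _ _
  obtain ⟨K, hK, hlip⟩ := N.lip δ
  set cl : ℝ → ℝ := fun v => max 0 (min v δ) with hcl
  have cl0 : ∀ v, 0 ≤ cl v := fun v => le_max_left _ _
  have cl1 : ∀ v, cl v ≤ δ := fun v => max_le N.δ0.le (min_le_right _ _)
  have clid : ∀ v, 0 ≤ v → v ≤ δ → cl v = v := fun v a b => by
    simp only [hcl, min_eq_left b, max_eq_right a]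
  have cllip : ∀ a b, |cl a - cl b| ≤ |a - b| := by
    intro a b
    have h1 := abs_max_sub_max_le_abs (min a δ) (min b δ) 0
    have h2 := abs_min_sub_min_le_max a δ b δ
    simp only [sub_self, abs_zero, abs_nonneg, sup_of_le_left] at h2
    simp only [hcl]
    rw [max_comm 0, max_comm 0]
    exact h1.trans h2
  set F : ℝ → ℝ := fun v => f (cl v) with hF
  have Flip : ∀ a b, |F a - F b| ≤ K * |a - b| := fun a b =>
    (hlip _ _ (cl0 a) (cl1 a) (cl0 b) (cl1 b)).trans (by
      have := cllip a b; gcongr)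
  have Fb : ∀ a, |F a| ≤ K * δ := by
    intro a
    have := hlip (cl a) 0 (cl0 a) (cl1 a) le_rfl N.δ0.le
    rw [N.f0, sub_zero, sub_zero, abs_of_nonneg (cl0 a)] at this
    exact this.trans (by have := cl1 a; gcongr)
  have Fc : Continuous F := by
    have : LipschitzWith (Real.toNNReal K) F := LipschitzWith.of_dist_le_mul (fun a b => by
      rw [Real.coe_toNNReal _ hK.le]; exact Flip a b)
    exact this.continuous
  set k := Real.sqrt (ε / (2 * d)) with hk
  have hk0 : 0 < k := Real.sqrt_pos.mpr (by positivity)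
  have hksq : k ^ 2 = ε / (2 * d) := Real.sq_sqrt (by positivity)
  set ℓ := Real.sqrt δ / k + 1 with hℓ
  have hℓ0 : 0 < ℓ := by positivity
  obtain ⟨y, y1, hy0, hy10, hy⟩ := ode2 (G := fun v => (ε - F v) / d) (K := K / d)
    (Γ := (ε + K * δ) / d) (ℓ := ℓ + 1) (y0 := δ) (by positivity)
    (by have := N.δ0; positivity) (by positivity)
    (by
      intro a b
      have e : (ε - F a) / d - (ε - F b) / d = -(F a - F b) / d := by ring
      rw [e, abs_div, abs_neg, abs_of_pos hd, div_mul_eq_mul_div]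
      exact div_le_div_of_nonneg_right (Flip a b) hd.le)
    (by
      intro a
      rw [abs_div, abs_of_pos hd]
      refine div_le_div_of_nonneg_right ?_ hd.le
      have := abs_sub ε (F a)
      rw [abs_of_pos hε0] at this
      linarith [Fb a])
  have dy : ∀ z, -ℓ ≤ z → z ≤ 0 → HasDerivAt y (y1 z) z := fun z a b =>
    (hy z (by linarith) (by linarith)).1
  have dy1 : ∀ z, -ℓ ≤ z → z ≤ 0 → HasDerivAt y1 ((ε - F (y z)) / d) z := fun z a b =>
    (hy z (by linarith) (by linarith)).2
  have yc : ContinuousOn y (Icc (-ℓ) 0) := fun z hz => (dy z hz.1 hz.2).continuousAt.continuousWithinAt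
  have y1c : ContinuousOn y1 (Icc (-ℓ) 0) :=
    fun z hz => (dy1 z hz.1 hz.2).continuousAt.continuousWithinAt
  -- second derivative at 0
  have hneg : (ε - F (y 0)) / d < 0 := by
    rw [hy0]
    simp only [hF, clid δ N.δ0.le le_rfl]
    apply div_neg_of_neg_of_pos _ hd
    linarith
  have hslope : ∀ᶠ z in 𝓝[≠] (0:ℝ), y1 z / z < 0 := by
    have := hasDerivAt_iff_tendsto_slope.mp (dy1 0 (by linarith) le_rfl)
    filter_upwards [this.eventually (gt_mem_nhds hneg)] with z hz
    rw [slope_def_field, hy10] at hz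
    simpa using hz
  -- right of 0
  have hright : ∀ᶠ z in 𝓝[>] (0:ℝ), y z ≤ δ := by
    have h1 : ∀ᶠ z in 𝓝[>] (0:ℝ), y1 z < 0 := by
      filter_upwards [hslope.filter_mono (nhdsWithin_mono _ (fun z hz => ne_of_gt hz)),
        self_mem_nhdsWithin] with z hz hz0
      have hz0 : 0 < z := hz0
      by_contra hc
      push Not at hc
      have := div_nonneg hc hz0.le
      linarith
    obtain ⟨b, hb, hbI⟩ := (mem_nhdsGT_iff_exists_Ioc_subset).mp h1
    have hb : 0 < b := hb
    filter_upwards [Ioo_mem_nhdsGT (show (0:ℝ) < min b ℓ from lt_min hb hℓ0)] with z hz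
    have m1 := min_le_left b ℓ
    have m2 := min_le_right b ℓ
    obtain ⟨ζ, hζ, he⟩ := exists_hasDerivAt_eq_slope y y1 hz.1
      (fun x hx => ((hy x (by linarith [hx.1]) (by linarith [hx.2, hz.2])).1).continuousAt.continuousWithinAt)
      (fun x hx => (hy x (by linarith [hx.1]) (by linarith [hx.2, hz.2])).1)
    have h2 : y1 ζ < 0 := hbI ⟨hζ.1, by linarith [hζ.2, hz.2]⟩
    rw [he, hy0, sub_zero] at h2
    by_contra hc
    push Not at hc
    have := div_nonneg (show 0 ≤ y z - δ by linarith) hz.1.le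
    linarith
  -- left of 0
  have hleft : ∃ ζ, -ℓ < ζ ∧ ζ < 0 ∧ ∀ z, ζ ≤ z → z < 0 → 0 < y1 z := by
    have h1 : ∀ᶠ z in 𝓝[<] (0:ℝ), 0 < y1 z := by
      filter_upwards [hslope.filter_mono (nhdsWithin_mono _ (fun z hz => ne_of_lt hz)),
        self_mem_nhdsWithin] with z hz hz0
      have hz0 : z < 0 := hz0
      by_contra hc
      push Not at hc
      have := div_nonneg_of_nonpos hc hz0.le
      linarith
    obtain ⟨b, hb, hbI⟩ := (mem_nhdsLT_iff_exists_Ico_subset).mp h1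
    refine ⟨max b (-ℓ / 2), ?_, ?_, fun z a c => hbI ⟨(le_max_left _ _).trans a, c⟩⟩
    · exact lt_of_lt_of_le (by linarith) (le_max_right _ _)
    · exact max_lt hb (by linarith)
  obtain ⟨ζ, hζ1, hζ2, hζ⟩ := hleft
  -- energy
  have energy : ∀ z, -ℓ ≤ z → z ≤ 0 → d * y1 z ^ 2 / 2 = ∫ s in (y z)..δ, (F s - ε) := by
    intro z hz1 hz2
    set E : ℝ → ℝ := fun z => d * y1 z ^ 2 / 2 + ∫ s in δ..(y z), (F s - ε) with hE
    have hcF : Continuous (fun s => F s - ε) := Fc.sub continuous_const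
    have dE : ∀ x ∈ Icc (-ℓ) (0:ℝ), HasDerivAt E 0 x := by
      intro x hx
      have e1 := dy1 x hx.1 hx.2
      have e2 := dy x hx.1 hx.2
      have e3 : HasDerivAt (fun v => ∫ s in δ..v, (F s - ε)) (F (y x) - ε) (y x) :=
        intervalIntegral.integral_hasDerivAt_right (hcF.intervalIntegrable _ _)
          hcF.stronglyMeasurable.stronglyMeasurableAtFilter hcF.continuousAt
      have e4 := e3.comp x e2
      have e5 := (((e1.pow 2).const_mul d).div_const 2).fun_add e4
      refine (e5.congr_deriv ?_)
      field_simp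
      ring
    have hcst := constant_of_has_deriv_right_zero (f := E) (a := z) (b := 0)
      (fun x hx => (dE x ⟨hz1.trans hx.1, hx.2⟩).continuousAt.continuousWithinAt)
      (fun x hx => (dE x ⟨hz1.trans hx.1, hx.2.le⟩).hasDerivWithinAt) 0 ⟨hz2, le_rfl⟩
    simp only [hE, hy0, hy10, intervalIntegral.integral_same] at hcst
    rw [intervalIntegral.integral_symm]
    linarith
  have elow : ∀ z, -ℓ ≤ z → z ≤ 0 → 0 ≤ y z → y z ≤ δ → ε * (δ - y z) ≤ d * y1 z ^ 2 / 2 := by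
    intro z a b c e
    rw [energy z a b, intervalIntegral.integral_sub (Fc.intervalIntegrable _ _) (by simp)]
    have e1 : ∫ s in (y z)..δ, F s = ∫ s in (y z)..δ, f s := by
      refine intervalIntegral.integral_congr ?_
      intro s hs
      rw [uIcc_of_le e] at hs
      simp only [hF, clid s (c.trans hs.1) hs.2]
    rw [e1]
    have := hfr (y z) c e
    simp only [intervalIntegral.integral_const, smul_eq_mul]
    nlinarith
  -- monotonicity
  have mono : ∀ z, -ℓ ≤ z → z < 0 → (∀ s, z ≤ s → s ≤ 0 → 0 ≤ y s) → 0 < y1 z := by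
    intro z hz1 hz2 hpos
    rcases le_or_gt ζ z with hc | hc
    · exact hζ z hc hz2
    -- first zero going left: m s = y1 (-s)
    have := first_zero (m := fun s => y1 (-s)) (T := -ζ) (T' := -z)
      (y1c.comp continuousOn_neg (fun s hs => ⟨by linarith [hs.2], by linarith [hs.1]⟩))
      (by simpa using hζ ζ le_rfl hζ2) (by
        intro s hs hpre hz
        have hp : ∀ r, -s < r → r < 0 → 0 < y1 r := by
          intro r h1 h2
          rcases le_or_gt ζ r with h | h
          · exact hζ r h h2
          · have := hpre (-r) ⟨by linarith, by linarith⟩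
            simpa using this
        have hs1 := hs.1
        have hs2 := hs.2
        have hs0 : -s < 0 := by linarith
        have hlt : y (-s) < δ := by
          obtain ⟨ξ, hξ, he⟩ := exists_hasDerivAt_eq_slope y y1 hs0
            (yc.mono (Icc_subset_Icc (by linarith) le_rfl))
            (fun x hx => dy x (by linarith [hx.1]) hx.2.le)
          have h1 := hp ξ hξ.1 hξ.2
          rw [he, hy0] at h1
          by_contra hc
          push Not at hc
          have := div_nonpos_of_nonpos_of_nonneg (show δ - y (-s) ≤ 0 by linarith)
            (show 0 ≤ 0 - -s by linarith)
          linarith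
        have := elow (-s) (by linarith) hs0.le (hpos (-s) (by linarith) hs0.le) hlt.le
        rw [hz] at this
        nlinarith)
    simpa using this (-z) ⟨by linarith, le_rfl⟩
  have ylt : ∀ z, -ℓ ≤ z → z < 0 → (∀ s, z ≤ s → s ≤ 0 → 0 ≤ y s) → y z < δ := by
    intro z hz1 hz2 hpos
    obtain ⟨ξ, hξ, he⟩ := exists_hasDerivAt_eq_slope y y1 hz2
      (yc.mono (Icc_subset_Icc hz1 le_rfl))
      (fun x hx => dy x (by linarith [hx.1]) hx.2.le)
    have h1 := mono ξ (by linarith [hξ.1]) hξ.2 (fun s a b => hpos s (by linarith [hξ.1]) b)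
    rw [he, hy0] at h1
    by_contra hc
    push Not at hc
    have := div_nonpos_of_nonpos_of_nonneg (show δ - y z ≤ 0 by linarith)
      (show 0 ≤ 0 - z by linarith)
    linarith
  -- y reaches 0
  have reach : ∃ z ∈ Icc (-ℓ) (0:ℝ), y z ≤ 0 := by
    by_contra hcon
    push Not at hcon
    have hp : ∀ z, -ℓ ≤ z → ∀ s, z ≤ s → s ≤ 0 → 0 ≤ y s := fun z a s b c =>
      (hcon s ⟨a.trans b, c⟩).le
    have hS : ∀ x ∈ Ioo (-ℓ) (0:ℝ), HasDerivAt (fun z => Real.sqrt (δ - y z))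
        ((0 - y1 x) / (2 * Real.sqrt (δ - y x))) x := by
      intro x hx
      have h1 := ylt x hx.1.le hx.2 (hp x hx.1.le)
      exact ((hasDerivAt_const x δ).fun_sub (dy x hx.1.le hx.2.le)).sqrt (by linarith)
    obtain ⟨ξ, hξ, he⟩ := exists_hasDerivAt_eq_slope (fun z => Real.sqrt (δ - y z))
      (fun x => (0 - y1 x) / (2 * Real.sqrt (δ - y x))) (show -ℓ < 0 by linarith)
      ((continuousOn_const.sub yc).sqrt) hS
    have h1 := ylt ξ hξ.1.le hξ.2 (hp ξ hξ.1.le)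
    have h2 := mono ξ hξ.1.le hξ.2 (hp ξ hξ.1.le)
    have h3 := elow ξ hξ.1.le hξ.2.le (hp ξ hξ.1.le ξ le_rfl hξ.2.le) h1.le
    set r := Real.sqrt (δ - y ξ) with hr
    have hr0 : 0 < r := Real.sqrt_pos.mpr (by linarith)
    have hrsq : r ^ 2 = δ - y ξ := Real.sq_sqrt (by linarith)
    -- y1 ≥ 2 k r
    have h4 : 2 * k * r ≤ y1 ξ := by
      refine le_of_sq_le_sq ?_ h2.le
      have : (2 * k * r) ^ 2 = 4 * k ^ 2 * r ^ 2 := by ring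
      rw [this, hksq, hrsq]
      have e : 4 * (ε / (2 * d)) * (δ - y ξ) = 2 * (ε * (δ - y ξ)) / d := by field_simp; ring
      rw [e, div_le_iff₀ hd]
      nlinarith
    have h5 : (0 - y1 ξ) / (2 * r) ≤ -k := by
      rw [div_le_iff₀ (by positivity)]; nlinarith
    rw [he] at h5
    simp only [hy0, sub_self, Real.sqrt_zero] at h5
    rw [div_le_iff₀ (by linarith)] at h5
    have h6 : Real.sqrt (δ - y (-ℓ)) ≤ Real.sqrt δ := Real.sqrt_le_sqrt (by
      linarith [hcon (-ℓ) ⟨le_rfl, by linarith⟩])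
    have h7 : k * ℓ = Real.sqrt δ + k := by rw [hℓ]; field_simp
    linarith
  -- last zero
  have hcz : IsCompact (Icc (-ℓ) (0:ℝ) ∩ y ⁻¹' Iic 0) :=
    isCompact_Icc.of_isClosed_subset (yc.preimage_isClosed_of_isClosed isClosed_Icc isClosed_Iic)
      inter_subset_left
  obtain ⟨z1, hz1, hz1'⟩ := reach
  obtain ⟨z₀, hz0, hmax⟩ := hcz.exists_isMaxOn ⟨z1, hz1, hz1'⟩ continuousOn_id
  have hz00 : y z₀ ≤ 0 := hz0.2
  have hzneg : z₀ < 0 := by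
    rcases eq_or_lt_of_le hz0.1.2 with e | e
    · rw [e, hy0] at hz00; linarith [N.δ0]
    · exact e
  have hposr : ∀ z, z₀ < z → z ≤ 0 → 0 < y z := by
    intro z a b
    by_contra hc
    push Not at hc
    have := isMaxOn_iff.mp hmax z ⟨⟨hz0.1.1.trans a.le, b⟩, hc⟩
    simp at this
    linarith
  have hyz : y z₀ = 0 := by
    refine le_antisymm hz00 ?_
    have : Tendsto y (𝓝[>] z₀) (𝓝 (y z₀)) :=
      (dy z₀ hz0.1.1 hzneg.le).continuousAt.tendsto.mono_left nhdsWithin_le_nhds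
    refine ge_of_tendsto this ?_
    filter_upwards [Ioo_mem_nhdsGT hzneg] with z hz
    exact (hposr z hz.1 hz.2.le).le
  have hnn : ∀ z, z₀ ≤ z → z ≤ 0 → 0 ≤ y z := by
    intro z a b
    rcases eq_or_lt_of_le a with e | e
    · rw [← e, hyz]
    · exact (hposr z e b).le
  have hle : ∀ z, z₀ ≤ z → z ≤ 0 → y z ≤ δ := by
    intro z a b
    rcases eq_or_lt_of_le b with e | e
    · rw [e, hy0]
    · exact (ylt z (hz0.1.1.trans a) e (fun s a' b' => hnn s (a.trans a') b')).le
  refine ⟨ε, z₀, y, y1, hε0, hzneg, hy0, hyz, fun z a b => ⟨hnn z a b, hle z a b⟩, ?_, hright⟩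
  intro z a b
  constructor
  · filter_upwards [Ioo_mem_nhds (show -(ℓ + 1) < z by linarith [hz0.1.1])
      (show z < ℓ + 1 by linarith)] with s hs
    exact (hy s hs.1 hs.2).1
  · have := dy1 z (hz0.1.1.trans a) b
    simpa only [hF, clid (y z) (hnn z a b) (hle z a b)] using this

end FA

open Set Filter Topology

namespace FA

section
variable {d δ : ℝ} {f : ℝ → ℝ} {u : ℝ → ℝ → ℝ} {g h : ℝ → ℝ}

lemma FB.plateau_one (S : FB d δ f u g h) (hd : 0 < d) (N : NL δ f) :
    ∃ k > 0, ∀ k', 0 < k' → k' ≤ k → ∃ R, ∀ t, 0 ≤ t → ∀ x, g t ≤ x → x ≤ h t →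
      R - k' * t ≤ x → δ ≤ u t x := by
  obtain ⟨ε, z₀, y, y1, hε, hz0, hy0, hyz, hyb, hyd, hyr⟩ := N.front_ode hd
  have yc : ContinuousOn y (Icc z₀ 0) := fun z hz =>
    ((hyd z hz.1 hz.2).1.self_of_nhds).continuousAt.continuousWithinAt
  have y1c : ContinuousOn y1 (Icc z₀ 0) := fun z hz =>
    ((hyd z hz.1 hz.2).2).continuousAt.continuousWithinAt
  obtain ⟨Y, hY⟩ := isCompact_Icc.exists_bound_of_continuousOn y1c
  have hY0 : 0 ≤ Y := (norm_nonneg _).trans (hY 0 ⟨hz0.le, le_rfl⟩)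
  obtain ⟨K, hK, hlip⟩ := N.lip 1
  refine ⟨ε / (2 * (Y + 1)), by positivity, fun k hk0 hk => ?_⟩
  have hkY : k * Y ≤ ε / 2 := by
    rw [le_div_iff₀ (by positivity)] at hk
    nlinarith
  set R := h 0 - z₀ with hR
  refine ⟨R, fun T' hT' x hx1 hx2 hx3 => ?_⟩
  set cl : ℝ → ℝ := fun z => max z₀ (min z 0) with hcl
  have clm : ∀ z, cl z ∈ Icc z₀ 0 := fun z => ⟨le_max_left _ _, max_le hz0.le (min_le_right _ _)⟩
  have clc : Continuous cl := by fun_prop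
  set Φ : ℝ → ℝ := fun z => y (cl z) with hΦ
  have Φc : Continuous Φ := yc.comp_continuous clc clm
  have Φb : ∀ z, 0 ≤ Φ z ∧ Φ z ≤ δ := fun z => hyb _ (clm z).1 (clm z).2
  have Φ0 : ∀ z, z ≤ z₀ → Φ z = 0 := fun z hz => by
    have : cl z = z₀ := by simp only [hcl]; rw [max_eq_left]; exact (min_le_left _ _).trans hz
    simp only [hΦ, this, hyz]
  have Φ1 : ∀ z, 0 ≤ z → Φ z = δ := fun z hz => by
    have : cl z = 0 := by simp only [hcl]; rw [min_eq_right hz, max_eq_right hz0.le]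
    simp only [hΦ, this, hy0]
  have Φy : ∀ z, z₀ ≤ z → z ≤ 0 → Φ z = y z := fun z a b => by
    have : cl z = z := by simp only [hcl]; rw [min_eq_left b, max_eq_right a]
    simp only [hΦ, this]
  -- key comparison for small ι
  have hfδ : 0 < f δ := N.fpos δ le_rfl N.δ1
  have hca : ContinuousAt f δ := N.fc.continuousAt (Ici_mem_nhds N.δ0)
  obtain ⟨ρ, hρ, hball⟩ := Metric.eventually_nhds_iff.mp (hca.eventually (lt_mem_nhds hfδ))
  set ι₀ := min ρ (min δ (ε / (2 * K))) with hι₀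
  have hι₀0 : 0 < ι₀ := lt_min hρ (lt_min N.δ0 (by positivity))
  have q1 : ι₀ ≤ ρ := min_le_left _ _
  have q2 : ι₀ ≤ δ := (min_le_right _ _).trans (min_le_left _ _)
  have q3 : ι₀ ≤ ε / (2 * K) := (min_le_right _ _).trans (min_le_right _ _)
  rw [le_div_iff₀ (by positivity)] at q3
  have key : ∀ ι, 0 < ι → ι < ι₀ → δ - ι < u T' x := by
    intro ι hι hι1
    have hcomp := S.dcl_low hd le_rfl (T' := T') (A := g) (B := h)
      (w := fun t x => Φ (x - R + k * t) - ι)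
      (S.gc.mono fun s hs => hs.1) (S.hc.mono fun s hs => hs.1)
      (fun _ _ _ => le_rfl) (fun _ _ _ => le_rfl) (by fun_prop)
      (by
        intro y h1 h2
        have e := Φ0 (y - R + k * 0) (by rw [hR]; linarith)
        simp only [e]
        linarith [S.pos0 y h1 h2])
      (by
        intro t h1 h2
        rw [S.bg t h1.le]
        have := (Φb (g t - R + k * t)).2
        linarith)
      (by
        intro t h1 h2
        rw [S.bh t h1.le]
        have := (Φb (h t - R + k * t)).2
        linarith)
      (by
        intro t h1 h2 x h3 h4 h5
        have hupos := S.pos hd N t h1.le x h3.le h4.le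
        rw [← h5] at hupos
        set z := x - R + k * t with hz
        rcases lt_or_ge 0 z with hzp | hzn
        · -- constant part
          refine ⟨fun _ _ => δ - ι, 0, fun _ => 0, 0, ?_, ?_, ?_, hasDerivAt_const _ _,
            Eventually.of_forall fun y => hasDerivAt_const _ _, hasDerivAt_const _ _, ?_⟩
          · simp only [← hz, Φ1 z hzp.le]
          · have hc : ContinuousAt (fun s => x - R + k * s) t := by fun_prop
            filter_upwards [(hc.eventually (lt_mem_nhds hzp)).filter_mono nhdsWithin_le_nhds] with s hs
            simp only [Φ1 _ (le_of_lt hs)]; exact le_rfl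
          · have hc : ContinuousAt (fun r => r - R + k * t) x := by fun_prop
            filter_upwards [(hc.eventually (lt_mem_nhds hzp))] with s hs
            simp only [Φ1 _ (le_of_lt hs)]; exact le_rfl
          · simp only [← hz, Φ1 z hzp.le]
            have : 0 < f (δ - ι) := hball (by
              rw [Real.dist_eq, abs_lt]; constructor <;> linarith)
            linarith
        · have hzz : z₀ < z := by
            by_contra hc
            push Not at hc
            rw [Φ0 z hc] at hupos
            linarith
          obtain ⟨d1, d2⟩ := hyd z hzz.le hzn
          have hb := hyb z hzz.le hzn
          rw [Φy z hzz.le hzn] at hupos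
          refine ⟨fun s r => y (r - R + k * s) - ι, y1 z * k, fun r => y1 (r - R + k * t),
            (ε - f (y z)) / d, ?_, ?_, ?_, ?_, ?_, ?_, ?_⟩
          · simp only [← hz, Φy z hzz.le hzn]
          · have hc : ContinuousAt (fun s => x - R + k * s) t := by fun_prop
            filter_upwards [(hc.eventually (lt_mem_nhds hzz)).filter_mono nhdsWithin_le_nhds,
              self_mem_nhdsWithin] with s hs hst
            have hst : s < t := hst
            have : x - R + k * s ≤ 0 := by
              have : k * s ≤ k * t := by gcongr
              linarith
            simp only [Φy _ (le_of_lt hs) this]; exact le_rfl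
          · have hc : ContinuousAt (fun r => r - R + k * t) x := by fun_prop
            have hr : ∀ᶠ r in 𝓝 z, y r ≤ Φ r := by
              have h1 : ∀ᶠ r in 𝓝 z, r ≤ 0 ∨ y r ≤ δ := by
                rcases eq_or_lt_of_le hzn with e | e
                · rw [e]
                  have h2 := eventually_nhdsWithin_iff.mp hyr
                  filter_upwards [h2] with r hr
                  rcases le_or_gt r 0 with h | h
                  · exact Or.inl h
                  · exact Or.inr (hr h)
                · filter_upwards [gt_mem_nhds e] with r hr
                  exact Or.inl (le_of_lt hr)
              filter_upwards [lt_mem_nhds hzz, h1] with r hr1 hr2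
              rcases le_or_gt r 0 with h | h
              · rw [Φy r (le_of_lt hr1) h]
              · rw [Φ1 r h.le]
                rcases hr2 with h' | h'
                · linarith
                · exact h'
            filter_upwards [hc.eventually hr] with r hr
            exact sub_le_sub_right hr _
          · have hin : HasDerivAt (fun s => x - R + k * s) k t := by
              simpa using ((hasDerivAt_id t).const_mul k).const_add (x - R)
            exact (d1.self_of_nhds.comp t hin).sub_const ι
          · have hc : ContinuousAt (fun r => r - R + k * t) x := by fun_prop
            filter_upwards [hc.eventually d1] with r hr
            have hin : HasDerivAt (fun r => r - R + k * t) 1 r := by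
              simpa using ((hasDerivAt_id r).sub_const R).add_const (k * t)
            simpa using (hr.comp r hin).sub_const ι
          · have hin : HasDerivAt (fun r => r - R + k * t) 1 x := by
              simpa using ((hasDerivAt_id x).sub_const R).add_const (k * t)
            have := HasDerivAt.comp (h₂ := y1) x d2 hin
            simpa [Function.comp_def] using this
          · simp only [← hz, Φy z hzz.le hzn]
            rw [mul_div_cancel₀ _ hd.ne']
            have e1 := hlip (y z) (y z - ι) (by linarith) (by linarith [N.δ1]) hupos.le
              (by linarith [N.δ1])
            rw [sub_sub_cancel, abs_of_pos hι] at e1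
            have e2 := (abs_le.mp e1).2
            have e3 := (abs_le.mp (hY z ⟨hzz.le, hzn⟩)).2
            nlinarith) T' hT' le_rfl x hx1 hx2
    simp only [Φ1 (x - R + k * T') (by linarith)] at hcomp
    exact hcomp
  by_contra hc
  push Not at hc
  have h1 := key (min (ι₀ / 2) (δ - u T' x)) (lt_min (by linarith) (by linarith))
    ((min_le_left _ _).trans_lt (by linarith))
  have h2 := min_le_right (ι₀ / 2) (δ - u T' x)
  linarith

lemma FB.plateau (S : FB d δ f u g h) (hd : 0 < d) (N : NL δ f) :
    ∃ T, 0 ≤ T ∧ ∀ t, T ≤ t → ∀ x, g t ≤ x → x ≤ h t → δ ≤ u t x := by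
  obtain ⟨k1, hk1, H1⟩ := S.plateau_one hd N
  obtain ⟨k2, hk2, H2⟩ := S.reflect.plateau_one hd N
  set k := min k1 k2
  have hk : 0 < k := lt_min hk1 hk2
  obtain ⟨R1, hR1⟩ := H1 k hk (min_le_left _ _)
  obtain ⟨R2, hR2⟩ := H2 k hk (min_le_right _ _)
  refine ⟨max 0 ((R1 + R2) / (2 * k)), le_max_left _ _, fun t ht x hx1 hx2 => ?_⟩
  have ht0 : 0 ≤ t := (le_max_left _ _).trans ht
  have ht1 : (R1 + R2) / (2 * k) ≤ t := (le_max_right _ _).trans ht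
  rw [div_le_iff₀ (by positivity)] at ht1
  rcases le_total (R1 - k * t) x with h1 | h1
  · exact hR1 t ht0 x hx1 hx2 h1
  · have := hR2 t ht0 (-x) (by simpa using hx2) (by simpa using hx1) (by nlinarith)
    simpa using this

lemma FB.plateau_strict (S : FB d δ f u g h) (hd : 0 < d) (N : NL δ f) :
    ∃ T, 0 < T ∧ (∀ t, T ≤ t → ∀ x, g t ≤ x → x ≤ h t → δ ≤ u t x) ∧
      ∀ t, T ≤ t → ∀ x, g t < x → x < h t → δ < u t x := by
  obtain ⟨T, hT, hle⟩ := S.plateau hd N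
  refine ⟨T + 1, by linarith, fun t ht => hle t (by linarith), fun t ht x h1 h2 => ?_⟩
  have ht0 : 0 < t := by linarith
  by_contra hc
  push Not at hc
  have heq : u t x = δ := le_antisymm hc (hle t (by linarith) x h1.le h2.le)
  have e2 : 0 ≤ deriv (deriv (u t)) x := by
    refine second_deriv_nonneg (S.ux_ev ht0 h1 h2) (S.uxx t ht0 x h1 h2) ?_
    filter_upwards [Ioo_mem_nhds h1 h2] with y hy
    rw [heq]; exact hle t (by linarith) y hy.1.le hy.2.le
  have e1 := deriv_nonpos_of_left (S.ut t ht0 x h1 h2) (by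
    have c1 := (S.gc.continuousAt (Ici_mem_nhds ht0)).eventually (gt_mem_nhds h1)
    have c2 := (S.hc.continuousAt (Ici_mem_nhds ht0)).eventually (lt_mem_nhds h2)
    have c3 := lt_mem_nhds (show T < t by linarith)
    filter_upwards [c1.filter_mono nhdsWithin_le_nhds, c2.filter_mono nhdsWithin_le_nhds,
      Filter.Eventually.filter_mono nhdsWithin_le_nhds c3] with s a b c
    rw [heq]; exact hle s (le_of_lt c) x a.le b.le)
  have := N.fpos δ le_rfl N.δ1
  rw [heq] at e1
  nlinarith

end

end FA

open Set Filter Topology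

namespace FA

section
variable {d δ : ℝ} {f : ℝ → ℝ} {u : ℝ → ℝ → ℝ} {g h : ℝ → ℝ}

lemma tanh_mono' {a b : ℝ} (hab : a ≤ b) :
    Real.sinh a / Real.cosh a ≤ Real.sinh b / Real.cosh b := by
  rw [div_le_div_iff₀ (Real.cosh_pos a) (Real.cosh_pos b)]
  have h1 : 0 ≤ Real.sinh (b - a) := Real.sinh_nonneg_iff.mpr (by linarith)
  rw [Real.sinh_sub] at h1
  linarith

lemma cosh_alg {d δ m A κ k₁ Cc th e : ℝ} {f : ℝ → ℝ} (hm : 0 < m) (hA : A = 1 - δ)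
    (hlin : ∀ v, δ ≤ v → v ≤ 1 → m * (1 - v) ≤ f v) (hA0 : 0 < A) (hκ0 : 0 < κ) (hk0 : 0 < k₁)
    (hκ2 : d * κ ^ 2 = m / 2) (hk2 : κ * k₁ ≤ m / 2) (hC0 : 0 < Cc) (hC1 : Cc < 1)
    (hth2 : 0 < th) (hth1 : th ≤ 1) (ea : 0 < e) (eb : e < 1) :
    A * (m / 2 * e) * (1 - Cc) + A * (1 - e) * (Cc * (κ * (k₁ * (1 - e)) * th)) <
      d * (-(A * (1 - e)) * (κ ^ 2 * Cc)) + f (δ + A * (1 - e) * (1 - Cc)) := by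
  obtain ⟨a', ha'⟩ : ∃ a', a' = 1 - e := ⟨_, rfl⟩
  have ha0 : 0 < a' := by rw [ha']; linarith
  have ha1 : a' < 1 := by rw [ha']; linarith
  have hee : e = 1 - a' := by rw [ha']; ring
  rw [← ha', hee]
  have hw2 : 0 < a' * (1 - Cc) := mul_pos ha0 (by linarith)
  have hw3 : a' * (1 - Cc) < 1 := by nlinarith
  have hf := hlin (δ + A * a' * (1 - Cc)) (by nlinarith) (by nlinarith)
  have hf' : m * (A * (1 - a' + a' * Cc)) ≤ f (δ + A * a' * (1 - Cc)) := by
    refine le_trans (le_of_eq ?_) hf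
    rw [hA]; ring
  have p1 : a' * Cc * (κ * (k₁ * a') * th) ≤ a' * Cc * (m / 2) := by
    have q1 : κ * k₁ * (a' * th) ≤ m / 2 * 1 := by
      have : a' * th ≤ 1 := by nlinarith
      have h0 : 0 ≤ a' * th := by positivity
      have h1 : 0 < κ * k₁ := by positivity
      nlinarith
    have q2 : κ * (k₁ * a') * th ≤ m / 2 := by linarith
    have : 0 < a' * Cc := by positivity
    nlinarith
  have p2 : m / 2 * (1 - a') * (1 - Cc) < m * (1 - a') := by
    have : 0 < 1 - a' := by linarith
    nlinarith [mul_pos hm this, mul_pos (mul_pos hm this) hC0]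
  have goal' : m / 2 * (1 - a') * (1 - Cc) + a' * Cc * (κ * (k₁ * a') * th) <
      - (d * κ ^ 2) * (a' * Cc) + m * (1 - a' + a' * Cc) := by
    rw [hκ2]; linarith
  have := mul_lt_mul_of_pos_left goal' hA0
  linarith

set_option maxHeartbeats 1000000 in
lemma FB.cosh_spread (S : FB d δ f u g h) (hd : 0 < d) (N : NL δ f) :
    ∃ x₀ C γ T, 0 < C ∧ 0 < γ ∧ 0 < T ∧
      (∀ t, T ≤ t → ∀ x, g t ≤ x → x ≤ h t → δ ≤ u t x) ∧
      (∀ t, T ≤ t → ∀ x, g t < x → x < h t → δ < u t x) ∧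
      ∀ t, T ≤ t → g t < x₀ ∧ x₀ + 1 < h t ∧ ∀ x, x₀ ≤ x → x ≤ x₀ + 1 →
        1 - C * Real.exp (-γ * t) < u t x := by
  obtain ⟨T, hT, hle, hlt⟩ := S.plateau_strict hd N
  obtain ⟨m, hm, hlin⟩ := N.lin
  have hδ0 := N.δ0
  have hδ1 := N.δ1
  have hgh := S.gh T hT.le
  set A := 1 - δ with hA
  have hA0 : 0 < A := by rw [hA]; linarith
  set x₀ := (g T + h T) / 2 with hx₀
  set L₀ := (h T - g T) / 4 with hL₀
  have hL0 : 0 < L₀ := by rw [hL₀]; linarith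
  set κ := Real.sqrt (m / (2 * d)) with hκ
  have hκ0 : 0 < κ := Real.sqrt_pos.mpr (by positivity)
  have hκ2 : d * κ ^ 2 = m / 2 := by
    rw [hκ, Real.sq_sqrt (by positivity)]; field_simp
  set th₀ := Real.sinh (κ * L₀) / Real.cosh (κ * L₀) with hth₀
  have hth0 : 0 < th₀ := div_pos (Real.sinh_pos_iff.mpr (by positivity)) (Real.cosh_pos _)
  set k₁ := min (d / δ * A * κ * th₀ / 2) (m / (2 * κ)) with hk₁
  have hk0 : 0 < k₁ := lt_min (by positivity) (by positivity)
  have hk1 : k₁ < d / δ * A * κ * th₀ := by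
    have h1 : k₁ ≤ _ := min_le_left _ _
    have h2 : 0 < d / δ * A * κ * th₀ := by positivity
    linarith
  have hk2 : κ * k₁ ≤ m / 2 := by
    have : k₁ ≤ _ := min_le_right _ _
    rw [le_div_iff₀ (by positivity)] at this
    linarith
  set m' := m / 2 with hm'
  have hm'0 : 0 < m' := by positivity
  set e : ℝ → ℝ := fun t => Real.exp (-m' * (t - T)) with he
  set L : ℝ → ℝ := fun t => L₀ + k₁ * ((t - T) - (1 - e t) / m') with hL
  have de : ∀ t, HasDerivAt e (-m' * e t) t := by
    intro t
    have := (((hasDerivAt_id t).sub_const T).const_mul (-m')).exp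
    simp only [id, mul_one] at this
    rw [mul_comm]; exact this
  have dL : ∀ t, HasDerivAt L (k₁ * (1 - e t)) t := by
    intro t
    have h1 := ((((hasDerivAt_id t).sub_const T).fun_sub
      (((hasDerivAt_const t (1:ℝ)).fun_sub (de t)).div_const m')).const_mul k₁).const_add L₀
    refine h1.congr_deriv ?_
    field_simp
    ring
  have e0 : ∀ t, 0 < e t := fun t => Real.exp_pos _
  have e1 : ∀ t, T < t → e t < 1 := fun t ht => by
    simp only [he]; rw [Real.exp_lt_one_iff]; nlinarith
  have eT : e T = 1 := by simp [he]
  have LT : L T = L₀ := by simp [hL, eT]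
  have L0 : ∀ t, T ≤ t → L₀ ≤ L t := by
    intro t ht
    have h1 := Real.add_one_le_exp (-m' * (t - T))
    have h2 : (1 - e t) / m' ≤ t - T := by
      rw [div_le_iff₀ hm'0]; simp only [he]; linarith
    simp only [hL]; nlinarith
  have ec : Continuous e := continuous_iff_continuousAt.mpr fun t => (de t).continuousAt
  have Lc : Continuous L := continuous_iff_continuousAt.mpr fun t => (dL t).continuousAt
  have cpos : ∀ t, Real.cosh (κ * L t) ≠ 0 := fun t => (Real.cosh_pos _).ne'
  have thL : ∀ t, T ≤ t → th₀ ≤ Real.sinh (κ * L t) / Real.cosh (κ * L t) := fun t ht =>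
    tanh_mono' (by have := L0 t ht; gcongr)
  set w : ℝ → ℝ → ℝ := fun t x =>
    δ + A * (1 - e t) * (1 - Real.cosh (κ * (x - x₀)) / Real.cosh (κ * L t)) with hw
  have wc : Continuous (fun p : ℝ × ℝ => w p.1 p.2) := by
    simp only [hw]
    have hc : ∀ p : ℝ × ℝ, Real.cosh (κ * L p.1) ≠ 0 := fun p => cpos p.1
    have h1 : Continuous (fun p : ℝ × ℝ => e p.1) := ec.comp continuous_fst
    have h2 : Continuous (fun p : ℝ × ℝ => Real.cosh (κ * L p.1)) :=
      Real.continuous_cosh.comp (continuous_const.mul (Lc.comp continuous_fst))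
    have h3 : Continuous (fun p : ℝ × ℝ => Real.cosh (κ * (p.2 - x₀))) :=
      Real.continuous_cosh.comp (by fun_prop)
    exact continuous_const.add ((continuous_const.mul (continuous_const.sub h1)).mul
      (continuous_const.sub (h3.div h2 hc)))
  have wx : ∀ t x, HasDerivAt (w t)
      (- (A * (1 - e t)) * (κ * (Real.sinh (κ * (x - x₀)) / Real.cosh (κ * L t)))) x := by
    intro t x
    have h1 : HasDerivAt (fun x => κ * (x - x₀)) κ x := by
      simpa using ((hasDerivAt_id x).sub_const x₀).const_mul κ
    have h2 := (((h1.cosh.div_const (Real.cosh (κ * L t))).const_sub 1).const_mul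
      (A * (1 - e t))).const_add δ
    refine h2.congr_deriv ?_
    ring
  have wxx : ∀ t x, HasDerivAt (fun x =>
      (- (A * (1 - e t)) * (κ * (Real.sinh (κ * (x - x₀)) / Real.cosh (κ * L t)))))
      (- (A * (1 - e t)) * (κ ^ 2 * (Real.cosh (κ * (x - x₀)) / Real.cosh (κ * L t)))) x := by
    intro t x
    have h1 : HasDerivAt (fun x => κ * (x - x₀)) κ x := by
      simpa using ((hasDerivAt_id x).sub_const x₀).const_mul κ
    have h2 := ((h1.sinh.div_const (Real.cosh (κ * L t))).const_mul κ).const_mul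
      (- (A * (1 - e t)))
    refine h2.congr_deriv ?_
    ring
  have wt : ∀ t x, HasDerivAt (fun t => w t x)
      (A * (m' * e t) * (1 - Real.cosh (κ * (x - x₀)) / Real.cosh (κ * L t)) +
        A * (1 - e t) * (Real.cosh (κ * (x - x₀)) / Real.cosh (κ * L t) *
          (κ * (k₁ * (1 - e t)) * (Real.sinh (κ * L t) / Real.cosh (κ * L t))))) t := by
    intro t x
    have h1 := ((dL t).const_mul κ).cosh
    have h2 := ((hasDerivAt_const t (Real.cosh (κ * (x - x₀)))).fun_div h1 (cpos t)).const_sub 1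
    have h3 := ((de t).const_sub 1).const_mul A
    have h4 := (h3.fun_mul h2).const_add δ
    refine h4.congr_deriv ?_
    have := cpos t
    field_simp
    ring
  have wB : ∀ t, w t (x₀ + L t) = δ := by
    intro t
    have : κ * (x₀ + L t - x₀) = κ * L t := by ring
    simp only [hw, this, div_self (cpos t)]; ring
  have wA : ∀ t, w t (x₀ - L t) = δ := by
    intro t
    have : κ * (x₀ - L t - x₀) = -(κ * L t) := by ring
    simp only [hw, this, Real.cosh_neg, div_self (cpos t)]; ring
  have main : ∀ T', T ≤ T' → g T' < x₀ - L T' ∧ x₀ + L T' < h T' ∧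
      ∀ x, x₀ - L T' ≤ x → x ≤ x₀ + L T' → w T' x < u T' x := by
    intro T' hT'
    refine S.freeComp hd hT.le (T' := T') (A := fun t => x₀ - L t) (B := fun t => x₀ + L t) (w := w)
      (by fun_prop) (by fun_prop) ?_ ?_ ?_ wc.continuousOn ?_ ?_ ?_ ?_ ?_ ?_ T' hT' le_rfl
    · intro t a b; have := L0 t a; show x₀ - L t < x₀ + L t; linarith
    · simp only [LT]; linarith
    · simp only [LT]; linarith
    · intro x a b
      simp only [LT] at a b
      simp only [hw, eT]
      have := hlt T le_rfl x (by linarith) (by linarith)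
      linarith
    · intro t a b c c'
      simp only [wA]
      exact hlt t a.le _ c c'
    · intro t a b c c'
      simp only [wB]
      exact hlt t a.le _ c c'
    · intro t a b x hx1 hx2 _ _ _
      refine SubAt.smooth _ _ _ (wt t x) (Eventually.of_forall (wx t)) (wxx t x) ?_
      have hch := Real.cosh_pos (κ * L t)
      have hchx := Real.cosh_pos (κ * (x - x₀))
      set Cc := Real.cosh (κ * (x - x₀)) / Real.cosh (κ * L t) with hCc
      have hC0 : 0 < Cc := div_pos hchx hch
      have hLp : 0 < L t := hL0.trans_le (L0 t a.le)
      have hC1 : Cc < 1 := by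
        rw [hCc, div_lt_one hch, Real.cosh_lt_cosh, abs_of_pos (by positivity : 0 < κ * L t),
          abs_mul, abs_of_pos hκ0]
        have : |x - x₀| < L t := abs_lt.mpr ⟨by linarith, by linarith⟩
        gcongr
      set th := Real.sinh (κ * L t) / Real.cosh (κ * L t) with hth
      have hth1 : th ≤ 1 := by
        rw [hth, div_le_one hch]; exact (Real.sinh_lt_cosh _).le
      have hth2 : 0 < th := hth0.trans_le (thL t a.le)
      have ea := e0 t
      have eb := e1 t a
      refine cosh_alg hm hA hlin hA0 hκ0 hk0 hκ2 hk2 hC0 hC1 hth2 hth1 ea eb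
    · intro t a b hearly heq hsl
      have hLp : 0 < L t := hL0.trans_le (L0 t a.le)
      refine S.slopeL hd hδ0 hT.le a (A := fun t => x₀ - L t) (v := w t) (b := x₀)
        (s := A * (1 - e t) * (κ * (Real.sinh (κ * L t) / Real.cosh (κ * L t))))
        ((dL t).const_sub x₀) hearly heq (show x₀ - L t < x₀ by linarith) ?_ (wA t) ?_ ?_
      · intro x c1 c2
        exact hsl x (le_of_lt c1) (by linarith)
      · have := wx t (x₀ - L t)
        refine this.congr_deriv ?_
        rw [show κ * (x₀ - L t - x₀) = -(κ * L t) by ring, Real.sinh_neg]; ring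
      · have h1 := thL t a.le
        have h2 := e1 t a
        have h3 : d / δ * A * κ * th₀ ≤
          d / δ * A * κ * (Real.sinh (κ * L t) / Real.cosh (κ * L t)) := by gcongr
        have h4 : k₁ * (1 - e t) < d / δ * A * κ *
          (Real.sinh (κ * L t) / Real.cosh (κ * L t)) * (1 - e t) :=
          mul_lt_mul_of_pos_right (hk1.trans_le h3) (by linarith)
        linarith
    · intro t a b hearly heq hsl
      have hLp : 0 < L t := hL0.trans_le (L0 t a.le)
      refine S.slopeR hd hδ0 hT.le a (B := fun t => x₀ + L t) (v := w t) (a := x₀)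
        (s := A * (1 - e t) * (κ * (Real.sinh (κ * L t) / Real.cosh (κ * L t))))
        ((dL t).const_add x₀) hearly heq (show x₀ < x₀ + L t by linarith) ?_ (wB t) ?_ ?_
      · intro x c1 c2
        exact hsl x (by linarith) (le_of_lt c2)
      · have := wx t (x₀ + L t)
        refine this.congr_deriv ?_
        rw [show κ * (x₀ + L t - x₀) = (κ * L t) by ring]; ring
      · have h1 := thL t a.le
        have h2 := e1 t a
        have h3 : d / δ * A * κ * th₀ ≤
          d / δ * A * κ * (Real.sinh (κ * L t) / Real.cosh (κ * L t)) := by gcongr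
        have h4 : k₁ * (1 - e t) < d / δ * A * κ *
          (Real.sinh (κ * L t) / Real.cosh (κ * L t)) * (1 - e t) :=
          mul_lt_mul_of_pos_right (hk1.trans_le h3) (by linarith)
        linarith
  -- conclusion
  set γ := min m' (κ * k₁) with hγ
  have hγ0 : 0 < γ := lt_min hm'0 (by positivity)
  have g1 : γ ≤ m' := min_le_left _ _
  have g2 : γ ≤ κ * k₁ := min_le_right _ _
  set Q := Real.cosh κ * 2 * Real.exp (κ * (k₁ / m')) with hQ
  have hQ0 : 0 < Q := by have := Real.cosh_pos κ; positivity
  refine ⟨x₀, A * (1 + Q) * Real.exp (γ * T), γ, T + 1 / m' + 1 / k₁, by positivity, hγ0,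
    by positivity, ?_, ?_, ?_⟩
  · intro t ht
    have : T ≤ t := by
      have h1 : 0 < 1 / m' := by positivity
      have h2 : 0 < 1 / k₁ := by positivity
      linarith
    exact hle t this
  · intro t ht
    have : T ≤ t := by
      have h1 : 0 < 1 / m' := by positivity
      have h2 : 0 < 1 / k₁ := by positivity
      linarith
    exact hlt t this
  intro t ht
  have hTt : T ≤ t := by
    have h1 : 0 < 1 / m' := by positivity
    have h2 : 0 < 1 / k₁ := by positivity
    linarith
  have Lbig : k₁ * (t - T) - k₁ / m' ≤ L t := by
    simp only [hL]
    have : k₁ * (t - T - (1 - e t) / m') = k₁ * (t - T) - k₁ / m' + k₁ * e t / m' := by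
      field_simp; ring
    rw [this]
    have : 0 < k₁ * e t / m' := by have := e0 t; positivity
    linarith
  have L1 : 1 ≤ L t := by
    have : k₁ * (1 / m' + 1 / k₁) ≤ k₁ * (t - T) := by gcongr; linarith
    have e : k₁ * (1 / m' + 1 / k₁) = k₁ / m' + 1 := by field_simp
    linarith
  obtain ⟨a1, a2, a3⟩ := main t hTt
  refine ⟨by linarith, by linarith, fun x hx1 hx2 => ?_⟩
  have hwu := a3 x (by linarith) (by linarith)
  refine lt_of_le_of_lt ?_ hwu
  have hch := Real.cosh_pos (κ * L t)
  have hex : e t ≤ Real.exp (γ * T) * Real.exp (-γ * t) := by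
    rw [← Real.exp_add]; simp only [he]; apply Real.exp_le_exp.mpr; nlinarith
  have hC : Real.cosh (κ * (x - x₀)) / Real.cosh (κ * L t) ≤
      Q * (Real.exp (γ * T) * Real.exp (-γ * t)) := by
    have c1 : Real.cosh (κ * (x - x₀)) ≤ Real.cosh κ := by
      rw [Real.cosh_le_cosh, abs_of_nonneg (by nlinarith), abs_of_pos hκ0]; nlinarith
    have c2 : Real.exp (κ * L t) / 2 ≤ Real.cosh (κ * L t) := by
      rw [Real.cosh_eq]; have := Real.exp_pos (-(κ * L t)); linarith
    rw [div_le_iff₀ hch]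
    have c3 : 1 ≤ Real.exp (κ * (k₁ / m')) * (Real.exp (γ * T) * Real.exp (-γ * t)) *
        Real.exp (κ * L t) := by
      rw [← Real.exp_add, ← Real.exp_add, ← Real.exp_add]
      apply Real.one_le_exp
      have : κ * (k₁ * (t - T) - k₁ / m') ≤ κ * L t := by gcongr
      nlinarith
    have hp : 0 < Real.cosh κ := Real.cosh_pos κ
    calc Real.cosh (κ * (x - x₀)) ≤ Real.cosh κ * 1 := by linarith
      _ ≤ Real.cosh κ * (Real.exp (κ * (k₁ / m')) * (Real.exp (γ * T) * Real.exp (-γ * t)) *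
        Real.exp (κ * L t)) := by gcongr
      _ = Q * (Real.exp (γ * T) * Real.exp (-γ * t)) * (Real.exp (κ * L t) / 2) := by
        rw [hQ]; ring
      _ ≤ _ := by gcongr
  set Cc := Real.cosh (κ * (x - x₀)) / Real.cosh (κ * L t) with hCc
  have hC0 : 0 < Cc := div_pos (Real.cosh_pos _) hch
  have hw1 : w t x = δ + A * (1 - e t) * (1 - Cc) := rfl
  have e0' := e0 t
  rw [hw1]
  have : (1 - e t) * (1 - Cc) ≥ 1 - e t - Cc := by nlinarith
  have : A * ((1 - e t) * (1 - Cc)) ≥ A * (1 - e t - Cc) := by gcongr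
  have : A * (e t + Cc) ≤ A * ((1 + Q) * (Real.exp (γ * T) * Real.exp (-γ * t))) := by
    gcongr; linarith
  nlinarith

end

end FA

open Set Filter Topology

namespace FA

/-! ### The semi-wave -/

structure WV (d δ c : ℝ) (f Q Q1 Q2 : ℝ → ℝ) : Prop where
  c0 : 0 < c
  dQ : ∀ ξ, HasDerivAt Q (Q1 ξ) ξ
  dQ1 : ∀ ξ, 0 < ξ → HasDerivAt Q1 (Q2 ξ) ξ
  ode : ∀ ξ, 0 < ξ → d * Q2 ξ = c * Q1 ξ - f (Q ξ)
  Q0 : Q 0 = δ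
  Q10 : Q1 0 = c * δ / d
  pos : ∀ ξ, 0 < Q1 ξ
  lim : Tendsto Q atTop (𝓝 1)
  Q1c : Continuous Q1

lemma WV.of {d δ c : ℝ} {f q : ℝ → ℝ} (hw : SemiWavePair d δ f c q) :
    ∃ Q Q1 Q2, WV d δ c f Q Q1 Q2 := by
  obtain ⟨c0, hq, hode, -, hq0, hlim, hq1, hpos⟩ := hw
  set D := derivWithin q (Ici (0:ℝ)) with hD
  have hDc : ContDiffOn ℝ 1 D (Ici (0:ℝ)) :=
    hq.derivWithin (uniqueDiffOn_Ici 0) (by norm_num)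
  have dq : ∀ z, 0 ≤ z → HasDerivWithinAt q (D z) (Ici 0) z := fun z hz =>
    (hq.differentiableOn (by norm_num) z hz).hasDerivWithinAt
  have dD : ∀ z, 0 < z → HasDerivAt D (derivWithin D (Ici 0) z) z := fun z hz =>
    (hDc.differentiableOn (by norm_num) z hz.le).hasDerivWithinAt.hasDerivAt (Ici_mem_nhds hz)
  refine ⟨fun ξ => if 0 ≤ ξ then q ξ else δ + D 0 * ξ, fun ξ => D (max ξ 0),
    fun ξ => derivWithin D (Ici 0) ξ, c0, ?_, ?_, ?_, ?_, ?_, ?_, ?_, ?_⟩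
  · intro ξ
    rcases lt_trichotomy ξ 0 with h | h | h
    · rw [max_eq_right h.le]
      have : HasDerivAt (fun ξ => δ + D 0 * ξ) (D 0) ξ := by
        simpa using ((hasDerivAt_id ξ).const_mul (D 0)).const_add δ
      refine this.congr_of_eventuallyEq ?_
      filter_upwards [Iio_mem_nhds h] with y hy
      rw [if_neg (not_le.mpr hy)]
    · subst h
      rw [max_self]
      have h1 : HasDerivWithinAt (fun ξ => if 0 ≤ ξ then q ξ else δ + D 0 * ξ) (D 0) (Ici 0) 0 := by
        refine (dq 0 le_rfl).congr (fun x hx => if_pos hx) (if_pos le_rfl)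
      have h2 : HasDerivWithinAt (fun ξ => if 0 ≤ ξ then q ξ else δ + D 0 * ξ) (D 0) (Iic 0) 0 := by
        have : HasDerivAt (fun ξ => δ + D 0 * ξ) (D 0) 0 := by
          simpa using ((hasDerivAt_id (0:ℝ)).const_mul (D 0)).const_add δ
        refine this.hasDerivWithinAt.congr (fun x hx => ?_) (by simp [hq0])
        rcases eq_or_lt_of_le (mem_Iic.mp hx) with e | e
        · subst e; simp [hq0]
        · exact if_neg (not_le.mpr e)
      have := h1.union h2
      rwa [Ici_union_Iic, hasDerivWithinAt_univ] at this
    · rw [max_eq_left h.le]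
      refine ((dq ξ h.le).hasDerivAt (Ici_mem_nhds h)).congr_of_eventuallyEq ?_
      filter_upwards [Ioi_mem_nhds h] with y hy
      rw [if_pos (le_of_lt hy)]
  · intro ξ h
    refine (dD ξ h).congr_of_eventuallyEq ?_
    filter_upwards [Ioi_mem_nhds h] with y hy
    rw [max_eq_left (le_of_lt hy)]
  · intro ξ h
    have := hode ξ h.le
    simp only [if_pos h.le, max_eq_left h.le]
    linarith
  · simp [hq0]
  · simp [hq1]
  · intro ξ; exact hpos _ (mem_Ici.mpr (le_max_right _ _))
  · refine hlim.congr' ?_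
    filter_upwards [eventually_ge_atTop 0] with y hy
    rw [if_pos hy]
  · exact hDc.continuousOn.comp_continuous (by fun_prop) (fun x => mem_Ici.mpr (le_max_right _ _))

section
variable {d δ c : ℝ} {f Q Q1 Q2 : ℝ → ℝ}

lemma WV.Qc (W : WV d δ c f Q Q1 Q2) : Continuous Q :=
  continuous_iff_continuousAt.mpr fun t => (W.dQ t).continuousAt

lemma WV.mono (W : WV d δ c f Q Q1 Q2) : StrictMono Q :=
  strictMono_of_hasDerivAt_pos W.dQ W.pos

lemma WV.lt_one (W : WV d δ c f Q Q1 Q2) (ξ : ℝ) : Q ξ < 1 := by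
  have h1 : Q ξ < Q (ξ + 1) := W.mono (by linarith)
  have h2 : Q (ξ + 1) ≤ 1 := W.mono.monotone.ge_of_tendsto W.lim _
  linarith

lemma WV.ge (W : WV d δ c f Q Q1 Q2) {ξ : ℝ} (h : 0 ≤ ξ) : δ ≤ Q ξ := by
  rw [← W.Q0]; exact W.mono.monotone h

lemma WV.gt (W : WV d δ c f Q Q1 Q2) {ξ : ℝ} (h : 0 < ξ) : δ < Q ξ := by
  rw [← W.Q0]; exact W.mono h

lemma WV.anti (W : WV d δ c f Q Q1 Q2) (N : NL δ f) {a b : ℝ} (ha : 0 ≤ a) (hab : a ≤ b) :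
    d * Q1 b - c * Q b ≤ d * Q1 a - c * Q a := by
  have : AntitoneOn (fun ξ => d * Q1 ξ - c * Q ξ) (Ici 0) := by
    refine antitoneOn_of_hasDerivWithinAt_nonpos (f' := fun ξ => d * Q2 ξ - c * Q1 ξ) (convex_Ici 0)
      ((continuous_const.mul W.Q1c).sub (continuous_const.mul W.Qc)).continuousOn ?_ ?_
    · intro x hx
      rw [interior_Ici] at hx
      exact (((W.dQ1 x hx).const_mul d).fun_sub ((W.dQ x).const_mul c)).hasDerivWithinAt
    · intro x hx
      rw [interior_Ici] at hx
      have := W.ode x hx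
      have := N.fpos (Q x) (W.ge (le_of_lt hx)) (W.lt_one x)
      linarith
  exact this ha (ha.trans hab) hab

lemma WV.Q1_le (W : WV d δ c f Q Q1 Q2) (hd : 0 < d) (N : NL δ f) {ξ : ℝ} (h : 0 ≤ ξ) :
    Q1 ξ ≤ c / d := by
  have h1 := W.anti N le_rfl h
  rw [W.Q0, W.Q10] at h1
  have h2 := W.lt_one ξ
  have h3 := W.c0
  have : d * (c * δ / d) = c * δ := by field_simp
  rw [le_div_iff₀ hd]
  nlinarith

lemma WV.Q1_small (W : WV d δ c f Q Q1 Q2) (hd : 0 < d) (N : NL δ f) {ε : ℝ} (hε : 0 < ε) :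
    ∃ R > 0, ∀ ξ, R ≤ ξ → Q1 ξ < ε := by
  have hc := W.c0
  have hη : 0 < d * ε / (2 * c) := by positivity
  obtain ⟨ξ₀, h0⟩ := (W.lim.eventually (lt_mem_nhds (show 1 - d * ε / (2 * c) < 1 by linarith))).exists_forall_of_atTop
  set z := max ξ₀ 0 with hz
  have hz0 : 0 ≤ z := le_max_right _ _
  have hzz : ξ₀ ≤ z := le_max_left _ _
  refine ⟨z + 2 / ε, by positivity, fun ξ hξ => ?_⟩
  by_contra hcon
  push Not at hcon
  have hε2 : 0 < 2 / ε := by positivity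
  have key : ∀ s, z ≤ s → s ≤ ξ → ε / 2 ≤ Q1 s := by
    intro s h1 h2
    have h3 := W.anti N (hz0.trans h1) h2
    have h4 := h0 s (hzz.trans h1)
    have h5 := W.lt_one ξ
    have h6 : c * (d * ε / (2 * c)) = d * ε / 2 := by field_simp
    have h7 : d * ε ≤ d * Q1 ξ := by gcongr
    have : d * (ε / 2) ≤ d * Q1 s := by nlinarith
    exact le_of_mul_le_mul_left this hd
  have hm : MonotoneOn (fun s => Q s - ε / 2 * s) (Icc z ξ) := by
    refine monotoneOn_of_hasDerivWithinAt_nonneg (f' := fun s => Q1 s - ε / 2 * 1) (convex_Icc _ _)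
      (W.Qc.sub (by fun_prop)).continuousOn ?_ ?_
    · intro x hx
      exact ((W.dQ x).fun_sub ((hasDerivAt_id x).const_mul (ε / 2))).hasDerivWithinAt
    · intro x hx
      rw [interior_Icc] at hx
      have := key x hx.1.le hx.2.le
      linarith
  have h1 := hm (left_mem_Icc.mpr (by linarith)) (right_mem_Icc.mpr (by linarith)) (by linarith : z ≤ ξ)
  simp only at h1
  have h2 := W.lt_one ξ
  have h3 := W.ge hz0
  have h4 : ε / 2 * (2 / ε) ≤ ε / 2 * (ξ - z) := by gcongr; linarith
  have h5 : ε / 2 * (2 / ε) = 1 := by field_simp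
  have := N.δ0
  linarith

/-- constants for the perturbed wave -/
structure WC (d δ c : ℝ) (f Q Q1 : ℝ → ℝ) (β σ κ₀ p₀ : ℝ) : Prop where
  β0 : 0 < β
  σc : c < σ
  κ0 : 0 < κ₀
  p0 : 0 < p₀
  p1 : p₀ ≤ 1 / 2
  p2 : p₀ * (2 * σ) ≤ c
  low : ∀ p ξ, 0 < p → p ≤ p₀ → 0 ≤ ξ →
    β * p * (Q ξ - δ) - (1 - p) * σ * p * Q1 ξ + (1 - p) * f (Q ξ)
      - f (δ + (1 - p) * (Q ξ - δ)) ≤ - κ₀ * p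
  up : ∀ p ξ, 0 < p → p ≤ p₀ → 0 < ξ →
    0 < - β * p * (Q ξ - δ) + (1 + p) * σ * p * Q1 ξ + (1 + p) * f (Q ξ)
      - f (δ + (1 + p) * (Q ξ - δ))

set_option maxHeartbeats 2000000 in
lemma WC.of (W : WV d δ c f Q Q1 Q2) (N : NL δ f) :
    ∃ β₀ σ κ₀ p₀, 0 < β₀ ∧ ∀ β, 0 < β → β ≤ β₀ → WC d δ c f Q Q1 β σ κ₀ p₀ := by
  obtain ⟨ω, hω, m, hm, hω1, hdec⟩ := N.dec
  obtain ⟨K, hK, hlip⟩ := N.lip 2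
  have hδ0 := N.δ0
  have hδ1 := N.δ1
  have hc := W.c0
  set ω' := min ω (1 - δ) / 2 with hω'
  have hω'0 : 0 < ω' := by
    have : 0 < min ω (1 - δ) := lt_min hω (by linarith)
    positivity
  have w1 : ω' ≤ ω / 2 := by rw [hω']; gcongr; exact min_le_left _ _
  have w2 : ω' ≤ (1 - δ) / 2 := by rw [hω']; gcongr; exact min_le_right _ _
  obtain ⟨z, hz⟩ := (W.lim.eventually (lt_mem_nhds (show 1 - ω' < 1 by linarith))).exists_forall_of_atTop
  obtain ⟨y, hy, hmin⟩ := (isCompact_Icc (a := (0:ℝ)) (b := max z 0)).exists_isMinOn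
    (nonempty_Icc.mpr (le_max_right _ _)) W.Q1c.continuousOn
  set qm := Q1 y with hqm
  have hqm0 : 0 < qm := W.pos y
  set σ := c + 2 * (K + 2) / qm with hσ
  have hσc : c < σ := by rw [hσ]; have : 0 < 2 * (K + 2) / qm := by positivity
                         linarith
  have hσ0 : 0 < σ := hc.trans hσc
  have hσq : 2 * (K + 2) ≤ σ * qm := by
    have : 2 * (K + 2) / qm * qm = 2 * (K + 2) := by field_simp
    have : 0 < c * qm := by positivity
    rw [hσ]; nlinarith
  set p₀ := min (min (1 / 2) (ω / 2)) (c / (2 * σ)) with hp₀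
  have pa : p₀ ≤ 1 / 2 := (min_le_left _ _).trans (min_le_left _ _)
  have pb : p₀ ≤ ω / 2 := (min_le_left _ _).trans (min_le_right _ _)
  have pc : p₀ ≤ c / (2 * σ) := min_le_right _ _
  have hp0 : 0 < p₀ := lt_min (lt_min (by norm_num) (by positivity)) (by positivity)
  refine ⟨min 1 (m / 2), σ, min 1 (m * (1 - δ) / 4), p₀, lt_min one_pos (by positivity),
    fun β hβ hβ' => ?_⟩
  have b1 : β ≤ 1 := hβ'.trans (min_le_left _ _)
  have b2 : β ≤ m / 2 := hβ'.trans (min_le_right _ _)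
  have k1 := min_le_left 1 (m * (1 - δ) / 4)
  have k2 := min_le_right 1 (m * (1 - δ) / 4)
  have k0 : 0 < min 1 (m * (1 - δ) / 4) := lt_min one_pos (by have : 0 < 1 - δ := by linarith
                                                              positivity)
  set κ₀ := min 1 (m * (1 - δ) / 4)
  refine ⟨hβ, hσc, k0, hp0, pa, ?_, ?_, ?_⟩
  · rwa [le_div_iff₀ (by positivity)] at pc
  · intro p ξ hp hp' hξ
    have hQ1 := W.lt_one ξ
    have hQδ := W.ge hξ
    have hf := N.fpos _ hQδ hQ1
    have hq := W.pos ξ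
    set y' := Q ξ - δ with hy'
    have hy0 : 0 ≤ y' := by rw [hy']; linarith
    have hy1 : y' ≤ 1 := by rw [hy']; linarith
    have ev : δ + (1 - p) * y' = Q ξ - p * y' := by rw [hy']; ring
    rw [ev]
    have hpy : 0 ≤ p * y' := by positivity
    have hpy1 : p * y' ≤ p := by nlinarith
    have hpf : 0 < p * f (Q ξ) := by positivity
    have hsq : 0 < σ * p * Q1 ξ := by positivity
    by_cases hcase : 1 - ω' ≤ Q ξ
    · have h1 := hdec (Q ξ - p * y') (Q ξ) (by linarith) (by linarith) (by linarith)
      have h2 : (1 - δ) / 2 ≤ y' := by rw [hy']; linarith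
      have h3 : p * ((1 - δ) / 2) ≤ p * y' := by gcongr
      have h4 : β * (p * y') ≤ m / 2 * (p * y') := by gcongr
      have h5 : m * (p * ((1 - δ) / 2)) ≤ m * (p * y') := by gcongr
      have h6 : κ₀ * p ≤ m * (1 - δ) / 4 * p := by gcongr
      have h7 : 0 ≤ (1 - p) * (σ * p * Q1 ξ) := mul_nonneg (by linarith) hsq.le
      linarith
    · have hξz : ξ ≤ max z 0 := by
        by_contra hc'
        push Not at hc'
        exact hcase (hz ξ ((le_max_left _ _).trans hc'.le)).le
      have h1 : qm ≤ Q1 ξ := hmin ⟨hξ, hξz⟩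
      have h2 := hlip (Q ξ) (Q ξ - p * y') (by linarith) (by linarith)
        (by have : p * y' ≤ y' := by nlinarith
            rw [hy'] at this ⊢; linarith) (by linarith)
      have h3 : |Q ξ - (Q ξ - p * y')| = p * y' := by rw [sub_sub_cancel, abs_of_nonneg hpy]
      rw [h3] at h2
      have h4 := (abs_le.mp h2).2
      have h5 : K * (p * y') ≤ K * p := by gcongr
      have h6 : p * (2 * (K + 2)) ≤ σ * p * Q1 ξ := by
        calc p * (2 * (K + 2)) ≤ p * (σ * qm) := by gcongr
          _ ≤ p * (σ * Q1 ξ) := by gcongr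
          _ = _ := by ring
      have h7 : β * (p * y') ≤ 1 * p := by gcongr
      have h8 : (1 / 2) * (σ * p * Q1 ξ) ≤ (1 - p) * (σ * p * Q1 ξ) := by gcongr; linarith
      have h9 : κ₀ * p ≤ 1 * p := by gcongr
      linarith
  · intro p ξ hp hp' hξ
    have hQ1 := W.lt_one ξ
    have hQδ := W.gt hξ
    have hf := N.fpos _ hQδ.le hQ1
    have hq := W.pos ξ
    set y' := Q ξ - δ with hy'
    have hy0 : 0 < y' := by rw [hy']; linarith
    have hy1 : y' ≤ 1 := by rw [hy']; linarith
    have ev : δ + (1 + p) * y' = Q ξ + p * y' := by rw [hy']; ring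
    rw [ev]
    have hpy : 0 < p * y' := by positivity
    have hpy1 : p * y' ≤ p := by nlinarith
    have hpf : 0 < p * f (Q ξ) := by positivity
    have hsq : 0 < σ * p * Q1 ξ := by positivity
    have hsq' : 0 < p * (σ * p * Q1 ξ) := by positivity
    by_cases hcase : 1 - ω' ≤ Q ξ
    · have h1 := hdec (Q ξ) (Q ξ + p * y') (by linarith) (by linarith) (by linarith)
      have h4 : β * (p * y') ≤ m / 2 * (p * y') := by gcongr
      have h5 : 0 < m * (p * y') := by positivity
      linarith
    · have hξz : ξ ≤ max z 0 := by
        by_contra hc'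
        push Not at hc'
        exact hcase (hz ξ ((le_max_left _ _).trans hc'.le)).le
      have h1 : qm ≤ Q1 ξ := hmin ⟨hξ.le, hξz⟩
      have h2 := hlip (Q ξ) (Q ξ + p * y') (by linarith) (by linarith) (by linarith) (by linarith)
      have h3 : |Q ξ - (Q ξ + p * y')| = p * y' := by
        rw [sub_add_cancel_left, abs_neg, abs_of_nonneg hpy.le]
      rw [h3] at h2
      have h4 := (abs_le.mp h2).1
      have h5 : K * (p * y') ≤ K * p := by gcongr
      have h6 : p * (2 * (K + 2)) ≤ σ * p * Q1 ξ := by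
        calc p * (2 * (K + 2)) ≤ p * (σ * qm) := by gcongr
          _ ≤ p * (σ * Q1 ξ) := by gcongr
          _ = _ := by ring
      have h7 : β * (p * y') ≤ 1 * p := by gcongr
      have := mul_pos hK hp
      linarith

end

end FA

open Set Filter Topology

namespace FA

section
variable {d δ c : ℝ} {f Q Q1 Q2 : ℝ → ℝ} {β σ κ₀ p₀ x₀ T₂ : ℝ}
  {u : ℝ → ℝ → ℝ} {g h : ℝ → ℝ}

/-! ### perturbed waves -/

lemma dPexp (p β T t : ℝ) : HasDerivAt (fun t => p * Real.exp (-β * (t - T)))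
    (-β * (p * Real.exp (-β * (t - T)))) t := by
  have := ((((hasDerivAt_id t).sub_const T).const_mul (-β)).exp).const_mul p
  refine this.congr_deriv ?_
  simp only [id]; ring

lemma dBB {β : ℝ} (hβ : β ≠ 0) (p σ B k T t : ℝ) :
    HasDerivAt (fun t => B + k * (t - T) - σ / β * (p - p * Real.exp (-β * (t - T))))
      (k - σ * (p * Real.exp (-β * (t - T)))) t := by
  have := ((((hasDerivAt_id t).sub_const T).const_mul k).const_add B).fun_sub
    (((hasDerivAt_const t p).fun_sub (dPexp p β T t)).const_mul (σ / β))
  refine this.congr_deriv ?_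
  field_simp
  ring

lemma WV.dt (W : WV d δ c f Q Q1 Q2) {a b : ℝ → ℝ} {a' b' t : ℝ} (ha : HasDerivAt a a' t)
    (hb : HasDerivAt b b' t) (x : ℝ) :
    HasDerivAt (fun s => δ + a s * (Q (b s - x) - δ))
      (a' * (Q (b t - x) - δ) + a t * (Q1 (b t - x) * b')) t := by
  have h1 : HasDerivAt (fun s => Q (b s - x)) (Q1 (b t - x) * b') t :=
    (W.dQ (b t - x)).comp t (hb.sub_const x)
  exact (ha.fun_mul (h1.sub_const δ)).const_add δ

lemma WV.dx (W : WV d δ c f Q Q1 Q2) (a b x : ℝ) :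
    HasDerivAt (fun x => δ + a * (Q (b - x) - δ)) (-(a * Q1 (b - x))) x := by
  have h1 : HasDerivAt (fun x => Q (b - x)) (Q1 (b - x) * (-1)) x :=
    (W.dQ (b - x)).comp x ((hasDerivAt_id x).const_sub b)
  refine (((h1.sub_const δ).const_mul a).const_add δ).congr_deriv (by ring)

lemma WV.dxx (W : WV d δ c f Q Q1 Q2) (a b x : ℝ) (h : x < b) :
    HasDerivAt (fun x => -(a * Q1 (b - x))) (a * Q2 (b - x)) x := by
  have h1 : HasDerivAt (fun x => Q1 (b - x)) (Q2 (b - x) * (-1)) x :=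
    (W.dQ1 (b - x) (by linarith)).comp x ((hasDerivAt_id x).const_sub b)
  refine ((h1.const_mul a).fun_neg).congr_deriv (by ring)

lemma cont_of_deriv {φ φ' : ℝ → ℝ} (h : ∀ t, HasDerivAt φ (φ' t) t) : Continuous φ :=
  continuous_iff_continuousAt.mpr fun t => (h t).continuousAt

lemma WV.wc (W : WV d δ c f Q Q1 Q2) {a b : ℝ → ℝ} (ha : Continuous a) (hb : Continuous b) :
    Continuous (fun p : ℝ × ℝ => δ + a p.1 * (Q (b p.1 - p.2) - δ)) := by
  have := W.Qc
  fun_prop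

lemma FB.upper (S : FB d δ f u g h) (hd : 0 < d) (N : NL δ f) (W : WV d δ c f Q Q1 Q2)
    (C : WC d δ c f Q Q1 β σ κ₀ p₀) : ∃ H T, 0 ≤ T ∧ ∀ t, T ≤ t → h t ≤ c * t + H := by
  have hδ0 := N.δ0
  have hδ1 := N.δ1
  have hp0 := C.p0
  have hc := W.c0
  have hβ := C.β0
  have hσ := C.σc
  have hA : 0 < p₀ * (1 - δ) := mul_pos hp0 (by linarith)
  obtain ⟨T, hT, hu⟩ := S.limsup_one hd N (half_pos hA)
  set z := p₀ * (1 - δ) / (2 * (1 + p₀)) with hz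
  have hz0 : 0 < z := by positivity
  obtain ⟨ξ₀, h0⟩ := (W.lim.eventually (lt_mem_nhds (show 1 - z < 1 by linarith))).exists_forall_of_atTop
  set H := h T + max ξ₀ 1 with hH
  set P : ℝ → ℝ := fun t => p₀ * Real.exp (-β * (t - T)) with hP
  set hb : ℝ → ℝ := fun t => H + c * (t - T) - (-σ) / β * (p₀ - P t) with hhb
  have dP : ∀ t, HasDerivAt P (-β * P t) t := fun t => dPexp p₀ β T t
  have dhb : ∀ t, HasDerivAt hb (c - (-σ) * P t) t := fun t => dBB hβ.ne' p₀ (-σ) H c T t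
  have Pc := cont_of_deriv dP
  have hbc := cont_of_deriv dhb
  have P0 : ∀ t, 0 < P t := fun t => by simp only [hP]; positivity
  have P1 : ∀ t, T ≤ t → P t ≤ p₀ := fun t ht => by
    have : Real.exp (-β * (t - T)) ≤ 1 := Real.exp_le_one_iff.mpr (by nlinarith)
    simp only [hP]; nlinarith
  have PT : P T = p₀ := by simp [hP]
  have hbT : hb T = H := by simp [hhb, PT]
  set w : ℝ → ℝ → ℝ := fun t x => δ + (1 + P t) * (Q (hb t - x) - δ) with hw
  have wc : Continuous (fun p : ℝ × ℝ => w p.1 p.2) := W.wc (continuous_const.add Pc) hbc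
  have hm1 := le_max_left ξ₀ 1
  have hm2 := le_max_right ξ₀ 1
  have key : ∀ t, T ≤ t → (∀ s, T ≤ s → s ≤ t → 0 < hb s - h s) →
      ∀ x, g t ≤ x → x ≤ h t → u t x < w t x := by
    intro T' hT' hh
    refine S.dcl_up hd hT (T' := T') (S.gc.mono fun s hs => hT.trans hs.1)
      (S.hc.mono fun s hs => hT.trans hs.1) (fun _ _ _ => le_rfl) (fun _ _ _ => le_rfl)
      wc.continuousOn ?_ ?_ ?_ ?_ T' hT' le_rfl
    · intro x a b
      refine (hu T le_rfl x a b).trans ?_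
      simp only [hw, hbT, PT]
      have h1 := h0 (H - x) (by rw [hH]; linarith)
      have h2 : (1 + p₀) * (1 - z - δ) < (1 + p₀) * (Q (H - x) - δ) := by gcongr
      have h3 : (1 + p₀) * z = p₀ * (1 - δ) / 2 := by rw [hz]; field_simp
      nlinarith
    · intro t a b
      rw [S.bg t (by linarith)]
      have h1 := W.gt (ξ := hb t - g t) (by
        have := hh t a.le b; have := S.gh t (by linarith); linarith)
      have h2 := P0 t
      have : 0 < (1 + P t) * (Q (hb t - g t) - δ) := mul_pos (by linarith) (by linarith)
      simp only [hw]; linarith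
    · intro t a b
      rw [S.bh t (by linarith)]
      have h1 := W.gt (ξ := hb t - h t) (hh t a.le b)
      have h2 := P0 t
      have : 0 < (1 + P t) * (Q (hb t - h t) - δ) := mul_pos (by linarith) (by linarith)
      simp only [hw]; linarith
    · intro t a b x e1 e2 _
      have hx : x < hb t := by have := hh t a.le b; linarith
      refine SupAt.smooth _ _ _ (W.dt ((dP t).const_add 1) (dhb t) x)
        (Eventually.of_forall (W.dx (1 + P t) (hb t))) (W.dxx _ _ x hx) ?_
      have h1 := C.up (P t) (hb t - x) (P0 t) (P1 t a.le) (by linarith)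
      have h2 := W.ode (hb t - x) (by linarith)
      have h3 : d * ((1 + P t) * Q2 (hb t - x)) = (1 + P t) * (c * Q1 (hb t - x) - f (Q (hb t - x))) := by
        rw [← h2]; ring
      rw [h3]
      simp only [hw]
      linarith
  have main : ∀ t, T ≤ t → 0 < hb t - h t := by
    intro T' hT'
    refine first_zero (m := fun t => hb t - h t) (T := T) (T' := T')
      (hbc.continuousOn.sub (S.hc.mono fun s hs => hT.trans hs.1)) (by
        simp only [hbT]; rw [hH]; linarith) ?_ T' ⟨hT', le_rfl⟩
    intro t ht hpos hz
    have ht0 : 0 < t := by linarith [ht.1]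
    have hsl := slice_le (T := T) (t := t) (A := g) (B := h) (u := w) (w := u) ht.1
      (S.gc.mono fun s hs => hT.trans hs.1)
      (S.hc.mono fun s hs => hT.trans hs.1) (S.gh t ht0.le) wc.continuousOn
      (S.band_cont hT (fun _ _ _ => le_rfl) (fun _ _ _ => le_rfl))
      (fun s a b x e1 e2 => (key s a (fun r a' b' => hpos r ⟨a', b'.trans_lt b⟩) x e1 e2).le)
    have h1 : (c - (-σ) * P t) - -(d / δ) * deriv (u t) (h t) ≤ 0 := by
      refine deriv_nonpos_of_left ((dhb t).fun_sub (S.sh t ht0)) ?_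
      filter_upwards [Ioo_mem_nhdsLT ht.1] with r hr
      have := hpos r ⟨hr.1.le, hr.2⟩
      rw [hz]; exact this.le
    have hz' : hb t = h t := by linarith
    have h2 : -((1 + P t) * Q1 (hb t - h t)) - deriv (u t) (h t) ≤ 0 := by
      refine deriv_nonpos_of_left ((W.dx (1 + P t) (hb t) (h t)).fun_sub
        (S.ux t ht0 (h t) (S.gh t ht0.le).le le_rfl)) ?_
      filter_upwards [Ioo_mem_nhdsLT (S.gh t ht0.le)] with r hr
      have := hsl r hr.1.le hr.2.le
      rw [S.bh t ht0.le, hz', sub_self, W.Q0]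
      simp only [hw, hz'] at this
      linarith
    rw [hz', sub_self, W.Q10] at h2
    have h3 : d / δ * (-((1 + P t) * (c * δ / d))) ≤ d / δ * deriv (u t) (h t) := by
      gcongr; linarith
    have h4 : d / δ * (-((1 + P t) * (c * δ / d))) = - ((1 + P t) * c) := by field_simp
    have := P0 t
    nlinarith
  refine ⟨H - c * T + σ / β * p₀, T, hT, fun t ht => ?_⟩
  have h1 := main t ht
  have h2 := P0 t
  have h3 : 0 < σ / β := div_pos (by linarith) hβ
  have h4 : hb t = H + c * (t - T) + σ / β * (p₀ - P t) := by simp only [hhb]; ring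
  nlinarith

/-! ### context and good triples -/

structure Ctx (d δ c : ℝ) (f Q Q1 Q2 : ℝ → ℝ) (β σ κ₀ p₀ : ℝ) (u : ℝ → ℝ → ℝ) (g h : ℝ → ℝ)
    (x₀ T₂ : ℝ) : Prop where
  S : FB d δ f u g h
  hd : 0 < d
  N : NL δ f
  W : WV d δ c f Q Q1 Q2
  C : WC d δ c f Q Q1 β σ κ₀ p₀
  hT : 0 < T₂
  le : ∀ t, T₂ ≤ t → ∀ x, g t ≤ x → x ≤ h t → δ ≤ u t x
  lt : ∀ t, T₂ ≤ t → ∀ x, g t < x → x < h t → δ < u t x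
  gx : ∀ t, T₂ ≤ t → g t < x₀
  xh : ∀ t, T₂ ≤ t → x₀ < h t

structure Good (δ : ℝ) (Q : ℝ → ℝ) (β p₀ : ℝ) (u : ℝ → ℝ → ℝ) (h : ℝ → ℝ) (x₀ T₂ T B p : ℝ) :
    Prop where
  hT : T₂ ≤ T
  p0 : 0 < p
  pp : p ≤ p₀
  left : ∀ t, T ≤ t → 1 - p * Real.exp (-β * (t - T)) * (1 - δ) < u t x₀
  xB : x₀ < B
  Bh : B < h T
  low : ∀ x, x₀ ≤ x → x ≤ B → δ + (1 - p) * (Q (B - x) - δ) < u T x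

lemma Ctx.bump (X : Ctx d δ c f Q Q1 Q2 β σ κ₀ p₀ u g h x₀ T₂) {T B p : ℝ}
    (G : Good δ Q β p₀ u h x₀ T₂ T B p) {K : ℝ}
    (hK : ∀ a b, 0 ≤ a → a ≤ 2 → 0 ≤ b → b ≤ 2 → |f a - f b| ≤ K * |a - b|)
    {T' μ : ℝ} (hT' : T ≤ T') (hμ : 0 ≤ μ) {P b : ℝ → ℝ}
    (hP : ∀ t, P t = p * Real.exp (-β * (t - T)))
    (hb : ∀ t, b t = B + (c + μ) * (t - T) - σ / β * (p - P t))
    {F Ft Fx Fxx : ℝ → ℝ → ℝ} (Fc : Continuous (fun p : ℝ × ℝ => F p.1 p.2))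
    (dFt : ∀ t x, HasDerivAt (fun s => F s x) (Ft t x) t)
    (dFx : ∀ t x, HasDerivAt (F t) (Fx t x) x)
    (dFxx : ∀ t x, HasDerivAt (Fx t) (Fxx t x) x)
    (h0 : ∀ x, x₀ ≤ x → x ≤ B → δ + (1 - p) * (Q (B - x) - δ) + max (F T x) 0 < u T x)
    (H1 : ∀ t, T < t → t ≤ T' → ∀ x, x₀ < x → x < b t → F t x ≤ 0 → μ * Q1 (b t - x) < κ₀ * P t)
    (H2 : ∀ t, T < t → t ≤ T' → ∀ x, x₀ < x → x < b t → 0 < F t x → F t x ≤ 1 ∧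
      Ft t x - d * Fxx t x + K * F t x + μ * Q1 (b t - x) ≤ 0)
    (H3 : ∀ t, T < t → t ≤ T' → F t (b t) ≤ 0 ∧
      (μ = 0 ∨ (F t (b t) = 0 ∧ μ ≤ d / δ * (- Fx t (b t)))))
    (H4 : ∀ t, T < t → t ≤ T' → F t x₀ ≤ 0) :
    ∀ t, T ≤ t → t ≤ T' → x₀ < b t ∧ b t < h t ∧ ∀ x, x₀ ≤ x → x ≤ b t →
      δ + (1 - P t) * (Q (b t - x) - δ) + max (F t x) 0 < u t x := by
  have hδ0 := X.N.δ0
  have hδ1 := X.N.δ1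
  have hp0 := X.C.p0
  have hc := X.W.c0
  have hβ := X.C.β0
  have hσ := X.C.σc
  have hd := X.hd
  have W := X.W
  obtain rfl : P = fun t => p * Real.exp (-β * (t - T)) := funext hP
  obtain rfl : b = fun t => B + (c + μ) * (t - T) - σ / β * (p - p * Real.exp (-β * (t - T))) :=
    funext hb
  set P : ℝ → ℝ := fun t => p * Real.exp (-β * (t - T)) with hPd
  set b : ℝ → ℝ := fun t => B + (c + μ) * (t - T) - σ / β * (p - P t) with hbd
  have dP : ∀ t, HasDerivAt P (-β * P t) t := fun t => dPexp p β T t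
  have db : ∀ t, HasDerivAt b (c + μ - σ * P t) t := fun t => dBB hβ.ne' p σ B (c + μ) T t
  have Pc := cont_of_deriv dP
  have bc := cont_of_deriv db
  have P0 : ∀ t, 0 < P t := fun t => mul_pos G.p0 (Real.exp_pos _)
  have P1 : ∀ t, T ≤ t → P t ≤ p₀ := fun t ht => by
    have : Real.exp (-β * (t - T)) ≤ 1 := Real.exp_le_one_iff.mpr (by nlinarith)
    have := G.p0
    have := G.pp
    simp only [hPd]; nlinarith
  have PT : P T = p := by simp [hPd]
  have bT : b T = B := by simp [hbd, PT]
  have b1 : ∀ t, T ≤ t → c + μ - σ * P t ≥ 0 := fun t ht => by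
    have h1 := P1 t ht
    have h2 := X.C.p2
    have h3 : σ * P t ≤ σ * p₀ := by gcongr; linarith
    nlinarith
  have bmono : MonotoneOn b (Ici T) :=
    monotoneOn_of_hasDerivWithinAt_nonneg (convex_Ici T) bc.continuousOn
      (fun x _ => (db x).hasDerivWithinAt) (fun x hx => by
        rw [interior_Ici] at hx; exact b1 x (le_of_lt hx))
  have xb : ∀ t, T ≤ t → x₀ < b t := fun t ht => by
    have := bmono (mem_Ici.mpr le_rfl) (mem_Ici.mpr ht) ht
    rw [bT] at this
    exact G.xB.trans_le this
  have hT0 : 0 ≤ T := X.hT.le.trans G.hT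
  have Phalf : ∀ t, T ≤ t → P t ≤ 1 / 2 := fun t ht => (P1 t ht).trans X.C.p1
  have res : ∀ t, T ≤ t → ∀ x, x < b t →
      -(-β * P t) * (Q (b t - x) - δ) + (1 - P t) * (Q1 (b t - x) * (c + μ - σ * P t))
        - d * ((1 - P t) * Q2 (b t - x)) - f (δ + (1 - P t) * (Q (b t - x) - δ)) ≤
      - κ₀ * P t + μ * Q1 (b t - x) := by
    intro t ht x hx
    have h1 := X.C.low (P t) (b t - x) (P0 t) (P1 t ht) (by linarith)
    have h2 := W.ode (b t - x) (by linarith)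
    have h3 : d * ((1 - P t) * Q2 (b t - x)) = (1 - P t) * (c * Q1 (b t - x) - f (Q (b t - x))) := by
      rw [← h2]; ring
    have h4 : 0 ≤ P t * (μ * Q1 (b t - x)) :=
      mul_nonneg (P0 t).le (mul_nonneg hμ (W.pos _).le)
    rw [h3]
    linarith
  have rng : ∀ t, T ≤ t → ∀ x, x ≤ b t → δ ≤ δ + (1 - P t) * (Q (b t - x) - δ) ∧
      δ + (1 - P t) * (Q (b t - x) - δ) < 1 - P t * (1 - δ) := by
    intro t ht x hx
    have h1 := W.ge (ξ := b t - x) (by linarith)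
    have h2 := W.lt_one (b t - x)
    have h3 := Phalf t ht
    constructor
    · have : 0 ≤ (1 - P t) * (Q (b t - x) - δ) := mul_nonneg (by linarith) (by linarith)
      linarith
    · have : (1 - P t) * (Q (b t - x) - δ) < (1 - P t) * (1 - δ) :=
        mul_lt_mul_of_pos_left (by linarith) (by linarith)
      linarith
  have main := X.S.freeComp hd hT0 (T' := T') (A := fun _ => x₀) (B := b)
    (w := fun t x => δ + (1 - P t) * (Q (b t - x) - δ) + max (F t x) 0)
    continuousOn_const bc.continuousOn (fun t a _ => xb t a) (X.gx T G.hT)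
    (by rw [bT]; exact G.Bh)
    ((W.wc (a := fun t => 1 - P t) (continuous_const.sub Pc) bc).add
      (Fc.max continuous_const)).continuousOn
    (by simpa only [bT, PT] using h0) ?_ ?_ ?_ ?_ ?_
  · intro t a a'
    exact ⟨xb t a, (main t a a').2⟩
  · intro t a a' _ _
    have h1 := (rng t a.le x₀ (xb t a.le).le).2
    have h2 := G.left t a.le
    show δ + (1 - P t) * (Q (b t - x₀) - δ) + max (F t x₀) 0 < u t x₀
    rw [max_eq_right (H4 t a a')]
    have h3 : P t * (1 - δ) = p * Real.exp (-β * (t - T)) * (1 - δ) := rfl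
    linarith
  · intro t a a' e1 e2
    show δ + (1 - P t) * (Q (b t - b t) - δ) + max (F t (b t)) 0 < u t (b t)
    rw [max_eq_right (H3 t a a').1, sub_self, W.Q0]
    have := X.lt t (G.hT.trans a.le) (b t) e1 e2
    linarith
  · intro t a a' x e1 e2 e3 e4 _
    have hr := res t a.le x e2
    rcases le_or_gt (F t x) 0 with hF | hF
    · have h1 := H1 t a a' x e1 e2 hF
      refine ⟨fun t x => δ + (1 - P t) * (Q (b t - x) - δ), _, _, _, ?_, ?_, ?_,
        W.dt ((dP t).const_sub 1) (db t) x, Eventually.of_forall (W.dx (1 - P t) (b t)),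
        W.dxx _ _ x e2, ?_⟩
      · simp only [max_eq_right hF, add_zero]
      · exact Eventually.of_forall fun s => le_add_of_nonneg_right (le_max_right _ _)
      · exact Eventually.of_forall fun s => le_add_of_nonneg_right (le_max_right _ _)
      · simp only [max_eq_right hF, add_zero]
        linarith
    · obtain ⟨h1, h2⟩ := H2 t a a' x e1 e2 hF
      refine ⟨fun t x => δ + (1 - P t) * (Q (b t - x) - δ) + F t x, _, _, _, ?_, ?_, ?_,
        (W.dt ((dP t).const_sub 1) (db t) x).fun_add (dFt t x),
        Eventually.of_forall (fun y => (W.dx (1 - P t) (b t) y).fun_add (dFx t y)),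
        (W.dxx _ _ x e2).fun_add (dFxx t x), ?_⟩
      · simp only [max_eq_left hF.le]
      · exact Eventually.of_forall fun s => by have := le_max_left (F s x) 0; simp only; linarith
      · exact Eventually.of_forall fun s => by have := le_max_left (F t s) 0; simp only; linarith
      · simp only [max_eq_left hF.le]
        obtain ⟨r1, r2⟩ := rng t a.le x e2.le
        have hPp := P0 t
        have hδP : 0 < P t * (1 - δ) := mul_pos hPp (by linarith)
        have h3 := hK (δ + (1 - P t) * (Q (b t - x) - δ)) (δ + (1 - P t) * (Q (b t - x) - δ) + F t x)
          (by linarith) (by linarith) (by linarith) (by linarith)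
        rw [sub_add_cancel_left, abs_neg, abs_of_pos hF] at h3
        have h4 := (abs_le.mp h3).2
        have h5 : 0 < κ₀ * P t := mul_pos X.C.κ0 hPp
        linarith
  · intro t a a' _ e _
    have := X.gx t (G.hT.trans a.le)
    linarith
  · intro t a a' hearly heq hsl
    have hPp := P0 t
    have hσP : c * P t < σ * P t := by gcongr
    have hq : d / δ * ((1 - P t) * (c * δ / d)) = (1 - P t) * c := by field_simp
    rcases (H3 t a a').2 with hz | ⟨hz, hz'⟩
    · refine X.S.slopeR hd hδ0 hT0 a (a := x₀)
        (v := fun x => δ + (1 - P t) * (Q (b t - x) - δ)) (s := (1 - P t) * Q1 (b t - b t))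
        (db t) hearly heq (xb t a.le) ?_ ?_ (W.dx (1 - P t) (b t) (b t)) ?_
      · intro x c1 c2
        exact le_trans (le_add_of_nonneg_right (le_max_right _ _)) (hsl x c1.le c2.le)
      · simp [W.Q0]
      · rw [sub_self, W.Q10, hq]; nlinarith
    · refine X.S.slopeR hd hδ0 hT0 a (a := x₀)
        (v := fun x => δ + (1 - P t) * (Q (b t - x) - δ) + F t x)
        (s := (1 - P t) * Q1 (b t - b t) + - Fx t (b t))
        (db t) hearly heq (xb t a.le) ?_ ?_
        (((W.dx (1 - P t) (b t) (b t)).fun_add (dFx t (b t))).congr_deriv (by ring)) ?_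
      · intro x c1 c2
        have := hsl x c1.le c2.le
        have := le_max_left (F t x) 0
        linarith
      · simp [W.Q0, hz]
      · rw [sub_self, W.Q10, mul_add, hq]; nlinarith

/-- good triples propagate -/
lemma Ctx.prop (X : Ctx d δ c f Q Q1 Q2 β σ κ₀ p₀ u g h x₀ T₂) {T B p : ℝ}
    (G : Good δ Q β p₀ u h x₀ T₂ T B p) {t : ℝ} (ht : T ≤ t) :
    ∃ B', Good δ Q β p₀ u h x₀ T₂ t B' (p * Real.exp (-β * (t - T))) ∧
      B' - c * t - σ / β * (p * Real.exp (-β * (t - T))) = B - c * T - σ / β * p := by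
  obtain ⟨K, -, hK⟩ := X.N.lip 2
  obtain ⟨h1, h2, h3⟩ := X.bump G hK ht le_rfl (P := fun t => p * Real.exp (-β * (t - T)))
    (b := fun t => B + (c + 0) * (t - T) - σ / β * (p - p * Real.exp (-β * (t - T))))
    (fun _ => rfl) (fun _ => rfl) (F := fun _ _ => 0) (Ft := fun _ _ => 0) (Fx := fun _ _ => 0)
    (Fxx := fun _ _ => 0) continuous_const (fun _ _ => hasDerivAt_const _ _)
    (fun _ _ => hasDerivAt_const _ _) (fun _ _ => hasDerivAt_const _ _)
    (by simpa using G.low)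
    (fun s a b x _ _ _ => by
      rw [zero_mul]; exact mul_pos X.C.κ0 (mul_pos G.p0 (Real.exp_pos _)))
    (fun s a b x _ _ h => absurd h (lt_irrefl _)) (fun s a b => ⟨le_rfl, Or.inl rfl⟩)
    (fun _ _ _ => le_rfl) t ht le_rfl
  have he : Real.exp (-β * (t - T)) ≤ 1 :=
    Real.exp_le_one_iff.mpr (by have := X.C.β0; nlinarith)
  refine ⟨_, ⟨G.hT.trans ht, mul_pos G.p0 (Real.exp_pos _), ?_, ?_, h1, h2, ?_⟩, ?_⟩
  · have := G.pp; have := G.p0; nlinarith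
  · intro s hs
    have := G.left s (ht.trans hs)
    rw [mul_assoc p, ← Real.exp_add]
    rwa [show -β * (t - T) + -β * (s - t) = -β * (s - T) by ring]
  · intro x a b
    have := h3 x a b
    simpa using this
  · ring

end

end FA

open Set Filter Topology

namespace FA

/-! ### explicit bump -/

noncomputable def bF (ε Λ m T : ℝ) (a b : ℝ → ℝ) (t x : ℝ) : ℝ :=
  ε * Real.exp (-Λ * (t - T)) * (Real.exp (m * ((b t - x) * (x - a t))) - 1)

noncomputable def bFt (ε Λ m T : ℝ) (a b a' b' : ℝ → ℝ) (t x : ℝ) : ℝ :=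
  ε * Real.exp (-Λ * (t - T)) * (-Λ * (Real.exp (m * ((b t - x) * (x - a t))) - 1)
    + Real.exp (m * ((b t - x) * (x - a t))) * (m * (b' t * (x - a t) - (b t - x) * a' t)))

noncomputable def bFx (ε Λ m T : ℝ) (a b : ℝ → ℝ) (t x : ℝ) : ℝ :=
  ε * Real.exp (-Λ * (t - T)) *
    (Real.exp (m * ((b t - x) * (x - a t))) * (m * (a t + b t - 2 * x)))

noncomputable def bFxx (ε Λ m T : ℝ) (a b : ℝ → ℝ) (t x : ℝ) : ℝ :=
  ε * Real.exp (-Λ * (t - T)) *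
    (Real.exp (m * ((b t - x) * (x - a t))) * (m ^ 2 * (a t + b t - 2 * x) ^ 2 - 2 * m))

lemma bF_dt (ε Λ m T : ℝ) {a b a' b' : ℝ → ℝ} (t x : ℝ) (ha : HasDerivAt a (a' t) t)
    (hb : HasDerivAt b (b' t) t) :
    HasDerivAt (fun s => bF ε Λ m T a b s x) (bFt ε Λ m T a b a' b' t x) t := by
  have h1 := dPexp ε Λ T t
  have h2 := ((((hb.sub_const x).fun_mul (ha.const_sub x)).const_mul m).exp).sub_const 1
  refine (h1.fun_mul h2).congr_deriv ?_
  simp only [bFt]; ring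

lemma bF_dx (ε Λ m T : ℝ) (a b : ℝ → ℝ) (t x : ℝ) :
    HasDerivAt (bF ε Λ m T a b t) (bFx ε Λ m T a b t x) x := by
  have h2 := ((((((hasDerivAt_id x).const_sub (b t)).fun_mul
    ((hasDerivAt_id x).sub_const (a t))).const_mul m).exp).sub_const 1).const_mul
    (ε * Real.exp (-Λ * (t - T)))
  refine h2.congr_deriv ?_
  simp only [bFx, id]; ring

lemma bF_dxx (ε Λ m T : ℝ) (a b : ℝ → ℝ) (t x : ℝ) :
    HasDerivAt (bFx ε Λ m T a b t) (bFxx ε Λ m T a b t x) x := by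
  have h1 := (((((hasDerivAt_id x).const_sub (b t)).fun_mul
    ((hasDerivAt_id x).sub_const (a t))).const_mul m).exp)
  have h2 := (((hasDerivAt_id x).const_mul 2).const_sub (a t + b t)).const_mul m
  refine ((h1.fun_mul h2).const_mul (ε * Real.exp (-Λ * (t - T)))).congr_deriv ?_
  simp only [bFxx, id]; ring

lemma bF_cont (ε Λ m T : ℝ) {a b : ℝ → ℝ} (ha : Continuous a) (hb : Continuous b) :
    Continuous (fun p : ℝ × ℝ => bF ε Λ m T a b p.1 p.2) := by
  unfold bF; fun_prop

lemma bF_nonpos {ε Λ m T : ℝ} {a b : ℝ → ℝ} {t x : ℝ} (hε : 0 < ε) (hm : 0 < m)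
    (h : (b t - x) * (x - a t) ≤ 0) : bF ε Λ m T a b t x ≤ 0 := by
  unfold bF
  have h1 : Real.exp (m * ((b t - x) * (x - a t))) ≤ 1 :=
    Real.exp_le_one_iff.mpr (mul_nonpos_of_nonneg_of_nonpos hm.le h)
  have h2 := Real.exp_pos (-Λ * (t - T))
  exact mul_nonpos_of_nonneg_of_nonpos (by positivity) (by linarith)

lemma bF_pos {ε Λ m T : ℝ} {a b : ℝ → ℝ} {t x : ℝ} (hε : 0 < ε) (hm : 0 < m)
    (hab : a t < b t) (h : 0 < bF ε Λ m T a b t x) : a t < x ∧ x < b t := by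
  have h1 : 0 < (b t - x) * (x - a t) := by
    by_contra hc
    exact absurd h (not_lt.mpr (bF_nonpos hε hm (not_lt.mp hc)))
  rcases mul_pos_iff.mp h1 with ⟨h2, h3⟩ | ⟨h2, h3⟩
  · exact ⟨by linarith, by linarith⟩
  · linarith

lemma bF_le {ε Λ m T R : ℝ} {a b : ℝ → ℝ} {t x : ℝ} (hε : 0 < ε) (hm : 0 < m) (hΛ : 0 < Λ)
    (ht : T ≤ t) (h1 : a t ≤ x) (h2 : x ≤ b t) (hR : b t - a t ≤ R) :
    bF ε Λ m T a b t x ≤ ε * Real.exp (m * R ^ 2) := by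
  unfold bF
  have e1 : Real.exp (-Λ * (t - T)) ≤ 1 := Real.exp_le_one_iff.mpr (by nlinarith)
  have e2 : Real.exp (m * ((b t - x) * (x - a t))) ≤ Real.exp (m * R ^ 2) := by
    apply Real.exp_le_exp.mpr
    gcongr
    nlinarith
  have e0 := Real.exp_pos (-Λ * (t - T))
  have e3 : 1 ≤ Real.exp (m * ((b t - x) * (x - a t))) :=
    Real.one_le_exp (mul_nonneg hm.le (mul_nonneg (by linarith) (by linarith)))
  calc ε * Real.exp (-Λ * (t - T)) * (Real.exp (m * ((b t - x) * (x - a t))) - 1)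
      ≤ ε * 1 * (Real.exp (m * ((b t - x) * (x - a t))) - 1) := by
        gcongr
    _ ≤ _ := by rw [mul_one]; gcongr; linarith

lemma bF_alg {d K Vb R r₀ : ℝ} (hd : 0 < d) (hK : 0 < K) (hV : 0 < Vb) (hR : 0 < R)
    (hr : 0 < r₀) : ∃ m Λ, 0 < m ∧ 0 < Λ ∧ ∀ (ε T : ℝ) (a b a' b' : ℝ → ℝ) (t x : ℝ),
      0 < ε → r₀ ≤ b t - a t → b t - a t ≤ R → |a' t| ≤ Vb → |b' t| ≤ Vb → a t < x → x < b t →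
      bFt ε Λ m T a b a' b' t x - d * bFxx ε Λ m T a b t x + K * bF ε Λ m T a b t x ≤
        - (ε * Real.exp (-Λ * (t - T))) := by
  set Xc := 2 * Vb * R + 2 * d with hX
  have hX0 : 0 < Xc := by positivity
  set m := 4 * (Xc + 1) / (d * r₀ ^ 2) + 16 / (3 * r₀ ^ 2) + 1 with hm
  have m1 : 1 ≤ m := by
    have h1 : 0 < 4 * (Xc + 1) / (d * r₀ ^ 2) := by positivity
    have h2 : 0 < 16 / (3 * r₀ ^ 2) := by positivity
    linarith
  have m2 : Xc + 1 ≤ d * m * (r₀ ^ 2 / 4) := by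
    have h1 : 4 * (Xc + 1) / (d * r₀ ^ 2) ≤ m := by
      have h2 : 0 < 16 / (3 * r₀ ^ 2) := by positivity
      linarith
    rw [div_le_iff₀ (by positivity)] at h1
    linarith
  have m3 : 1 ≤ m * (3 * r₀ ^ 2 / 16) := by
    have h1 : 16 / (3 * r₀ ^ 2) ≤ m := by
      have h2 : 0 < 4 * (Xc + 1) / (d * r₀ ^ 2) := by positivity
      linarith
    rw [div_le_iff₀ (by positivity)] at h1
    linarith
  have hm0 : 0 < m := by linarith
  clear_value m
  refine ⟨m, K + 2 * m * Xc + 1, hm0, by positivity, ?_⟩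
  intro ε T a b a' b' t x hε h1 h2 h3 h4 h5 h6
  set Λ := K + 2 * m * Xc + 1 with hΛ
  set φ := (b t - x) * (x - a t) with hφ
  set φx := a t + b t - 2 * x with hφx
  have hφ0 : 0 < φ := mul_pos (by linarith) (by linarith)
  set E := Real.exp (m * φ) with hE
  have hE1 : 1 + m * φ ≤ E := by
    have := Real.add_one_le_exp (m * φ); linarith
  have hmφ : 0 < m * φ := by positivity
  have hφt : b' t * (x - a t) - (b t - x) * a' t ≤ 2 * Vb * R := by
    have q1 : b' t * (x - a t) ≤ Vb * R := by
      have := (abs_le.mp h4).2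
      calc b' t * (x - a t) ≤ Vb * (x - a t) := by gcongr
        _ ≤ Vb * R := by gcongr; linarith
    have q2 : (b t - x) * (- a' t) ≤ R * Vb := by
      have := (abs_le.mp h3).1
      calc (b t - x) * (- a' t) ≤ (b t - x) * Vb := by gcongr; linarith
        _ ≤ R * Vb := by gcongr; linarith
    linarith
  have key : -Λ * (E - 1) + E * (m * (b' t * (x - a t) - (b t - x) * a' t))
      - d * (E * (m ^ 2 * φx ^ 2 - 2 * m)) + K * (E - 1) ≤ -1 := by
    have k1 : E * (m * (b' t * (x - a t) - (b t - x) * a' t)) ≤ E * (m * (2 * Vb * R)) := by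
      gcongr
    have k2 : E * (m * (2 * Vb * R)) + d * (E * (2 * m)) = E * (m * Xc) := by rw [hX]; ring
    suffices h : E * (m * Xc) - d * E * m ^ 2 * φx ^ 2 - (Λ - K) * (E - 1) ≤ -1 by linarith
    have hΛK : Λ - K = 2 * m * Xc + 1 := by rw [hΛ]; ring
    rw [hΛK]
    have hmX : 0 < m * Xc := by positivity
    by_cases hc : r₀ ^ 2 / 4 ≤ φx ^ 2
    · have q1 : m * (Xc + 1) ≤ m * (d * m * (r₀ ^ 2 / 4)) := by gcongr
      have q2 : d * m ^ 2 * (r₀ ^ 2 / 4) ≤ d * m ^ 2 * φx ^ 2 := by gcongr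
      have q3 : m * Xc - d * m ^ 2 * φx ^ 2 ≤ -1 := by nlinarith
      have q4 : E * (m * Xc - d * m ^ 2 * φx ^ 2) ≤ E * (-1) := by gcongr
      have q5 : 0 ≤ (2 * m * Xc + 1) * (E - 1) := mul_nonneg (by linarith) (by linarith)
      linarith
    · push Not at hc
      have q0 : r₀ ^ 2 ≤ (b t - a t) ^ 2 := by gcongr
      have q1 : 3 * r₀ ^ 2 / 16 ≤ φ := by
        have : 4 * φ = (b t - a t) ^ 2 - φx ^ 2 := by rw [hφ, hφx]; ring
        linarith
      have q2 : m * (3 * r₀ ^ 2 / 16) ≤ m * φ := by gcongr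
      have q3 : 1 ≤ E - 1 := by linarith
      have q4 : 0 ≤ d * E * m ^ 2 * φx ^ 2 := by positivity
      have q5 : m * Xc * 1 ≤ m * Xc * (E - 1) := by gcongr
      linarith
  have hee := Real.exp_pos (-Λ * (t - T))
  have := mul_le_mul_of_nonneg_left key (by positivity : 0 ≤ ε * Real.exp (-Λ * (t - T)))
  unfold bFt bFxx bF
  linarith

section
variable {d δ c : ℝ} {f Q Q1 Q2 : ℝ → ℝ} {β σ κ₀ p₀ x₀ T₂ : ℝ}
  {u : ℝ → ℝ → ℝ} {g h : ℝ → ℝ}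

lemma bb_ge {β p σ c μ s B : ℝ} (hβ : 0 < β) (hp : 0 < p) (hμ : 0 ≤ μ) (hσ : 0 < σ) (hs : 0 ≤ s)
    (hc : σ * p ≤ c) : B ≤ B + (c + μ) * s - σ / β * (p - p * Real.exp (-β * s)) := by
  have h1 := Real.add_one_le_exp (-β * s)
  have h2 : σ / β * (p - p * Real.exp (-β * s)) ≤ σ / β * (p * (β * s)) := by
    have : 0 < σ / β := by positivity
    gcongr
    nlinarith
  have h3 : σ / β * (p * (β * s)) = σ * p * s := by field_simp
  nlinarith [mul_nonneg hμ hs, mul_le_mul_of_nonneg_right hc hs]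


set_option maxHeartbeats 4000000 in
lemma Ctx.excess (X : Ctx d δ c f Q Q1 Q2 β σ κ₀ p₀ u g h x₀ T₂) :
    ∃ Rm > 0, ∀ R η r₀, Rm ≤ R → 0 < η → 0 < r₀ → ∃ κ > 0, ∀ T B p ξ₁,
      Good δ Q β p₀ u h x₀ T₂ T B p → p ≤ p₀ / 2 → R ≤ B - x₀ → 0 ≤ ξ₁ → ξ₁ + r₀ ≤ R →
      (∀ ξ, ξ₁ ≤ ξ → ξ ≤ ξ₁ + r₀ → Q ξ + η ≤ u T (B - ξ)) →
      ∃ T' B' p', T ≤ T' ∧ Good δ Q β p₀ u h x₀ T₂ T' B' p' ∧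
        B - c * T - σ / β * p + κ ≤ B' - c * T' - σ / β * p' := by
  have hδ0 := X.N.δ0
  have hδ1 := X.N.δ1
  have hp0 := X.C.p0
  have hc := X.W.c0
  have hβ := X.C.β0
  have hσc := X.C.σc
  have hσ : 0 < σ := hc.trans hσc
  have hd := X.hd
  have hκ := X.C.κ0
  have W := X.W
  obtain ⟨K, hK0, hK⟩ := X.N.lip 2
  set ϑ := β / (2 * σ) with hϑ
  have hϑ0 : 0 < ϑ := by positivity
  obtain ⟨Rm, hRm, hQsmall⟩ := W.Q1_small hd X.N (ε := κ₀ * ϑ * Real.exp (-β)) (by positivity)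
  refine ⟨Rm, hRm, fun R η r₀ hR hη hr => ?_⟩
  have hR0 : 0 < R := hRm.trans_le hR
  obtain ⟨m, Λ, hm, hΛ, halg⟩ := bF_alg (Vb := 2 * c + R) hd hK0 (by positivity) hR0 hr
  set ε := min 1 η / (2 * Real.exp (m * R ^ 2)) with hε
  have hmin : 0 < min 1 η := lt_min one_pos hη
  have hε0 : 0 < ε := by positivity
  have hεe : ε * Real.exp (m * R ^ 2) = min 1 η / 2 := by rw [hε]; field_simp
  set ε₂ := ε * Real.exp (-Λ) with hε₂
  have hε20 : 0 < ε₂ := by positivity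
  have hε2le : ε₂ ≤ ε := by
    have : Real.exp (-Λ) ≤ 1 := Real.exp_le_one_iff.mpr (by linarith)
    rw [hε₂]; nlinarith
  set μ := min (min (ε₂ * Real.exp (-Λ) * (d / c)) (d / δ * (ε₂ * Real.exp (-Λ) * (m * R))))
    (min c (p₀ / (2 * ϑ))) with hμ
  have hμ0 : 0 < μ := lt_min (lt_min (by positivity) (by positivity)) (lt_min hc (by positivity))
  have μ1 : μ ≤ ε₂ * Real.exp (-Λ) * (d / c) := (min_le_left _ _).trans (min_le_left _ _)
  have μ2 : μ ≤ d / δ * (ε₂ * Real.exp (-Λ) * (m * R)) := (min_le_left _ _).trans (min_le_right _ _)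
  have μ3 : μ ≤ c := (min_le_right _ _).trans (min_le_left _ _)
  have μ4 : ϑ * μ ≤ p₀ / 2 := by
    have : μ ≤ p₀ / (2 * ϑ) := (min_le_right _ _).trans (min_le_right _ _)
    rw [le_div_iff₀ (by positivity)] at this
    linarith
  have μ1' : μ * (c / d) ≤ ε₂ * Real.exp (-Λ) := by
    have : μ * (c / d) ≤ ε₂ * Real.exp (-Λ) * (d / c) * (c / d) := by gcongr
    have e : ε₂ * Real.exp (-Λ) * (d / c) * (c / d) = ε₂ * Real.exp (-Λ) := by field_simp
    linarith
  refine ⟨μ / 2, by positivity, ?_⟩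
  intro T B p ξ₁ G hp hRB hξ hξR hexc
  have hσp : ∀ p', p' ≤ p₀ → σ * p' ≤ c := by
    intro p' hp'
    have h1 := X.C.p2
    have h2 : σ * p' ≤ σ * p₀ := by gcongr
    have h3 := mul_pos hσ hp0
    nlinarith
  -- stage 1
  set P : ℝ → ℝ := fun t => p * Real.exp (-β * (t - T)) with hP
  set b : ℝ → ℝ := fun t => B + (c + 0) * (t - T) - σ / β * (p - P t) with hb
  have db : ∀ t, HasDerivAt b (c + 0 - σ * P t) t := fun t => dBB hβ.ne' p σ B (c + 0) T t
  set br : ℝ → ℝ := fun t => b t - ξ₁ * (1 - (t - T)) with hbr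
  set ar : ℝ → ℝ := fun t => b t - ((ξ₁ + r₀) * (1 - (t - T)) + R * (t - T)) with har
  have dbr : ∀ t, HasDerivAt br (c + 0 - σ * P t + ξ₁) t := by
    intro t
    refine ((db t).fun_sub ((((hasDerivAt_id t).sub_const T).const_sub 1).const_mul ξ₁)).congr_deriv ?_
    ring
  have dar : ∀ t, HasDerivAt ar (c + 0 - σ * P t + (ξ₁ + r₀) - R) t := by
    intro t
    refine ((db t).fun_sub (((((hasDerivAt_id t).sub_const T).const_sub 1).const_mul (ξ₁ + r₀)).fun_add
      (((hasDerivAt_id t).sub_const T).const_mul R))).congr_deriv ?_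
    ring
  have Pp : ∀ t, 0 < P t := fun t => mul_pos G.p0 (Real.exp_pos _)
  have Ple : ∀ t, T ≤ t → P t ≤ p := fun t ht => by
    have : Real.exp (-β * (t - T)) ≤ 1 := Real.exp_le_one_iff.mpr (by nlinarith)
    have := G.p0
    simp only [hP]; nlinarith
  have PT : P T = p := by simp [hP]
  have bT : b T = B := by simp [hb, PT]
  have bge : ∀ t, T ≤ t → B ≤ b t := fun t ht =>
    bb_ge hβ G.p0 le_rfl hσ (by linarith) (hσp p G.pp)
  have width : ∀ t, T ≤ t → t ≤ T + 1 → r₀ ≤ br t - ar t ∧ br t - ar t ≤ R := by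
    intro t h1 h2
    have : br t - ar t = r₀ * (1 - (t - T)) + R * (t - T) := by simp only [hbr, har]; ring
    rw [this]
    constructor <;> nlinarith
  have st1 := X.bump G hK (T' := T + 1) (μ := 0) (by linarith) le_rfl (P := P) (b := b)
    (fun _ => rfl) (fun _ => rfl) (F := bF ε Λ m T ar br)
    (bF_cont ε Λ m T (cont_of_deriv dar) (cont_of_deriv dbr))
    (fun t x => bF_dt ε Λ m T (a' := fun t => c + 0 - σ * P t + (ξ₁ + r₀) - R)
      (b' := fun t => c + 0 - σ * P t + ξ₁) t x (dar t) (dbr t)) (bF_dx ε Λ m T ar br) (bF_dxx ε Λ m T ar br)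
    ?_ ?_ ?_ ?_ ?_ (T + 1) (by linarith) le_rfl
  rotate_left
  · intro x hx1 hx2
    rcases le_or_gt (bF ε Λ m T ar br T x) 0 with hF | hF
    · rw [max_eq_right hF, add_zero]; exact G.low x hx1 hx2
    · rw [max_eq_left hF.le]
      have hw := width T le_rfl (by linarith)
      obtain ⟨k1, k2⟩ := bF_pos hε0 hm (by linarith) hF
      have k3 := bF_le (Λ := Λ) (T := T) (R := R) hε0 hm hΛ le_rfl k1.le k2.le hw.2
      have e1 : ar T = B - (ξ₁ + r₀) := by simp only [har, bT]; ring
      have e2 : br T = B - ξ₁ := by simp only [hbr, bT]; ring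
      rw [e1] at k1
      rw [e2] at k2
      have k4 := hexc (B - x) (by linarith) (by linarith)
      rw [sub_sub_cancel] at k4
      have k5 := W.ge (ξ := B - x) (by linarith)
      have k6 : 0 ≤ p * (Q (B - x) - δ) := mul_nonneg G.p0.le (by linarith)
      have k7 : min 1 η ≤ η := min_le_right _ _
      rw [hεe] at k3
      linarith
  · intro t h1 h2 x h3 h4 h5
    rw [zero_mul]; exact mul_pos hκ (Pp t)
  · intro t h1 h2 x h3 h4 h5
    have hw := width t h1.le h2
    obtain ⟨k1, k2⟩ := bF_pos hε0 hm (by linarith) h5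
    have k3 := bF_le (Λ := Λ) (T := T) (R := R) hε0 hm hΛ h1.le k1.le k2.le hw.2
    have k7 : min 1 η ≤ 1 := min_le_left _ _
    rw [hεe] at k3
    refine ⟨by linarith, ?_⟩
    rw [zero_mul, add_zero]
    have hPl := hσp (P t) ((Ple t h1.le).trans G.pp)
    have hσP : 0 < σ * P t := mul_pos hσ (Pp t)
    refine (halg ε T ar br (fun t => c + 0 - σ * P t + (ξ₁ + r₀) - R)
      (fun t => c + 0 - σ * P t + ξ₁) t x hε0 hw.1 hw.2 ?_ ?_ k1 k2).trans ?_
    · rw [abs_le]; constructor <;> linarith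
    · rw [abs_le]; constructor <;> linarith
    · have := Real.exp_pos (-Λ * (t - T))
      have : 0 < ε * Real.exp (-Λ * (t - T)) := by positivity
      linarith
  · intro t h1 h2
    refine ⟨bF_nonpos hε0 hm ?_, Or.inl rfl⟩
    have e1 : br t - b t = -(ξ₁ * (1 - (t - T))) := by simp only [hbr]; ring
    have e2 : b t - ar t = (ξ₁ + r₀) * (1 - (t - T)) + R * (t - T) := by simp only [har]; ring
    rw [e1, e2]
    have q1 : 0 ≤ ξ₁ * (1 - (t - T)) := mul_nonneg hξ (by linarith)
    have q2 : 0 ≤ (ξ₁ + r₀) * (1 - (t - T)) := mul_nonneg (by linarith) (by linarith)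
    have q3 : 0 ≤ R * (t - T) := mul_nonneg hR0.le (by linarith)
    nlinarith [mul_nonneg q1 (add_nonneg q2 q3)]
  · intro t h1 h2
    refine bF_nonpos hε0 hm ?_
    have hw := width t h1.le h2
    have q1 := bge t h1.le
    have e2 : b t - ar t = (ξ₁ + r₀) * (1 - (t - T)) + R * (t - T) := by simp only [har]; ring
    have q2 : (ξ₁ + r₀) * (1 - (t - T)) ≤ R * (1 - (t - T)) := by gcongr; linarith
    have q3 : x₀ - ar t ≤ 0 := by linarith
    exact mul_nonpos_of_nonneg_of_nonpos (by linarith) q3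
  obtain ⟨s1, s2, s3⟩ := st1
  -- stage 2
  set T1 := T + 1 with hT1
  set B1 := b T1 with hB1
  set p1 := P T1 + ϑ * μ with hp1
  have hP1p := Ple T1 (by linarith)
  have hp1le : p1 ≤ p₀ := by rw [hp1]; linarith
  have hp1pos : 0 < p1 := by have := Pp T1; rw [hp1]; positivity
  have hRB1 : R ≤ B1 - x₀ := by have := bge T1 (by linarith); linarith
  have hϑμ : 0 < ϑ * μ := by positivity
  have lowp : ∀ x, x ≤ B1 → δ + (1 - p1) * (Q (B1 - x) - δ) ≤ δ + (1 - P T1) * (Q (B1 - x) - δ) := by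
    intro x hx
    have := W.ge (ξ := B1 - x) (by linarith)
    have : 0 ≤ ϑ * μ * (Q (B1 - x) - δ) := mul_nonneg hϑμ.le (by linarith)
    rw [hp1]; linarith
  have G1 : Good δ Q β p₀ u h x₀ T₂ T1 B1 p1 := by
    refine ⟨G.hT.trans (by linarith), hp1pos, hp1le, ?_, s1, s2, ?_⟩
    · intro t ht
      have q1 := G.left t (by linarith)
      have q2 : P T1 * Real.exp (-β * (t - T1)) = p * Real.exp (-β * (t - T)) := by
        simp only [hP]
        rw [mul_assoc p, ← Real.exp_add, show -β * (T1 - T) + -β * (t - T1) = -β * (t - T) by ring]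
      have q3 : P T1 * Real.exp (-β * (t - T1)) * (1 - δ) ≤ p1 * Real.exp (-β * (t - T1)) * (1 - δ) := by
        have : 0 ≤ 1 - δ := by linarith
        gcongr
        rw [hp1]; linarith
      rw [q2] at q3
      linarith
    · intro x h1 h2
      have := s3 x h1 h2
      have := le_max_right (bF ε Λ m T ar br T1 x) 0
      have := lowp x h2
      linarith
  set Pb : ℝ → ℝ := fun t => p1 * Real.exp (-β * (t - T1)) with hPb
  set bb : ℝ → ℝ := fun t => B1 + (c + μ) * (t - T1) - σ / β * (p1 - Pb t) with hbb
  have dbb : ∀ t, HasDerivAt bb (c + μ - σ * Pb t) t := fun t => dBB hβ.ne' p1 σ B1 (c + μ) T1 t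
  set a2 : ℝ → ℝ := fun t => bb t - R with ha2
  have da2 : ∀ t, HasDerivAt a2 (c + μ - σ * Pb t) t := fun t => (dbb t).sub_const R
  have Pbp : ∀ t, 0 < Pb t := fun t => mul_pos hp1pos (Real.exp_pos _)
  have Pble : ∀ t, T1 ≤ t → Pb t ≤ p1 := fun t ht => by
    have : Real.exp (-β * (t - T1)) ≤ 1 := Real.exp_le_one_iff.mpr (by nlinarith)
    simp only [hPb]; nlinarith
  have bbge : ∀ t, T1 ≤ t → B1 ≤ bb t := fun t ht =>
    bb_ge hβ hp1pos hμ0.le hσ (by linarith) (hσp p1 hp1le)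
  have PbT : Pb T1 = p1 := by simp [hPb]
  have bbT : bb T1 = B1 := by simp [hbb, PbT]
  have elow : ∀ t, T1 < t → t ≤ T1 + 1 → Real.exp (-Λ) ≤ Real.exp (-Λ * (t - T1)) := by
    intro t h1 h2
    apply Real.exp_le_exp.mpr
    nlinarith
  have st2 := X.bump G1 hK (T' := T1 + 1) (μ := μ) (by linarith) hμ0.le (P := Pb) (b := bb)
    (fun _ => rfl) (fun _ => rfl) (F := bF ε₂ Λ m T1 a2 bb)
    (bF_cont ε₂ Λ m T1 (cont_of_deriv da2) (cont_of_deriv dbb))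
    (fun t x => bF_dt ε₂ Λ m T1 (a' := fun t => c + μ - σ * Pb t)
      (b' := fun t => c + μ - σ * Pb t) t x (da2 t) (dbb t)) (bF_dx ε₂ Λ m T1 a2 bb) (bF_dxx ε₂ Λ m T1 a2 bb)
    ?_ ?_ ?_ ?_ ?_ (T1 + 1) (by linarith) le_rfl
  rotate_left
  · intro x h1 h2
    have q1 := s3 x h1 h2
    have q2 := lowp x h2
    have e : bF ε₂ Λ m T1 a2 bb T1 x = bF ε Λ m T ar br T1 x := by
      have e1 : br T1 = bb T1 := by rw [bbT]; simp only [hbr, hT1]; ring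
      have e2 : ar T1 = a2 T1 := by simp only [ha2]; rw [bbT]; simp only [har, hT1]; ring
      unfold bF
      rw [e1, e2, hε₂, show T1 - T1 = 0 by ring, show T1 - T = 1 by rw [hT1]; ring]
      simp
    rw [e]
    linarith
  · intro t h1 h2 x h3 h4 h5
    have hx : R ≤ bb t - x := by
      by_contra hcon
      push Not at hcon
      have : 0 < bF ε₂ Λ m T1 a2 bb t x := by
        unfold bF
        have : 0 < m * ((bb t - x) * (x - a2 t)) := by
          refine mul_pos hm (mul_pos (by linarith) ?_)
          simp only [ha2]; linarith
        have h1 := Real.one_lt_exp_iff.mpr this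
        have h2 := Real.exp_pos (-Λ * (t - T1))
        exact mul_pos (by positivity) (by linarith)
      linarith
    have q1 := hQsmall (bb t - x) (hR.trans hx)
    have q2 : ϑ * μ * Real.exp (-β) ≤ Pb t := by
      have : Real.exp (-β) ≤ Real.exp (-β * (t - T1)) := by
        apply Real.exp_le_exp.mpr; nlinarith
      simp only [hPb]
      have : ϑ * μ ≤ p1 := by rw [hp1]; have := Pp T1; linarith
      gcongr
    calc μ * Q1 (bb t - x) < μ * (κ₀ * ϑ * Real.exp (-β)) := by gcongr
      _ = κ₀ * (ϑ * μ * Real.exp (-β)) := by ring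
      _ ≤ κ₀ * Pb t := by gcongr
  · intro t h1 h2 x h3 h4 h5
    have hw : bb t - a2 t = R := by simp only [ha2]; ring
    obtain ⟨k1, k2⟩ := bF_pos hε20 hm (by linarith) h5
    have k3 := bF_le (Λ := Λ) (T := T1) (R := R) hε20 hm hΛ h1.le k1.le k2.le hw.le
    have k7 : min 1 η ≤ 1 := min_le_left _ _
    have k8 : ε₂ * Real.exp (m * R ^ 2) ≤ ε * Real.exp (m * R ^ 2) := by gcongr
    refine ⟨by linarith, ?_⟩
    have hPl := hσp (Pb t) ((Pble t h1.le).trans hp1le)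
    have hσP : 0 < σ * Pb t := mul_pos hσ (Pbp t)
    have habs : |c + μ - σ * Pb t| ≤ 2 * c + R := by
      rw [abs_le]; constructor <;> linarith
    have k9 := halg ε₂ T1 a2 bb (fun t => c + μ - σ * Pb t) (fun t => c + μ - σ * Pb t)
      t x hε20 (by linarith) hw.le habs habs k1 k2
    have k10 := elow t h1 h2
    have k11 : ε₂ * Real.exp (-Λ) ≤ ε₂ * Real.exp (-Λ * (t - T1)) := by gcongr
    have k12 : μ * Q1 (bb t - x) ≤ μ * (c / d) := by
      have := W.Q1_le hd X.N (ξ := bb t - x) (by linarith)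
      gcongr
    linarith
  · intro t h1 h2
    have hz : bF ε₂ Λ m T1 a2 bb t (bb t) = 0 := by unfold bF; simp
    refine ⟨hz.le, Or.inr ⟨hz, ?_⟩⟩
    have e : - bFx ε₂ Λ m T1 a2 bb t (bb t) = ε₂ * Real.exp (-Λ * (t - T1)) * (m * R) := by
      unfold bFx
      simp only [sub_self, zero_mul, mul_zero, Real.exp_zero, one_mul, ha2]
      ring
    rw [e]
    refine μ2.trans ?_
    have := elow t h1 h2
    gcongr
  · intro t h1 h2
    refine bF_nonpos hε20 hm ?_
    have q1 := bbge t h1.le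
    have q2 : a2 t = bb t - R := rfl
    exact mul_nonpos_of_nonneg_of_nonpos (by linarith) (by linarith)
  obtain ⟨z1, z2, z3⟩ := st2
  have hle1 := Pble (T1 + 1) (by linarith)
  refine ⟨T1 + 1, bb (T1 + 1), Pb (T1 + 1), by linarith, ⟨G1.hT.trans (by linarith), Pbp _,
    hle1.trans hp1le, ?_, z1, z2, ?_⟩, ?_⟩
  · intro t ht
    have q1 := G1.left t (by linarith)
    have q2 : Pb (T1 + 1) * Real.exp (-β * (t - (T1 + 1))) = p1 * Real.exp (-β * (t - T1)) := by
      simp only [hPb]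
      rw [mul_assoc p1, ← Real.exp_add,
        show -β * (T1 + 1 - T1) + -β * (t - (T1 + 1)) = -β * (t - T1) by ring]
    rw [q2]; exact q1
  · intro x h1 h2
    have := z3 x h1 h2
    have := le_max_right (bF ε₂ Λ m T1 a2 bb (T1 + 1) x) 0
    linarith
  · have e1 : bb (T1 + 1) = B1 + (c + μ) - σ / β * (p1 - Pb (T1 + 1)) := by
      simp only [hbb]; ring
    have e2 : B1 = B + c - σ / β * (p - P T1) := by
      simp only [hB1, hb, hT1]; ring
    have e3 : σ / β * (ϑ * μ) = μ / 2 := by rw [hϑ]; field_simp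
    have e4 : σ / β * p1 = σ / β * P T1 + σ / β * (ϑ * μ) := by rw [hp1]; ring
    rw [e1, e2]
    have : c * (T1 + 1) = c * T + 2 * c := by rw [hT1]; ring
    linarith

end

end FA

open Set Filter Topology

namespace FA

section
variable {d δ c : ℝ} {f Q Q1 Q2 : ℝ → ℝ} {β σ κ₀ p₀ x₀ T₂ : ℝ}
  {u : ℝ → ℝ → ℝ} {g h : ℝ → ℝ}

def dbl (S : Set (ℝ × ℝ)) : Set (ℝ × (ℝ × ℝ)) :=
  {p | (p.1, p.2.1) ∈ S ∧ (p.1, p.2.2) ∈ S ∧ p.2.2 ≤ p.2.1 ∧ p.2.1 - p.2.2 ≤ 1}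

lemma dbl_compact {S : Set (ℝ × ℝ)} (hS : IsCompact S) : IsCompact (dbl S) := by
  have h1 : IsClosed {p : (ℝ × ℝ) × (ℝ × ℝ) | p.1.1 = p.2.1 ∧ p.2.2 ≤ p.1.2 ∧ p.1.2 - p.2.2 ≤ 1} := by
    have k1 : IsClosed {p : (ℝ × ℝ) × (ℝ × ℝ) | p.1.1 = p.2.1} :=
      isClosed_eq (by fun_prop) (by fun_prop)
    have k2 : IsClosed {p : (ℝ × ℝ) × (ℝ × ℝ) | p.2.2 ≤ p.1.2} :=
      isClosed_le (by fun_prop) (by fun_prop)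
    have k3 : IsClosed {p : (ℝ × ℝ) × (ℝ × ℝ) | p.1.2 - p.2.2 ≤ 1} :=
      isClosed_le (by fun_prop) (by fun_prop)
    exact k1.inter (k2.inter k3)
  have h2 := ((hS.prod hS).inter_right h1).image
    (f := fun p : (ℝ × ℝ) × (ℝ × ℝ) => (p.1.1, (p.1.2, p.2.2))) (by fun_prop)
  convert h2 using 1
  ext ⟨t, x, y⟩
  constructor
  · rintro ⟨a1, a2, a3, a4⟩
    exact ⟨((t, x), (t, y)), ⟨⟨a1, a2⟩, rfl, a3, a4⟩, rfl⟩
  · rintro ⟨⟨⟨t1, x1⟩, ⟨t2, y1⟩⟩, ⟨⟨a1, a2⟩, a3, a4, a5⟩, e⟩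
    simp only [Prod.mk.injEq] at e a3
    obtain ⟨rfl, rfl, rfl⟩ := e
    subst a3
    exact ⟨a1, a2, a4, a5⟩

set_option maxHeartbeats 1000000 in
lemma Ctx.qlip (X : Ctx d δ c f Q Q1 Q2 β σ κ₀ p₀ u g h x₀ T₂)
    (hx0 : ∀ ω > 0, ∃ T, ∀ t, T ≤ t → 1 - ω < u t x₀) {ε₀ : ℝ} (hε : 0 < ε₀) :
    ∃ G > 0, ∃ T, T₂ ≤ T ∧ ∀ t, T ≤ t → ∀ x y, x₀ ≤ y → y ≤ x → x ≤ h t →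
      u t x - u t y ≤ ε₀ + G * (x - y) := by
  have hd := X.hd
  have hδ0 := X.N.δ0
  have hδ1 := X.N.δ1
  obtain ⟨Ta, hTa⟩ := hx0 (ε₀ / 4) (by positivity)
  obtain ⟨Tb, hTb0, hTb⟩ := X.S.limsup_one hd X.N (ω := min 1 (ε₀ / 4)) (by positivity)
  set T := max T₂ (max Ta Tb) with hT
  have hT2 : T₂ ≤ T := le_max_left _ _
  have hTTa : Ta ≤ T := (le_max_left _ _).trans (le_max_right _ _)
  have hTTb : Tb ≤ T := (le_max_right _ _).trans (le_max_right _ _)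
  have hT0 : 0 < T := X.hT.trans_le hT2
  clear_value T
  obtain ⟨L, hL0, hL⟩ := X.N.lip 2
  have u2 : ∀ t, T ≤ t → ∀ x, x₀ ≤ x → x ≤ h t → δ ≤ u t x ∧ u t x < 2 ∧ u t x < 1 + ε₀ / 4 := by
    intro t ht x h1 h2
    have q := X.gx t (hT2.trans ht)
    have a1 := hTb t (hTTb.trans ht) x (by linarith) h2
    have a2 := X.le t (hT2.trans ht) x (by linarith) h2
    exact ⟨a2, by linarith [min_le_left 1 (ε₀ / 4)], by linarith [min_le_right 1 (ε₀ / 4)]⟩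
  have hF : ∀ v, 0 ≤ v → v ≤ 2 → |f v| ≤ L * 2 := by
    intro v h1 h2
    have := hL v 0 h1 h2 le_rfl (by norm_num)
    rw [X.N.f0, sub_zero, sub_zero, abs_of_nonneg h1] at this
    exact this.trans (by gcongr)
  set K := L / d + 1 with hK
  have hK0 : 0 < K := by positivity
  have hdK : L < d * K := by rw [hK]; field_simp; linarith
  clear_value K
  -- uniform continuity at T
  have huc : UniformContinuousOn (u T) (Icc x₀ (h T)) :=
    isCompact_Icc.uniformContinuousOn_of_continuous
      (X.S.slice_compact hT0.le (X.gx T hT2).le le_rfl)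
  obtain ⟨r, hr0, hr⟩ := Metric.uniformContinuousOn_iff.mp huc ε₀ hε
  set G := K + 2 / r + 2 with hG
  have hG0 : 0 < G := by positivity
  have hGr : 2 ≤ (G - K) * r := by
    have : (G - K) * r = 2 + 2 * r := by rw [hG]; field_simp; ring
    linarith
  have hGK : 2 ≤ G - K := by
    have : 0 < 2 / r := by positivity
    rw [hG]; linarith
  clear_value G
  refine ⟨G, hG0, T, hT2, ?_⟩
  intro t₁ ht₁ x₁ y₁ hy₁ hxy₁ hx₁
  rcases le_or_gt (x₁ - y₁) 1 with hle1 | hgt1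
  swap
  · have a1 := u2 t₁ ht₁ x₁ (by linarith) hx₁
    have a2 := u2 t₁ ht₁ y₁ hy₁ (by linarith)
    nlinarith
  have hsub : band T t₁ (fun _ => x₀) h ⊆ {p | 0 ≤ p.1 ∧ g p.1 ≤ p.2 ∧ p.2 ≤ h p.1} := by
    rintro ⟨s, x⟩ ⟨⟨b1, b2⟩, b3, b4⟩
    simp only at b1 b2 b3 b4
    exact ⟨by simp only; linarith, (X.gx s (hT2.trans b1)).le.trans b3, b4⟩
  have hcont := X.S.uc.mono hsub
  have hhc : ContinuousOn h (Icc T t₁) := X.S.hc.mono (fun s hs => mem_Ici.mpr (by linarith [hs.1]))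
  have hΩ := dbl_compact (band_compact (A := fun _ => x₀) (B := h) (T := T) (T' := t₁)
    continuousOn_const hhc)
  set Z : ℝ × (ℝ × ℝ) → ℝ := fun p => ε₀ + G * (p.2.1 - p.2.2) - K * (p.2.1 - p.2.2) ^ 2
    - u p.1 p.2.1 + u p.1 p.2.2 with hZ
  have hZc : ContinuousOn Z (dbl (band T t₁ (fun _ => x₀) h)) := by
    have c1 : ContinuousOn (fun p : ℝ × (ℝ × ℝ) => u p.1 p.2.1) (dbl (band T t₁ (fun _ => x₀) h)) :=
      hcont.comp (f := fun p : ℝ × (ℝ × ℝ) => (p.1, p.2.1)) (by fun_prop) (fun p hp => hp.1)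
    have c2 : ContinuousOn (fun p : ℝ × (ℝ × ℝ) => u p.1 p.2.2) (dbl (band T t₁ (fun _ => x₀) h)) :=
      hcont.comp (f := fun p : ℝ × (ℝ × ℝ) => (p.1, p.2.2)) (by fun_prop) (fun p hp => hp.2.1)
    refine (ContinuousOn.sub ?_ c1).add c2
    exact Continuous.continuousOn (by fun_prop)
  have main := first_touch hΩ hZc (by
    rintro t ⟨x, y⟩ ⟨⟨⟨ht1, ht2⟩, hx1, hx2⟩, ⟨-, hy1, hy2⟩, hyx, hxy⟩ hle hearly hmin
    simp only at ht1 ht2 hx1 hx2 hy1 hy2 hyx hxy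
    simp only [hZ] at hle hearly hmin
    obtain ⟨x1, x2, x3⟩ := u2 t ht1 x hx1 hx2
    obtain ⟨y1, y2, y3⟩ := u2 t ht1 y hy1 hy2
    have hr1 : (G - K) * (x - y) ≤ G * (x - y) - K * (x - y) ^ 2 := by
      have : 0 ≤ K * ((x - y) * (1 - (x - y))) :=
        mul_nonneg hK0.le (mul_nonneg (by linarith) (by linarith))
      linarith
    have hr0' : 0 ≤ (G - K) * (x - y) := mul_nonneg (by linarith) (by linarith)
    rcases eq_or_lt_of_le ht1 with e | htT
    · subst e
      rcases lt_or_ge (x - y) r with hlt | hge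
      · have := hr x ⟨hx1, hx2⟩ y ⟨hy1, hy2⟩ (by rw [Real.dist_eq, abs_of_nonneg (by linarith)]; exact hlt)
        rw [Real.dist_eq] at this
        linarith [le_abs_self (u T x - u T y)]
      · have : (G - K) * r ≤ (G - K) * (x - y) := by
          have : 0 ≤ G - K := by linarith
          gcongr
        linarith
    rcases eq_or_lt_of_le hyx with e | hyx'
    · subst e; linarith
    rcases eq_or_lt_of_le hy1 with e | hyA
    · have := hTa t (hTTa.trans ht1)
      rw [e] at this
      linarith
    rcases eq_or_lt_of_le hx2 with e | hxB
    · have := X.S.bh t (by linarith)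
      rw [e, this] at hle
      rw [e] at hr1 hr0'
      linarith
    rcases eq_or_lt_of_le hxy with e | hxy'
    · rw [e] at hr1
      rw [e] at hle
      linarith
    -- interior
    have ht0 : 0 < t := hT0.trans htT
    have hg := X.gx t (hT2.trans ht1)
    have dtx := X.S.ut t ht0 x (by linarith) hxB
    have dty := X.S.ut t ht0 y (by linarith) (by linarith)
    have r1 : -(d * deriv (deriv (u t)) x + f (u t x)) + (d * deriv (deriv (u t)) y + f (u t y)) ≤ 0 := by
      have D := (dtx.const_sub (ε₀ + G * (x - y) - K * (x - y) ^ 2)).fun_add dty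
      refine deriv_nonpos_of_left D ?_
      have hle2 : 𝓝[Ioo T t] t ≤ 𝓝[Icc T t₁] t :=
        nhdsWithin_mono _ (fun s hs => ⟨hs.1.le, hs.2.le.trans ht2⟩)
      have a2 := (hhc t ⟨ht1, ht2⟩).mono_left hle2 |>.eventually (lt_mem_nhds hxB)
      have a3 : ∀ᶠ s in 𝓝[Ioo T t] t, s ∈ Ioo T t := self_mem_nhdsWithin
      rw [nhdsWithin_Ioo_eq_nhdsLT htT] at a2 a3
      filter_upwards [a2, a3] with s b2 b3
      have := hearly s (x, y) ⟨⟨⟨b3.1.le, b3.2.le.trans ht2⟩, hx1, b2.le⟩,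
        ⟨⟨b3.1.le, b3.2.le.trans ht2⟩, hy1, hyx.trans b2.le⟩, hyx, hxy⟩ b3.2
      simp only at this
      linarith
    have r2 : 0 ≤ -(8 * K) - deriv (deriv (u t)) x + deriv (deriv (u t)) y := by
      have ex := X.S.ux_ev ht0 (x := x) (by linarith) hxB
      have ey := X.S.ux_ev ht0 (x := y) (by linarith) (by linarith)
      have tx : Tendsto (fun z : ℝ => x + z) (𝓝 0) (𝓝 x) := by
        have : Continuous fun z : ℝ => x + z := by fun_prop
        simpa using this.tendsto 0
      have ty : Tendsto (fun z : ℝ => y - z) (𝓝 0) (𝓝 y) := by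
        have : Continuous fun z : ℝ => y - z := by fun_prop
        simpa using this.tendsto 0
      refine second_deriv_nonneg (x := (0:ℝ))
        (φ := fun z => ε₀ + G * ((x + z) - (y - z)) - K * ((x + z) - (y - z)) ^ 2
          - u t (x + z) + u t (y - z))
        (φ1 := fun z => 2 * G - 4 * K * (x - y + 2 * z) - deriv (u t) (x + z) - deriv (u t) (y - z))
        ?_ ?_ ?_
      · filter_upwards [tx.eventually ex, ty.eventually ey] with z zx zy
        have d1 : HasDerivAt (fun z : ℝ => x + z) 1 z := (hasDerivAt_id z).const_add x
        have d2 : HasDerivAt (fun z : ℝ => y - z) (-1) z := (hasDerivAt_id z).const_sub y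
        have d3 := d1.fun_sub d2
        have d4 := HasDerivAt.comp z zx d1
        have d5 := HasDerivAt.comp z zy d2
        refine (((((d3.const_mul G).const_add ε₀).fun_sub ((d3.fun_pow 2).const_mul K)).fun_sub d4).fun_add
          d5).congr_deriv ?_
        simp only [Nat.cast_ofNat]; ring
      · have d1 : HasDerivAt (fun z : ℝ => x + z) 1 0 := (hasDerivAt_id 0).const_add x
        have d2 : HasDerivAt (fun z : ℝ => y - z) (-1) 0 := (hasDerivAt_id 0).const_sub y
        have zx := X.S.uxx t ht0 x (by linarith) hxB
        have zy := X.S.uxx t ht0 y (by linarith) (by linarith)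
        have d4 : HasDerivAt (fun z : ℝ => deriv (u t) (x + z)) (deriv (deriv (u t)) x * 1) 0 :=
          HasDerivAt.comp (h₂ := deriv (u t)) 0 (by simpa using zx) d1
        have d5 : HasDerivAt (fun z : ℝ => deriv (u t) (y - z)) (deriv (deriv (u t)) y * (-1)) 0 :=
          HasDerivAt.comp (h₂ := deriv (u t)) 0 (by simpa using zy) d2
        refine ((((((((hasDerivAt_id (0:ℝ)).const_mul 2).const_add (x - y)).const_mul (4 * K)).const_sub
          (2 * G)).fun_sub d4).fun_sub d5)).congr_deriv ?_
        ring
      · have n1 : ∀ᶠ z in 𝓝 (0:ℝ), y < x + z ∧ x + z < h t :=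
          tx.eventually ((lt_mem_nhds hyx').and (gt_mem_nhds hxB))
        have n2 : ∀ᶠ z in 𝓝 (0:ℝ), x₀ < y - z ∧ y - z < x :=
          ty.eventually ((lt_mem_nhds hyA).and (gt_mem_nhds hyx'))
        have tz : Tendsto (fun z : ℝ => (x + z) - (y - z)) (𝓝 0) (𝓝 (x - y)) := tx.sub ty
        have n3 := tz.eventually ((lt_mem_nhds (show 0 < x - y by linarith)).and (gt_mem_nhds hxy'))
        filter_upwards [n1, n2, n3] with z z1 z2 z3
        have := hmin (x + z, y - z) ⟨⟨⟨ht1, ht2⟩, by simp only; linarith, z1.2.le⟩,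
          ⟨⟨ht1, ht2⟩, z2.1.le, by simp only; linarith⟩, by simp only; linarith, z3.2.le⟩
        simpa using this
    have fx := abs_le.mp (hF (u t x) (by linarith) x2.le)
    have fy := abs_le.mp (hF (u t y) (by linarith) y2.le)
    have : d * (8 * K) ≤ d * (deriv (deriv (u t)) y - deriv (deriv (u t)) x) := by
      gcongr; linarith
    nlinarith)
  have := main (t₁, (x₁, y₁)) ⟨⟨⟨ht₁, le_rfl⟩, by simp only; linarith, hx₁⟩,
    ⟨⟨ht₁, le_rfl⟩, hy₁, by simp only; linarith⟩, hxy₁, hle1⟩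
  simp only [hZ] at this
  have : 0 ≤ K * (x₁ - y₁) ^ 2 := by positivity
  linarith

end

end FA

open Set Filter Topology

namespace FA

section
variable {d δ c : ℝ} {f Q Q1 Q2 : ℝ → ℝ} {β σ κ₀ p₀ x₀ T₂ : ℝ}
  {u : ℝ → ℝ → ℝ} {g h : ℝ → ℝ}

lemma WV.lip (W : WV d δ c f Q Q1 Q2) (hd : 0 < d) (N : NL δ f) {a b : ℝ} (ha : 0 ≤ a)
    (hab : a ≤ b) : Q b - Q a ≤ c / d * (b - a) := by
  have h1 : MonotoneOn (fun ξ => c / d * ξ - Q ξ) (Ici 0) := by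
    have hD : ∀ ξ, HasDerivAt (fun ξ => c / d * ξ - Q ξ) (c / d * 1 - Q1 ξ) ξ := fun ξ =>
      ((hasDerivAt_id ξ).const_mul (c / d)).fun_sub (W.dQ ξ)
    refine monotoneOn_of_deriv_nonneg (convex_Ici 0)
      (fun ξ _ => (hD ξ).continuousAt.continuousWithinAt)
      (fun ξ _ => (hD ξ).differentiableAt.differentiableWithinAt) ?_
    intro ξ hξ
    rw [interior_Ici] at hξ
    rw [(hD ξ).deriv]
    have := W.Q1_le hd N (ξ := ξ) (le_of_lt hξ)
    linarith
  have := h1 (mem_Ici.mpr ha) (mem_Ici.mpr (ha.trans hab)) hab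
  simp only at this
  linarith

lemma Ctx.h_mono (X : Ctx d δ c f Q Q1 Q2 β σ κ₀ p₀ u g h x₀ T₂) : MonotoneOn h (Ici T₂) := by
  have hT := X.hT
  have hd := X.hd
  have hδ := X.N.δ0
  refine monotoneOn_of_deriv_nonneg (convex_Ici T₂)
    (X.S.hc.mono (fun s hs => mem_Ici.mpr (hT.le.trans hs)))
    (fun t ht => ?_) ?_
  · rw [interior_Ici] at ht
    exact (X.S.sh t (hT.trans ht)).differentiableAt.differentiableWithinAt
  · intro t ht
    rw [interior_Ici] at ht
    have ht0 : 0 < t := hT.trans ht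
    rw [(X.S.sh t ht0).deriv]
    have hgh := X.S.gh t ht0.le
    have : deriv (u t) (h t) ≤ 0 := by
      refine deriv_nonpos_of_left (X.S.ux t ht0 (h t) hgh.le le_rfl) ?_
      filter_upwards [Ioo_mem_nhdsLT hgh] with x hx
      rw [X.S.bh t ht0.le]
      exact X.le t (le_of_lt ht) x hx.1.le hx.2.le
    have h2 : 0 < d / δ := by positivity
    nlinarith

lemma Good.x0 {T B p : ℝ} (G : Good δ Q β p₀ u h x₀ T₂ T B p) (hβ : 0 < β) (_hδ : δ < 1) :
    ∀ ω > 0, ∃ T, ∀ t, T ≤ t → 1 - ω < u t x₀ := by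
  intro ω hω
  have h1 : Tendsto (fun t : ℝ => p * Real.exp (-β * (t - T)) * (1 - δ)) atTop (𝓝 (p * 0 * (1 - δ))) := by
    refine Tendsto.mul_const _ (Tendsto.const_mul _ (Real.tendsto_exp_atBot.comp ?_))
    exact (tendsto_atTop_add_const_right atTop (-T) tendsto_id).const_mul_atTop_of_neg (by linarith)
  rw [mul_zero, zero_mul] at h1
  obtain ⟨T', hT'⟩ := (h1.eventually (gt_mem_nhds hω)).exists_forall_of_atTop
  refine ⟨max T T', fun t ht => ?_⟩
  have a1 := hT' t ((le_max_right _ _).trans ht)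
  have a2 := G.left t ((le_max_left _ _).trans ht)
  linarith

lemma Ctx.sup (X : Ctx d δ c f Q Q1 Q2 β σ κ₀ p₀ u g h x₀ T₂) {T B p : ℝ}
    (G : Good δ Q β p₀ u h x₀ T₂ T B p) :
    ∃ b, (∀ T B p, Good δ Q β p₀ u h x₀ T₂ T B p → B - c * T - σ / β * p ≤ b) ∧
      ∀ κ > 0, ∃ T B p, Good δ Q β p₀ u h x₀ T₂ T B p ∧ b - κ < B - c * T - σ / β * p := by
  obtain ⟨H, TH, hTH, hH⟩ := X.S.upper X.hd X.N X.W X.C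
  have hσ : 0 < σ := X.W.c0.trans X.C.σc
  have hβ := X.C.β0
  set A : Set ℝ := {v | ∃ T B p, Good δ Q β p₀ u h x₀ T₂ T B p ∧ v = B - c * T - σ / β * p} with hA
  have hne : A.Nonempty := ⟨_, T, B, p, G, rfl⟩
  have hbd : BddAbove A := by
    refine ⟨H, ?_⟩
    rintro v ⟨T, B, p, G, rfl⟩
    obtain ⟨B', G', e⟩ := X.prop G (t := max T TH) (le_max_left _ _)
    have h1 := hH (max T TH) (le_max_right _ _)
    have h2 := G'.Bh
    have h3 : 0 < σ / β * (p * Real.exp (-β * (max T TH - T))) :=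
      mul_pos (by positivity) G'.p0
    linarith
  refine ⟨sSup A, fun T B p G => le_csSup hbd ⟨T, B, p, G, rfl⟩, fun κ hκ => ?_⟩
  obtain ⟨v, ⟨T, B, p, G, rfl⟩, hv⟩ := exists_lt_of_lt_csSup hne (show sSup A - κ < sSup A by linarith)
  exact ⟨T, B, p, G, hv⟩

set_option maxHeartbeats 1000000 in
lemma Ctx.control (X : Ctx d δ c f Q Q1 Q2 β σ κ₀ p₀ u g h x₀ T₂) {T B p : ℝ}
    (G : Good δ Q β p₀ u h x₀ T₂ T B p) :
    ∃ b, ∀ η > 0, ∃ T, T₂ ≤ T ∧ ∀ t, T ≤ t → ∃ B p, Good δ Q β p₀ u h x₀ T₂ t B p ∧ p ≤ η ∧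
      |B - c * t - b| ≤ η ∧ ∀ x, x₀ ≤ x → x ≤ B → u t x < Q (B - x) + η := by
  obtain ⟨b, hb1, hb2⟩ := X.sup G
  have hc := X.W.c0
  have hd := X.hd
  have hσ : 0 < σ := hc.trans X.C.σc
  have hβ := X.C.β0
  have hp0 := X.C.p0
  refine ⟨b, fun η hη => ?_⟩
  obtain ⟨Gq, hGq, Tq, hTq2, hq⟩ := X.qlip (G.x0 hβ X.N.δ1) (ε₀ := η / 4) (by positivity)
  obtain ⟨Rm, hRm, hex⟩ := X.excess
  obtain ⟨R1, hR1⟩ := (X.W.lim.eventually (lt_mem_nhds (show 1 - η / 2 < 1 by linarith))).exists_forall_of_atTop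
  set R := max Rm R1 + 1 with hR
  have hRRm : Rm ≤ R := by rw [hR]; linarith [le_max_left Rm R1]
  have hRR1 : R1 ≤ R - 1 := by rw [hR]; linarith [le_max_right Rm R1]
  have hR0 : 0 < R - 1 := by rw [hR]; linarith [le_max_left Rm R1]
  clear_value R
  set r₀ := min 1 (η / 4 / (Gq + c / d)) with hr₀
  have hr0 : 0 < r₀ := by positivity
  have hr1 : r₀ ≤ 1 := min_le_left _ _
  have hr2 : (Gq + c / d) * r₀ ≤ η / 4 := by
    have : r₀ ≤ η / 4 / (Gq + c / d) := min_le_right _ _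
    rw [le_div_iff₀ (by positivity)] at this
    linarith
  obtain ⟨κ, hκ, hexc⟩ := hex R (η / 2) r₀ hRRm (by positivity) hr0
  obtain ⟨T1, B1, p1, G1, hV⟩ := hb2 (min κ (η / 2)) (by positivity)
  have hV1 : b - κ < B1 - c * T1 - σ / β * p1 := by linarith [min_le_left κ (η / 2)]
  have hV2 : b - η / 2 < B1 - c * T1 - σ / β * p1 := by linarith [min_le_right κ (η / 2)]
  set V := B1 - c * T1 - σ / β * p1 with hVdef
  have hVb : V ≤ b := hb1 _ _ _ G1
  obtain ⟨Tω, hTω0, hTω⟩ := X.S.limsup_one hd X.N (ω := η / 2) (by positivity)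
  have hlim : Tendsto (fun t : ℝ => p1 * Real.exp (-β * (t - T1))) atTop (𝓝 (p1 * 0)) := by
    refine Tendsto.const_mul _ (Real.tendsto_exp_atBot.comp ?_)
    exact (tendsto_atTop_add_const_right atTop (-T1) tendsto_id).const_mul_atTop_of_neg (by linarith)
  rw [mul_zero] at hlim
  have hsm : 0 < min η (min (p₀ / 2) (η * β / (2 * σ))) := by positivity
  obtain ⟨Tp, hTp⟩ := (hlim.eventually (gt_mem_nhds hsm)).exists_forall_of_atTop
  set TT := max (max T₂ Tq) (max (max T1 Tω) (max Tp ((R + x₀ - V) / c))) with hTT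
  refine ⟨TT, (le_max_left _ _).trans (le_max_left _ _), fun t ht => ?_⟩
  have t1 : T₂ ≤ t := ((le_max_left _ _).trans (le_max_left _ _)).trans ht
  have t2 : Tq ≤ t := ((le_max_right _ _).trans (le_max_left _ _)).trans ht
  have t3 : T1 ≤ t := (((le_max_left _ _).trans (le_max_left _ _)).trans (le_max_right _ _)).trans ht
  have t4 : Tω ≤ t := (((le_max_right _ _).trans (le_max_left _ _)).trans (le_max_right _ _)).trans ht
  have t5 : Tp ≤ t := (((le_max_left _ _).trans (le_max_right _ _)).trans (le_max_right _ _)).trans ht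
  have t6 : (R + x₀ - V) / c ≤ t :=
    (((le_max_right _ _).trans (le_max_right _ _)).trans (le_max_right _ _)).trans ht
  obtain ⟨B', G', e⟩ := X.prop G1 t3
  have hpt := hTp t t5
  set p' := p1 * Real.exp (-β * (t - T1)) with hp'
  have q1 : p' ≤ η := hpt.le.trans (min_le_left _ _)
  have q2 : p' ≤ p₀ / 2 := hpt.le.trans ((min_le_right _ _).trans (min_le_left _ _))
  have q3 : p' ≤ η * β / (2 * σ) := hpt.le.trans ((min_le_right _ _).trans (min_le_right _ _))
  have q4 : σ / β * p' ≤ η / 2 := by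
    have : σ / β * p' ≤ σ / β * (η * β / (2 * σ)) := by gcongr
    have e : σ / β * (η * β / (2 * σ)) = η / 2 := by field_simp
    linarith
  have q5 : 0 < σ / β * p' := mul_pos (by positivity) G'.p0
  rw [← hVdef] at e
  have hRB : R ≤ B' - x₀ := by
    rw [div_le_iff₀ hc] at t6
    linarith
  refine ⟨B', p', G', q1, ?_, ?_⟩
  · rw [abs_le]; constructor <;> linarith
  · intro x h1 h2
    rcases le_or_gt (B' - x) (R - 1) with hx | hx
    · by_contra hcon
      push Not at hcon
      have hQ0 : 0 ≤ B' - x := by linarith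
      obtain ⟨T3, B3, p3, -, G3, hV3⟩ := hexc t B' p' (B' - x) G' q2 hRB hQ0 (by linarith) (by
        intro ξ z1 z2
        have a1 := hq t t2 x (B' - ξ) (by linarith) (by linarith) (by linarith [G'.Bh])
        have a2 := X.W.lip hd X.N hQ0 z1
        have a3 : Gq * (x - (B' - ξ)) ≤ Gq * r₀ := by gcongr; linarith
        have a4 : c / d * (ξ - (B' - x)) ≤ c / d * r₀ := by gcongr; linarith
        linarith)
      have := hb1 _ _ _ G3
      linarith
    · have a1 := hR1 (B' - x) (by linarith)
      have a2 := hTω t t4 x (by linarith [X.gx t t1]) (by linarith [G'.Bh])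
      linarith

set_option maxHeartbeats 1000000 in
lemma Ctx.grow (X : Ctx d δ c f Q Q1 Q2 β σ κ₀ p₀ u g h x₀ T₂) {ℓ τ : ℝ} (hℓ : 0 < ℓ) (hτ : 0 < τ) :
    ∃ ν > 0, ∀ t a, T₂ ≤ t → x₀ ≤ a → a + 2 * ℓ < h t → ∀ x, a ≤ x → x ≤ a + 2 * ℓ →
      δ + ν * τ * ((x - a) * (a + 2 * ℓ - x)) < u (t + τ) x := by
  have hd := X.hd
  have hδ0 := X.N.δ0
  obtain ⟨L, hL0, hL⟩ := X.N.lip 2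
  have hf := X.N.fpos δ le_rfl X.N.δ1
  set D := ℓ ^ 2 + 2 * d * τ + L * (τ * ℓ ^ 2) + 1 with hD
  have hD0 : 0 < D := by positivity
  set ν := min (f δ / (2 * D)) (1 / (τ * ℓ ^ 2)) with hν
  have hν0 : 0 < ν := by positivity
  have hν1 : ν * D < f δ := by
    have : ν ≤ f δ / (2 * D) := min_le_left _ _
    rw [le_div_iff₀ (by positivity)] at this
    linarith
  have hν2 : ν * (τ * ℓ ^ 2) ≤ 1 := by
    have : ν ≤ 1 / (τ * ℓ ^ 2) := min_le_right _ _
    rwa [le_div_iff₀ (by positivity)] at this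
  refine ⟨ν, hν0, fun t a ht ha hah => ?_⟩
  have hmono : ∀ s, t ≤ s → a + 2 * ℓ < h s := fun s hs =>
    hah.trans_le (X.h_mono (mem_Ici.mpr ht) (mem_Ici.mpr (ht.trans hs)) hs)
  have hgt : ∀ s, t ≤ s → ∀ x, a ≤ x → x ≤ a + 2 * ℓ → δ < u s x := fun s hs x h1 h2 =>
    X.lt s (ht.trans hs) x (by linarith [X.gx s (ht.trans hs)]) (by linarith [hmono s hs])
  have key := X.S.dcl_low hd (T := t) (T' := t + τ) (by linarith [X.hT])
    (A := fun _ => a) (B := fun _ => a + 2 * ℓ) continuousOn_const continuousOn_const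
    (fun s h1 h2 => (by linarith [X.gx s (ht.trans h1)])) (fun s h1 h2 => (hmono s h1).le)
    (w := fun s x => δ + ν * (s - t) * ((x - a) * (a + 2 * ℓ - x)))
    (Continuous.continuousOn (by fun_prop)) ?_ ?_ ?_ ?_
  · intro x h1 h2
    have := key (t + τ) (by linarith) le_rfl x h1 h2
    simpa using this
  · intro x h1 h2
    have := hgt t le_rfl x h1 h2
    simpa using this
  · intro s h1 h2
    have := hgt s h1.le a le_rfl (by linarith)
    simpa using this
  · intro s h1 h2
    have := hgt s h1.le (a + 2 * ℓ) (by linarith) le_rfl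
    simpa using this
  · intro s h1 h2 x h3 h4 h5
    refine SubAt.smooth (ν * ((x - a) * (a + 2 * ℓ - x)))
      (fun x => ν * (s - t) * (2 * a + 2 * ℓ - 2 * x)) (ν * (s - t) * (-2)) ?_ ?_ ?_ ?_
    · refine ((((((hasDerivAt_id s).sub_const t).const_mul ν).mul_const
        ((x - a) * (a + 2 * ℓ - x))).const_add δ)).congr_deriv ?_
      ring
    · refine Eventually.of_forall fun y => ?_
      refine ((((((hasDerivAt_id y).sub_const a).fun_mul ((hasDerivAt_id y).const_sub (a + 2 * ℓ)))).const_mul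
        (ν * (s - t))).const_add δ).congr_deriv ?_
      simp only [id]; ring
    · refine ((((hasDerivAt_id x).const_mul 2).const_sub (2 * a + 2 * ℓ)).const_mul
        (ν * (s - t))).congr_deriv ?_
      ring
    · set φ := (x - a) * (a + 2 * ℓ - x) with hφ
      have φ0 : 0 < φ := mul_pos (by linarith) (by linarith)
      have φ1 : φ ≤ ℓ ^ 2 := by rw [hφ]; nlinarith [sq_nonneg (x - a - ℓ)]
      have s0 : 0 < s - t := by linarith
      have s1 : s - t ≤ τ := by linarith
      have w1 : ν * (s - t) * φ ≤ ν * (τ * ℓ ^ 2) := by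
        rw [mul_assoc]; gcongr
      have w0 : 0 < ν * (s - t) * φ := by positivity
      have w2 := hL (δ + ν * (s - t) * φ) δ (by linarith) (by linarith [X.N.δ1]) hδ0.le
        (by linarith [X.N.δ1])
      rw [add_sub_cancel_left, abs_of_pos w0] at w2
      have w3 := (abs_le.mp w2).1
      have w4 : L * (ν * (s - t) * φ) ≤ L * (ν * (τ * ℓ ^ 2)) := by gcongr
      have w5 : ν * φ ≤ ν * ℓ ^ 2 := by gcongr
      have w6 : d * (ν * (s - t)) ≤ d * (ν * τ) := by gcongr
      have w7 : ν * D = ν * ℓ ^ 2 + 2 * (d * (ν * τ)) + L * (ν * (τ * ℓ ^ 2)) + ν := by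
        rw [hD]; ring
      linarith

set_option maxHeartbeats 1000000 in
lemma Ctx.conv (X : Ctx d δ c f Q Q1 Q2 β σ κ₀ p₀ u g h x₀ T₂) {T B p : ℝ}
    (G : Good δ Q β p₀ u h x₀ T₂ T B p) :
    ∃ b, Tendsto (fun t => h t - c * t) atTop (𝓝 b) ∧
      ∀ ε > 0, ∃ T, T₂ ≤ T ∧ ∀ t, T ≤ t → ∀ x, h t - 1 ≤ x → x ≤ h t →
        |u t x - Q (h t - x)| ≤ ε := by
  obtain ⟨b, hb⟩ := X.control G
  have hc := X.W.c0
  have hd := X.hd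
  have up : ∀ ℓ > 0, ∃ T, T₂ ≤ T ∧ ∀ t, T ≤ t → h t ≤ c * t + b + 4 * ℓ := by
    intro ℓ hℓ
    set τ := 3 * ℓ / c with hτd
    have hτ : 0 < τ := by positivity
    have hcτ : c * τ = 3 * ℓ := by rw [hτd]; field_simp
    obtain ⟨ν, hν, hgr⟩ := X.grow hℓ hτ
    set η := min (ℓ / 2) (ν * τ * (3 * ℓ ^ 2 / 4)) with hη
    have hη0 : 0 < η := by positivity
    have hη1 : η ≤ ℓ / 2 := min_le_left _ _
    have hη2 : η ≤ ν * τ * (3 * ℓ ^ 2 / 4) := min_le_right _ _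
    obtain ⟨T', hT', hT''⟩ := hb η hη0
    refine ⟨max T' ((x₀ - b) / c), hT'.trans (le_max_left _ _), fun t ht => ?_⟩
    have t1 : T' ≤ t := (le_max_left _ _).trans ht
    have t2 : (x₀ - b) / c ≤ t := (le_max_right _ _).trans ht
    rw [div_le_iff₀ hc] at t2
    by_contra hcon
    push Not at hcon
    obtain ⟨B, p, GB, hp, hB, hu⟩ := hT'' (t + τ) (by linarith)
    obtain ⟨hB1, hB2⟩ := abs_le.mp hB
    have e1 : c * (t + τ) = c * t + 3 * ℓ := by rw [mul_add, hcτ]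
    have a1 := hgr t (c * t + b + 2 * ℓ) (hT'.trans t1) (by linarith) (by linarith) B (by linarith)
      (by linarith)
    have a2 := hu B GB.xB.le le_rfl
    rw [sub_self, X.W.Q0] at a2
    have a3 : 3 * ℓ ^ 2 / 4 ≤ (B - (c * t + b + 2 * ℓ)) * (c * t + b + 2 * ℓ + 2 * ℓ - B) := by
      have b1 : -(ℓ / 2) ≤ B - (c * t + b + 3 * ℓ) := by linarith
      have b2 : B - (c * t + b + 3 * ℓ) ≤ ℓ / 2 := by linarith
      nlinarith
    have a4 : ν * τ * (3 * ℓ ^ 2 / 4) ≤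
        ν * τ * ((B - (c * t + b + 2 * ℓ)) * (c * t + b + 2 * ℓ + 2 * ℓ - B)) := by
      gcongr
    linarith
  refine ⟨b, ?_, ?_⟩
  · rw [Metric.tendsto_atTop]
    intro ε hε
    obtain ⟨Ta, -, hTa⟩ := up (ε / 8) (by positivity)
    obtain ⟨Tb, -, hTb⟩ := hb (ε / 2) (by positivity)
    refine ⟨max Ta Tb, fun t ht => ?_⟩
    have a1 := hTa t ((le_max_left _ _).trans ht)
    obtain ⟨B, p, GB, hp, hB, hu⟩ := hTb t ((le_max_right _ _).trans ht)
    have a2 := GB.Bh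
    have a3 := (abs_le.mp hB).1
    rw [Real.dist_eq, abs_lt]
    constructor <;> linarith
  · intro ε hε
    obtain ⟨Gq, hGq, Tq, hTq2, hq⟩ := X.qlip (G.x0 X.C.β0 X.N.δ1) (ε₀ := ε / 4) (by positivity)
    set η := min (ε / 4) (ε / 4 / (2 * (Gq + c / d))) with hη
    have hη0 : 0 < η := by positivity
    have hη1 : η ≤ ε / 4 := min_le_left _ _
    have hη2 : (Gq + c / d) * (2 * η) ≤ ε / 4 := by
      have : η ≤ ε / 4 / (2 * (Gq + c / d)) := min_le_right _ _
      rw [le_div_iff₀ (by positivity)] at this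
      linarith
    obtain ⟨Ta, hTa2, hTa⟩ := up (η / 4) (by positivity)
    obtain ⟨Tb, hTb2, hTb⟩ := hb η hη0
    refine ⟨max (max Ta Tb) (max Tq ((x₀ + 1 + η - b) / c)),
      hTa2.trans ((le_max_left _ _).trans (le_max_left _ _)), fun t ht => ?_⟩
    have t1 : Ta ≤ t := ((le_max_left _ _).trans (le_max_left _ _)).trans ht
    have t2 : Tb ≤ t := ((le_max_right _ _).trans (le_max_left _ _)).trans ht
    have t3 : Tq ≤ t := ((le_max_left _ _).trans (le_max_right _ _)).trans ht
    have t4 : (x₀ + 1 + η - b) / c ≤ t := ((le_max_right _ _).trans (le_max_right _ _)).trans ht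
    rw [div_le_iff₀ hc] at t4
    obtain ⟨B, p, GB, hp, hB, hu⟩ := hTb t t2
    obtain ⟨hB1, hB2⟩ := abs_le.mp hB
    have hBh := GB.Bh
    have a1 := hTa t t1
    have hhB : h t - B ≤ 2 * η := by linarith
    intro x hx1 hx2
    have hx0 : x₀ ≤ x := by linarith
    have hcd : 0 < c / d := by positivity
    have k1 : c / d * (h t - B) ≤ c / d * (2 * η) := by gcongr
    have hGη : 0 < Gq * (2 * η) := by positivity
    have hcη : 0 < c / d * (2 * η) := by positivity
    rcases le_or_gt x B with hx | hx
    · have z1 := hu x hx0 hx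
      have z2 := GB.low x hx0 hx
      have z3 := X.W.lip hd X.N (a := B - x) (b := h t - x) (by linarith) (by linarith)
      have z4 : Q (B - x) ≤ Q (h t - x) := X.W.mono.monotone (by linarith)
      have z5 := X.W.lt_one (B - x)
      have z6 := X.W.ge (ξ := B - x) (by linarith)
      have z7 : p * (Q (B - x) - δ) ≤ p * 1 := by
        have := GB.p0
        have := X.N.δ0
        gcongr; linarith
      have z8 : h t - x - (B - x) = h t - B := by ring
      rw [z8] at z3
      rw [abs_le]; constructor <;> linarith
    · have z1 := hu B GB.xB.le le_rfl
      rw [sub_self, X.W.Q0] at z1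
      have z2 := hq t t3 x B GB.xB.le hx.le hx2
      have z3 := X.W.lip hd X.N (a := 0) (b := h t - x) le_rfl (by linarith)
      have z4 := X.W.ge (ξ := h t - x) (by linarith)
      have z5 := X.le t (hTa2.trans t1) x (by linarith [X.gx t (hTa2.trans t1)]) hx2
      rw [X.W.Q0] at z3
      have z6 : Gq * (x - B) ≤ Gq * (2 * η) := by gcongr; linarith
      have z7 : c / d * (h t - x - 0) ≤ c / d * (2 * η) := by gcongr; linarith
      rw [abs_le]; constructor <;> linarith

end

end FA

open Set Filter Topology

namespace FA

section
variable {d δ c : ℝ} {f Q Q1 Q2 : ℝ → ℝ} {β σ κ₀ p₀ x₀ T₂ : ℝ}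
  {u : ℝ → ℝ → ℝ} {g h : ℝ → ℝ}

lemma WV.near0 (W : WV d δ c f Q Q1 Q2) {η : ℝ} (hη : 0 < η) :
    ∃ r > 0, ∀ z, 0 ≤ z → z ≤ r → |Q z - δ - c * δ / d * z| ≤ η * z := by
  have h1 := hasDerivAt_iff_isLittleO.mp (W.dQ 0)
  obtain ⟨r, hr, hr'⟩ := Metric.eventually_nhds_iff.mp (h1.def hη)
  refine ⟨r / 2, by positivity, fun z h2 h3 => ?_⟩
  have := hr' (y := z) (by rw [Real.dist_eq, sub_zero, abs_of_nonneg h2]; linarith)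
  simp only [sub_zero, smul_eq_mul, W.Q0, W.Q10, Real.norm_eq_abs, abs_of_nonneg h2] at this
  rwa [mul_comm z] at this

lemma Ctx.bounds (X : Ctx d δ c f Q Q1 Q2 β σ κ₀ p₀ u g h x₀ T₂) :
    ∃ F > 0, ∃ T, T₂ ≤ T ∧ ∀ t, T ≤ t → ∀ x, g t ≤ x → x ≤ h t → |f (u t x)| ≤ F := by
  obtain ⟨Tb, hTb0, hTb⟩ := X.S.limsup_one X.hd X.N (ω := 1) one_pos
  obtain ⟨L, hL0, hL⟩ := X.N.lip 2
  refine ⟨L * 2, by positivity, max T₂ Tb, le_max_left _ _, fun t ht x h1 h2 => ?_⟩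
  have a1 := hTb t ((le_max_right _ _).trans ht) x h1 h2
  have a2 := X.le t ((le_max_left _ _).trans ht) x h1 h2
  have h0 := X.N.δ0.le.trans a2
  have := hL (u t x) 0 h0 (by linarith) le_rfl (by norm_num)
  rw [X.N.f0, sub_zero, sub_zero, abs_of_nonneg h0] at this
  exact this.trans (by gcongr; linarith)

lemma incr {b : ℝ} (hb : Tendsto (fun t => h t - c * t) atTop (𝓝 b)) {e : ℝ} (he : 0 < e) :
    ∃ T, ∀ t s, T ≤ t → T ≤ s → |h t - h s - c * (t - s)| ≤ e := by
  obtain ⟨T, hT⟩ := Metric.tendsto_atTop.mp hb (e / 2) (by positivity)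
  refine ⟨T, fun t s h1 h2 => ?_⟩
  have a1 := hT t h1
  have a2 := hT s h2
  rw [Real.dist_eq, abs_lt] at a1 a2
  rw [abs_le]
  constructor <;> linarith

set_option maxHeartbeats 1000000 in
lemma Ctx.slope_up (X : Ctx d δ c f Q Q1 Q2 β σ κ₀ p₀ u g h x₀ T₂) {b : ℝ}
    (hb : Tendsto (fun t => h t - c * t) atTop (𝓝 b))
    (hprof : ∀ ε > 0, ∃ T, T₂ ≤ T ∧ ∀ t, T ≤ t → ∀ x, h t - 1 ≤ x → x ≤ h t →
        |u t x - Q (h t - x)| ≤ ε) {η : ℝ} (hη : 0 < η) :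
    ∃ T, T₂ ≤ T ∧ ∀ t, T ≤ t → - deriv (u t) (h t) ≤ c * δ / d + η := by
  have hd := X.hd
  have hc := X.W.c0
  have hδ := X.N.δ0
  set q := c * δ / d with hq
  have hq0 : 0 < q := by positivity
  obtain ⟨r₁, hr₁, hQ⟩ := X.W.near0 (η := η / 4) (by positivity)
  rw [← hq] at hQ
  obtain ⟨F, hF0, TF, hTF2, hF⟩ := X.bounds
  set K := F / d with hK
  have hK0 : 0 < K := by positivity
  have hdK : d * K = F := by rw [hK]; field_simp
  clear_value K
  set r := min (min r₁ 1) (η / (4 * K)) with hr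
  have hr0 : 0 < r := by positivity
  have hr1 : r ≤ r₁ := (min_le_left _ _).trans (min_le_left _ _)
  have hr2 : r ≤ 1 := (min_le_left _ _).trans (min_le_right _ _)
  have hr3 : K * r ≤ η / 4 := by
    have : r ≤ η / (4 * K) := min_le_right _ _
    rw [le_div_iff₀ (by positivity)] at this
    linarith
  clear_value r
  set s := r / (2 * c) with hs
  have hs0 : 0 < s := by positivity
  have hcs : c * s = r / 2 := by rw [hs]; field_simp
  clear_value s
  set ε := η * r / 16 with hε
  have hε0 : 0 < ε := by positivity
  obtain ⟨T1, hT1⟩ := incr hb (e := r / 4) (by positivity)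
  obtain ⟨T3, hT3, hpr⟩ := hprof ε hε0
  have hgb : ∃ T, ∀ t, T ≤ t → x₀ + 1 ≤ h t := by
    have : Tendsto h atTop atTop := by
      have h1 : Tendsto (fun t : ℝ => c * t) atTop atTop := tendsto_id.const_mul_atTop hc
      have := hb.add_atTop h1
      simpa using this
    exact (this.eventually_ge_atTop (x₀ + 1)).exists_forall_of_atTop
  obtain ⟨T4, hT4⟩ := hgb
  set T := max (max TF T1) (max T3 T4) with hT
  have m1 : TF ≤ T := (le_max_left _ _).trans (le_max_left _ _)
  have m2 : T1 ≤ T := (le_max_right _ _).trans (le_max_left _ _)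
  have m3 : T3 ≤ T := (le_max_left _ _).trans (le_max_right _ _)
  have m4 : T4 ≤ T := (le_max_right _ _).trans (le_max_right _ _)
  clear_value T
  refine ⟨T + s, by linarith, fun t₁ ht₁ => ?_⟩
  set H := h t₁ with hH
  have hTs : T ≤ t₁ - s := by linarith
  have hmono : ∀ t, t₁ - s ≤ t → t ≤ t₁ → h t ≤ H := fun t h1 h2 =>
    X.h_mono (mem_Ici.mpr (by linarith)) (mem_Ici.mpr (by linarith)) h2
  have hmono2 : ∀ t, t₁ - s ≤ t → t ≤ t₁ → h (t₁ - s) ≤ h t := fun t h1 h2 =>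
    X.h_mono (mem_Ici.mpr (by linarith)) (mem_Ici.mpr (by linarith)) h1
  have hz0 := abs_le.mp (hT1 t₁ (t₁ - s) (by linarith) (by linarith))
  rw [show t₁ - (t₁ - s) = s by ring, hcs, ← hH] at hz0
  have Qup : ∀ z, 0 ≤ z → z ≤ r → Q z ≤ δ + (q + η / 4) * z := by
    intro z z1 z2
    have := (abs_le.mp (hQ z z1 (z2.trans hr1))).2
    linarith
  have hub : ∀ t, t₁ - s ≤ t → t ≤ t₁ → ∀ x, H - r ≤ x → x ≤ h t →
      u t x ≤ δ + (q + η / 4) * (H - x) + ε := by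
    intro t h1 h2 x h3 h4
    have a0 := hmono t h1 h2
    have a1 := abs_le.mp (hpr t (by linarith) x (by linarith) h4)
    have a2 := Qup (H - x) (by linarith) (by linarith)
    have a3 : Q (h t - x) ≤ Q (H - x) := X.W.mono.monotone (by linarith)
    linarith
  have Kz : ∀ z, 0 ≤ z → z ≤ r → K * z ^ 2 ≤ η / 4 * z := by
    intro z z1 z2
    have : K * z ≤ K * r := by gcongr
    nlinarith
  have hgH : ∀ t, t₁ - s ≤ t → g t ≤ H - r := by
    intro t h1
    have a1 := X.gx t (by linarith)
    have a2 := hT4 t₁ (by linarith)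
    linarith
  have key : ∀ ι > 0, ∀ x, H - r ≤ x → x ≤ H → u t₁ x < δ + (q + η) * (H - x) - K * (H - x) ^ 2 + ι := by
    intro ι hι
    have := X.S.dcl_up hd (T := t₁ - s) (T' := t₁) (by linarith [X.hT])
      (A := fun _ => H - r) (B := h) continuousOn_const
      (X.S.hc.mono fun t ht => mem_Ici.mpr (by linarith [ht.1, X.hT]))
      (fun t h1 h2 => hgH t h1) (fun t h1 h2 => le_rfl)
      (w := fun t x => δ + (q + η) * (H - x) - K * (H - x) ^ 2 + ι)
      (Continuous.continuousOn (by fun_prop)) ?_ ?_ ?_ ?_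
    · exact this t₁ (by linarith) le_rfl
    · intro x h1 h2
      have a1 := hub (t₁ - s) le_rfl (by linarith) x h1 h2
      have a2 : r / 4 ≤ H - x := by linarith
      have a3 := Kz (H - x) (by linarith) (by linarith)
      have a4 : η / 2 * (r / 4) ≤ η / 2 * (H - x) := by gcongr
      have a5 : ε = η * r / 16 := hε
      have a6 : 0 < η * r := by positivity
      linarith
    · intro t h1 h2
      have a0 : H - r ≤ h t := by linarith [hmono2 t h1.le h2]
      have a1 := hub t h1.le h2 (H - r) le_rfl a0
      rw [show H - (H - r) = r by ring] at a1 ⊢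
      have a3 := Kz r hr0.le le_rfl
      have a5 : ε = η * r / 16 := hε
      have a6 : 0 < η * r := by positivity
      linarith
    · intro t h1 h2
      have a1 := X.S.bh t (by linarith [X.hT])
      rw [a1]
      have b1 := hmono t h1.le h2
      have b2 := hmono2 t h1.le h2
      have a3 := Kz (H - h t) (by linarith) (by linarith)
      have a4 : 0 ≤ (q + 3 * η / 4) * (H - h t) := mul_nonneg (by positivity) (by linarith)
      linarith
    · intro t h1 h2 x h3 h4 h5
      refine SupAt.smooth 0 (fun x => - (q + η) + 2 * K * (H - x)) (-(2 * K)) (hasDerivAt_const _ _)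
        (Eventually.of_forall fun y => ?_) ?_ ?_
      · have e := (hasDerivAt_id y).const_sub H
        refine ((((e.const_mul (q + η)).const_add δ).fun_sub ((e.fun_pow 2).const_mul K)).add_const
          ι).congr_deriv ?_
        simp only [id, Nat.cast_ofNat]; ring
      · refine ((((hasDerivAt_id x).const_sub H).const_mul (2 * K)).const_add _).congr_deriv ?_
        ring
      · rw [h5]
        have := (abs_le.mp (hF t (by linarith) x (by linarith [hgH t h1.le]) h4.le)).2
        linarith
  have ht0 : 0 < t₁ := by linarith [X.hT]
  have fin : -(q + η) - deriv (u t₁) H ≤ 0 := by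
    have hux := X.S.ux t₁ ht0 H (X.S.gh t₁ ht0.le).le le_rfl
    have D := (((hasDerivAt_id H).const_sub H).const_mul (q + η)).fun_sub hux
    have D' : HasDerivAt (fun x => (q + η) * (H - id x) - u t₁ x) (-(q + η) - deriv (u t₁) H) H :=
      D.congr_deriv (by ring)
    refine deriv_nonpos_of_left D' ?_
    filter_upwards [Ioo_mem_nhdsLT (show H - r < H by linarith)] with x hx
    have b1 := X.S.bh t₁ ht0.le
    rw [← hH] at b1
    simp only [id, sub_self, mul_zero, b1]
    have : u t₁ x ≤ δ + (q + η) * (H - x) := by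
      refine le_of_forall_pos_lt_add fun ι hι => ?_
      have a1 := key ι hι x hx.1.le hx.2.le
      have a2 : 0 ≤ K * (H - x) ^ 2 := by positivity
      linarith
    linarith
  linarith

set_option maxHeartbeats 1000000 in
lemma Ctx.slope_low (X : Ctx d δ c f Q Q1 Q2 β σ κ₀ p₀ u g h x₀ T₂) {b : ℝ}
    (hb : Tendsto (fun t => h t - c * t) atTop (𝓝 b))
    (hprof : ∀ ε > 0, ∃ T, T₂ ≤ T ∧ ∀ t, T ≤ t → ∀ x, h t - 1 ≤ x → x ≤ h t →
        |u t x - Q (h t - x)| ≤ ε) {η : ℝ} (hη : 0 < η) (hηq : η ≤ c * δ / d / 2) :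
    ∃ T, T₂ ≤ T ∧ ∀ t, T ≤ t → c * δ / d - η ≤ - deriv (u t) (h t) := by
  have hd := X.hd
  have hc := X.W.c0
  have hδ := X.N.δ0
  obtain ⟨T5, hT5, hsl⟩ := X.slope_up hb hprof (η := c * δ / d) (by positivity)
  set q := c * δ / d with hq
  have hq0 : 0 < q := by positivity
  have hdq : d / δ * q = c := by rw [hq]; field_simp
  have hlip : ∀ s t, T5 < s → s ≤ t → h t - h s ≤ 2 * c * (t - s) := by
    have hM : MonotoneOn (fun t => 2 * c * t - h t) (Ioi T5) := by
      have hD : ∀ t, T5 < t → HasDerivAt (fun t => 2 * c * t - h t)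
          (2 * c * 1 - -(d / δ) * deriv (u t) (h t)) t := fun t ht =>
        ((hasDerivAt_id t).const_mul (2 * c)).fun_sub (X.S.sh t (by linarith [X.hT]))
      refine monotoneOn_of_deriv_nonneg (convex_Ioi T5)
        (fun t ht => (hD t ht).continuousAt.continuousWithinAt)
        (fun t ht => ?_) (fun t ht => ?_)
      · rw [interior_Ioi] at ht
        exact (hD t ht).differentiableAt.differentiableWithinAt
      · rw [interior_Ioi] at ht
        rw [(hD t ht).deriv]
        have a1 := hsl t (le_of_lt ht)
        have a2 : d / δ * (- deriv (u t) (h t)) ≤ d / δ * (q + q) := by gcongr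
        linarith
    intro s t h1 h2
    have := hM h1 (lt_of_lt_of_le h1 h2) h2
    simp only at this
    linarith
  obtain ⟨r₁, hr₁, hQ⟩ := X.W.near0 (η := η / 4) (by positivity)
  rw [← hq] at hQ
  obtain ⟨F, hF0, TF, hTF2, hF⟩ := X.bounds
  set K := (F + 6 * c * q) / d with hK
  have hK0 : 0 < K := by positivity
  have hdK : d * K = F + 6 * c * q := by rw [hK]; field_simp
  clear_value K
  set r := min (min (r₁ / 2) (1 / 2)) (η / (4 * K)) with hr
  have hr0 : 0 < r := by positivity
  have hr1 : r ≤ r₁ / 2 := (min_le_left _ _).trans (min_le_left _ _)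
  have hr2 : r ≤ 1 / 2 := (min_le_left _ _).trans (min_le_right _ _)
  have hr3 : K * r ≤ η / 4 := by
    have : r ≤ η / (4 * K) := min_le_right _ _
    rw [le_div_iff₀ (by positivity)] at this
    linarith
  clear_value r
  set s := r / (2 * c) with hs
  have hs0 : 0 < s := by positivity
  have hcs : c * s = r / 2 := by rw [hs]; field_simp
  clear_value s
  set ε := η * r / 16 with hε
  have hε0 : 0 < ε := by positivity
  obtain ⟨T1, hT1⟩ := incr hb (e := r / 4) (by positivity)
  obtain ⟨T3, hT3, hpr⟩ := hprof ε hε0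
  have hgb : ∃ T, ∀ t, T ≤ t → x₀ + 2 ≤ h t := by
    have : Tendsto h atTop atTop := by
      have h1 : Tendsto (fun t : ℝ => c * t) atTop atTop := tendsto_id.const_mul_atTop hc
      have := hb.add_atTop h1
      simpa using this
    exact (this.eventually_ge_atTop (x₀ + 2)).exists_forall_of_atTop
  obtain ⟨T4, hT4⟩ := hgb
  set T := max (max TF T1) (max (max T3 T4) (T5 + 1)) with hT
  have m1 : TF ≤ T := (le_max_left _ _).trans (le_max_left _ _)
  have m2 : T1 ≤ T := (le_max_right _ _).trans (le_max_left _ _)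
  have m3 : T3 ≤ T := ((le_max_left _ _).trans (le_max_left _ _)).trans (le_max_right _ _)
  have m4 : T4 ≤ T := ((le_max_right _ _).trans (le_max_left _ _)).trans (le_max_right _ _)
  have m5 : T5 + 1 ≤ T := (le_max_right _ _).trans (le_max_right _ _)
  clear_value T
  refine ⟨T + s, by linarith, fun t₁ ht₁ => ?_⟩
  set H := h t₁ with hH
  have hTs : T ≤ t₁ - s := by linarith
  set hm : ℝ → ℝ := fun t => H - 2 * c * (t₁ - t) with hhm
  have hm1 : ∀ t, t₁ - s ≤ t → t ≤ t₁ → hm t ≤ h t := fun t h1 h2 => by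
    have := hlip t t₁ (by linarith) h2
    simp only [hhm]; linarith
  have hm2 : ∀ t, t₁ - s ≤ t → t ≤ t₁ → h t - hm t ≤ r := fun t h1 h2 => by
    have a1 : h t ≤ H := X.h_mono (mem_Ici.mpr (by linarith)) (mem_Ici.mpr (by linarith)) h2
    have a2 : c * (t₁ - t) ≤ c * s := by gcongr; linarith
    simp only [hhm]; linarith
  have hm3 : r / 4 ≤ h (t₁ - s) - hm (t₁ - s) := by
    have hz0 := abs_le.mp (hT1 t₁ (t₁ - s) (by linarith) (by linarith))
    have e : hm (t₁ - s) = H - 2 * (c * s) := by simp only [hhm]; ring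
    rw [show t₁ - (t₁ - s) = s by ring, hcs, ← hH] at hz0
    rw [e, hcs]
    linarith
  have hdm : ∀ t, HasDerivAt hm (2 * c) t := fun t => by
    refine ((((hasDerivAt_id t).const_sub t₁).const_mul (2 * c)).const_sub H).congr_deriv ?_
    ring
  have hmc : Continuous hm := cont_of_deriv hdm
  have Qlow : ∀ z, 0 ≤ z → z ≤ 2 * r → δ + (q - η / 4) * z ≤ Q z := by
    intro z z1 z2
    have := (abs_le.mp (hQ z z1 (z2.trans (by linarith)))).1
    linarith
  have hlb : ∀ t, t₁ - s ≤ t → t ≤ t₁ → ∀ x, hm t - r ≤ x → x ≤ hm t →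
      δ + (q - η / 4) * (h t - x) - ε ≤ u t x := by
    intro t h1 h2 x h3 h4
    have b1 := hm1 t h1 h2
    have b2 := hm2 t h1 h2
    have a1 := abs_le.mp (hpr t (by linarith) x (by linarith) (by linarith))
    have a2 := Qlow (h t - x) (by linarith) (by linarith)
    linarith
  have Kz : ∀ z, 0 ≤ z → z ≤ r → K * z ^ 2 ≤ η / 4 * z := by
    intro z z1 z2
    have : K * z ≤ K * r := by gcongr
    nlinarith
  have hgH : ∀ t, t₁ - s ≤ t → t ≤ t₁ → g t < hm t - r := by
    intro t h1 h2
    have a1 := X.gx t (by linarith)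
    have a2 := hT4 t (by linarith)
    have a3 := hm2 t h1 h2
    linarith
  have key : ∀ ι > 0, ∀ x, hm t₁ - r ≤ x → x ≤ hm t₁ →
      δ + (q - η) * (hm t₁ - x) + K * (hm t₁ - x) ^ 2 - ι < u t₁ x := by
    intro ι hι
    have := X.S.dcl_low hd (T := t₁ - s) (T' := t₁) (by linarith [X.hT])
      (A := fun t => hm t - r) (B := hm) (Continuous.continuousOn (by fun_prop)) hmc.continuousOn
      (fun t h1 h2 => (hgH t h1 h2).le) (fun t h1 h2 => hm1 t h1 h2)
      (w := fun t x => δ + (q - η) * (hm t - x) + K * (hm t - x) ^ 2 - ι)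
      (Continuous.continuousOn (by fun_prop)) ?_ ?_ ?_ ?_
    · exact this t₁ (by linarith) le_rfl
    · intro x h1 h2
      have a1 := hlb (t₁ - s) le_rfl (by linarith) x h1 h2
      have a3 := Kz (hm (t₁ - s) - x) (by linarith) (by linarith)
      have a4 : (q - η / 4) * (hm (t₁ - s) - x + r / 4) ≤ (q - η / 4) * (h (t₁ - s) - x) := by
        have : 0 ≤ q - η / 4 := by linarith
        gcongr; linarith
      have a5 : ε = η * r / 16 := hε
      have a6 : η * r ≤ q / 2 * r := by gcongr
      have a7 : 0 ≤ η * (hm (t₁ - s) - x) := mul_nonneg hη.le (by linarith)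
      have a8 : 0 < η * r := by positivity
      linarith
    · intro t h1 h2
      have a1 := hlb t h1.le h2 (hm t - r) le_rfl (by linarith)
      have a3 := Kz r hr0.le le_rfl
      have a5 : ε = η * r / 16 := hε
      have a6 : 0 < η * r := by positivity
      have a4 : (q - η / 4) * r ≤ (q - η / 4) * (h t - (hm t - r)) := by
        have : 0 ≤ q - η / 4 := by linarith
        gcongr; linarith [hm1 t h1.le h2]
      rw [show hm t - (hm t - r) = r by ring]
      linarith
    · intro t h1 h2
      have a1 := X.le t (by linarith) (hm t) (by linarith [hgH t h1.le h2]) (hm1 t h1.le h2)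
      rw [sub_self]
      linarith
    · intro t h1 h2 x h3 h4 h5
      refine SubAt.smooth ((q - η) * (2 * c) + K * (2 * (hm t - x) * (2 * c)))
        (fun x => - (q - η) - 2 * K * (hm t - x)) (2 * K) ?_
        (Eventually.of_forall fun y => ?_) ?_ ?_
      · have e := (hdm t).sub_const x
        refine ((((e.const_mul (q - η)).const_add δ).fun_add ((e.fun_pow 2).const_mul K)).sub_const
          ι).congr_deriv ?_
        simp only [Nat.cast_ofNat]; ring
      · have e := (hasDerivAt_id y).const_sub (hm t)
        refine ((((e.const_mul (q - η)).const_add δ).fun_add ((e.fun_pow 2).const_mul K)).sub_const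
          ι).congr_deriv ?_
        simp only [id, Nat.cast_ofNat]; ring
      · refine ((((hasDerivAt_id x).const_sub (hm t)).const_mul (2 * K)).const_sub _).congr_deriv ?_
        ring
      · rw [h5]
        have b1 := (abs_le.mp (hF t (by linarith) x (by linarith [hgH t h1.le h2])
          (by linarith [hm1 t h1.le h2]))).1
        have b2 : K * (hm t - x) ≤ K * r := by gcongr; linarith
        have b3 : c * (K * (hm t - x)) ≤ c * q := by gcongr; linarith
        have b4 : 0 < η * c := by positivity
        have b5 : 0 < c * q := by positivity
        linarith
  have ht0 : 0 < t₁ := by linarith [X.hT]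
  have hmt : hm t₁ = H := by simp [hhm]
  rw [hmt] at key
  have fin : deriv (u t₁) H + (q - η) ≤ 0 := by
    have hux := X.S.ux t₁ ht0 H (X.S.gh t₁ ht0.le).le le_rfl
    have D := hux.fun_sub (((hasDerivAt_id H).const_sub H).const_mul (q - η))
    have D' : HasDerivAt (fun x => u t₁ x - (q - η) * (H - id x)) (deriv (u t₁) H + (q - η)) H :=
      D.congr_deriv (by ring)
    refine deriv_nonpos_of_left D' ?_
    filter_upwards [Ioo_mem_nhdsLT (show H - r < H by linarith)] with x hx
    have b1 := X.S.bh t₁ ht0.le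
    rw [← hH] at b1
    simp only [id, sub_self, mul_zero, b1]
    have : δ + (q - η) * (H - x) ≤ u t₁ x := by
      refine le_of_forall_pos_lt_add fun ι hι => ?_
      have a1 := key ι hι x hx.1.le hx.2.le
      have a2 : 0 ≤ K * (H - x) ^ 2 := by positivity
      linarith
    linarith
  linarith

lemma Ctx.speed (X : Ctx d δ c f Q Q1 Q2 β σ κ₀ p₀ u g h x₀ T₂) {b : ℝ}
    (hb : Tendsto (fun t => h t - c * t) atTop (𝓝 b))
    (hprof : ∀ ε > 0, ∃ T, T₂ ≤ T ∧ ∀ t, T ≤ t → ∀ x, h t - 1 ≤ x → x ≤ h t →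
        |u t x - Q (h t - x)| ≤ ε) : Tendsto (deriv h) atTop (𝓝 c) := by
  have hd := X.hd
  have hc := X.W.c0
  have hδ := X.N.δ0
  rw [Metric.tendsto_atTop]
  intro ε hε
  set η := min (c * δ / d / 2) (δ / d * (ε / 2)) with hη
  have hη0 : 0 < η := by positivity
  have hη2 : d / δ * η ≤ ε / 2 := by
    have : d / δ * η ≤ d / δ * (δ / d * (ε / 2)) := by gcongr; exact min_le_right _ _
    have e : d / δ * (δ / d * (ε / 2)) = ε / 2 := by field_simp
    linarith
  obtain ⟨Ta, hTa, hA⟩ := X.slope_up hb hprof hη0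
  obtain ⟨Tb, hTb, hB⟩ := X.slope_low hb hprof hη0 (min_le_left _ _)
  refine ⟨max Ta Tb, fun t ht => ?_⟩
  have a1 := hA t ((le_max_left _ _).trans ht)
  have a2 := hB t ((le_max_right _ _).trans ht)
  have ht0 : 0 < t := X.hT.trans_le (hTa.trans ((le_max_left _ _).trans ht))
  rw [(X.S.sh t ht0).deriv, Real.dist_eq, abs_lt]
  have e : d / δ * (c * δ / d) = c := by field_simp
  have b1 : d / δ * (- deriv (u t) (h t)) ≤ d / δ * (c * δ / d + η) := by gcongr
  have b2 : d / δ * (c * δ / d - η) ≤ d / δ * (- deriv (u t) (h t)) := by gcongr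
  constructor <;> linarith

end

end FA

open Set Filter Topology
namespace FA

lemma oneSided {d δ c : ℝ} {f q : ℝ → ℝ} {u : ℝ → ℝ → ℝ} {g h : ℝ → ℝ}
    {Q Q1 Q2 : ℝ → ℝ} (S : FB d δ f u g h) (hd : 0 < d)
    (N : NL δ f) (W : WV d δ c f Q Q1 Q2) :
    ∃ b, Tendsto (fun t => h t - c * t) atTop (𝓝 b) ∧ Tendsto (deriv h) atTop (𝓝 c) := by
  obtain ⟨x₀, C, γ, T₂, hC, hγ, hT, hle, hlt, hsp⟩ := S.cosh_spread hd N
  obtain ⟨β₀, σ, κ₀, p₀, hβ₀, hWC⟩ := WC.of W N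
  have hβ : 0 < min β₀ γ := lt_min hβ₀ hγ
  have Cc := hWC (min β₀ γ) hβ (min_le_left _ _)
  generalize hβe : min β₀ γ = β at *
  have hβγ : β ≤ γ := hβe ▸ min_le_right _ _
  have X : Ctx d δ c f Q Q1 Q2 β σ κ₀ p₀ u g h x₀ T₂ :=
    ⟨S, hd, N, W, Cc, hT, hle, hlt, fun t ht => (hsp t ht).1,
      fun t ht => by linarith [(hsp t ht).2.1]⟩
  have hδ1 := N.δ1
  have hp0 := Cc.p0
  have hp1 := Cc.p1
  have hlim : Tendsto (fun t : ℝ => C * Real.exp (-γ * t)) atTop (𝓝 0) := by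
    have h1 : Tendsto (fun t : ℝ => -γ * t) atTop atBot :=
      tendsto_id.const_mul_atTop_of_neg (by linarith)
    simpa using (Real.tendsto_exp_atBot.comp h1).const_mul C
  have hpos : 0 < p₀ * (1 - δ) := mul_pos hp0 (by linarith)
  obtain ⟨T, hT1, hT2⟩ :=
    ((hlim.eventually (gt_mem_nhds hpos)).and (eventually_ge_atTop T₂)).exists
  have G : Good δ Q β p₀ u h x₀ T₂ T (x₀ + 1) p₀ := by
    refine ⟨hT2, hp0, le_rfl, ?_, by linarith, (hsp T hT2).2.1, ?_⟩
    · intro t ht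
      have h1 := (hsp t (hT2.trans ht)).2.2 x₀ le_rfl (by linarith)
      have h2 : Real.exp (-γ * t) ≤ Real.exp (-γ * T) * Real.exp (-β * (t - T)) := by
        rw [← Real.exp_add]
        apply Real.exp_le_exp.mpr
        nlinarith
      have h3 : 0 < Real.exp (-β * (t - T)) := Real.exp_pos _
      have h4 : C * Real.exp (-γ * t) ≤ p₀ * (1 - δ) * Real.exp (-β * (t - T)) := by
        calc C * Real.exp (-γ * t) ≤ C * (Real.exp (-γ * T) * Real.exp (-β * (t - T))) := by
              gcongr
          _ = C * Real.exp (-γ * T) * Real.exp (-β * (t - T)) := by ring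
          _ ≤ _ := by gcongr
      linarith
    · intro x h1 h2
      have h3 := (hsp T hT2).2.2 x h1 h2
      have h4 := W.lt_one (x₀ + 1 - x)
      nlinarith
  obtain ⟨b, hb, hprof⟩ := X.conv G
  exact ⟨b, hb, X.speed hb hprof⟩

lemma FB.ofSol {d δ h₀ : ℝ} {f u₀ : ℝ → ℝ} {u : ℝ → ℝ → ℝ} {g h : ℝ → ℝ} (hh₀ : 0 < h₀)
    (hu₀ : InX δ h₀ u₀)
    (hsol : ClassicalSolution d δ h₀ (fun _ _ v => f v) u₀ (Ici (0:ℝ)) u g h) :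
    FB d δ f u g h := by
  obtain ⟨_, e1, e2, e3⟩ := hu₀
  refine ⟨hsol.g_reg.continuousOn, hsol.h_reg.continuousOn, fun t ht => hsol.g_lt_h t ht, ?_, ?_,
    ?_, ?_, ?_, ?_, ?_, ?_, ?_⟩
  · exact hsol.u_cont
  · intro t ht x h1 h2
    have := (hsol.ut_diff t ht.le ht x ⟨h1, h2⟩).hasDerivAt
    rwa [hsol.pde t ht.le ht x ⟨h1, h2⟩] at this
  · intro t ht x h1 h2
    exact (hsol.ux_diff t ht.le ht x ⟨h1, h2⟩).hasDerivAt
  · intro t ht x h1 h2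
    exact (hsol.uxx_diff t ht.le ht x ⟨h1, h2⟩).hasDerivAt
  · intro t ht
    rcases ht.eq_or_lt with rfl | h0
    · rw [hsol.g_init, hsol.u_init _ ⟨le_rfl, by linarith⟩, e1]
    · exact hsol.bc_g t ht h0
  · intro t ht
    rcases ht.eq_or_lt with rfl | h0
    · rw [hsol.h_init, hsol.u_init _ ⟨by linarith, le_rfl⟩, e2]
    · exact hsol.bc_h t ht h0
  · intro t ht
    have := ((hsol.g_reg.differentiableOn one_ne_zero).differentiableAt
      (Ici_mem_nhds ht)).hasDerivAt
    rwa [hsol.stefan_g t ht.le ht] at this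
  · intro t ht
    have := ((hsol.h_reg.differentiableOn one_ne_zero).differentiableAt
      (Ici_mem_nhds ht)).hasDerivAt
    rwa [hsol.stefan_h t ht.le ht] at this
  · intro x h1 h2
    rw [hsol.g_init] at h1
    rw [hsol.h_init] at h2
    rw [hsol.u_init x ⟨h1, h2⟩]
    exact e3 x ⟨h1, h2⟩

end FA

/-- asymptotics of the fronts in terms of the semi-wave speed `c*`. -/
theorem front_asymptotics (d δ h₀ θ θs c : ℝ) (f u₀ q : ℝ → ℝ)
    (u : ℝ → ℝ → ℝ) (g h : ℝ → ℝ)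
    (hd : 0 < d) (hh₀ : 0 < h₀)
    (hf : AlleeType f θ) (hθs : IsThetaStar f θ θs) (hδ : δ ∈ Ioo θs 1)
    (hsw : SemiWavePair d δ f c q)
    (hu₀ : InX δ h₀ u₀)
    (hsol : ClassicalSolution d δ h₀ (fun _ _ v => f v) u₀ (Ici (0:ℝ)) u g h) :
    ∃ hhat ghat : ℝ,
      Tendsto (fun t => h t - c * t) atTop (nhds hhat) ∧
      Tendsto (fun t => deriv h t) atTop (nhds c) ∧
      Tendsto (fun t => g t + c * t) atTop (nhds ghat) ∧
      Tendsto (fun t => deriv g t) atTop (nhds (-c)) := by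
  have N := FA.NL.of hf hθs hδ
  have S := FA.FB.ofSol hh₀ hu₀ hsol
  obtain ⟨Q, Q1, Q2, W⟩ := FA.WV.of hsw
  obtain ⟨b, hb, hb'⟩ := FA.oneSided (q := q) S hd N W
  obtain ⟨b2, hb2, hb2'⟩ := FA.oneSided (q := q) S.reflect hd N W
  refine ⟨b, -b2, hb, hb', ?_, ?_⟩
  · refine hb2.neg.congr fun t => ?_
    ring
  · refine hb2'.neg.congr fun t => ?_
    rw [deriv.fun_neg, neg_neg]
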